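/- arXiv:2411.07908 — 2 statements merged into one kernel-verified Lean document; each statement's English description precedes it below -/
import Mathlib

section
/- For all integers t ≥ 2 and k ≥ 2, the limit of U_{t+1}(n, tk)/n^k as n → ∞ exists and equals (1/k!) · 1/C(tk−1, k−1), where C(a,b) denotes the binomial coefficient. -/
open Finset

variable {α : Type*} {β : Type*}

/-- An `r`-graph `H` is `t`-cancellative if for any subfamily `𝒜 ⊆ H` of at most `t` edges and
any two further distinct edges `B, C ∈ H` not in `𝒜`, the symmetric difference of `B` and `C`
is not contained in the union of the edges of `𝒜`. -/
def IsCancellative [DecidableEq α] (t : ℕ) (H : Finset (Finset α)) : Prop :=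
  ∀ 𝒜 ⊆ H, 𝒜.card ≤ t → ∀ B ∈ H, ∀ C ∈ H, B ∉ 𝒜 → C ∉ 𝒜 → B ≠ C →
    ¬((B \ C) ∪ (C \ B) ⊆ 𝒜.sup id)

/-- An `r`-graph `H` is `t`-union-free if any two distinct nonempty subfamilies of `H`, each
consisting of at most `t` edges, have distinct unions. -/
def IsUnionFree [DecidableEq α] (t : ℕ) (H : Finset (Finset α)) : Prop :=
  ∀ 𝒜 ⊆ H, ∀ ℬ ⊆ H, 𝒜.Nonempty → ℬ.Nonempty → 𝒜.card ≤ t → ℬ.card ≤ t → 𝒜 ≠ ℬ →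
    𝒜.sup id ≠ ℬ.sup id

/-- An `r`-graph `H` is `t`-cover-free if no edge of `H` is contained in the union of at most
`t` other edges of `H`. -/
def IsCoverFree [DecidableEq α] (t : ℕ) (H : Finset (Finset α)) : Prop :=
  ∀ 𝒜 ⊆ H, 𝒜.card ≤ t → ∀ B ∈ H, B ∉ 𝒜 → ¬(B ⊆ 𝒜.sup id)

/-- `H` is `(v, e)`-free if any `e` distinct edges of `H` have union of size at least `v + 1`. -/
def IsVEFree [DecidableEq α] (v e : ℕ) (H : Finset (Finset α)) : Prop :=
  ∀ 𝒜 ⊆ H, 𝒜.card = e → v + 1 ≤ (𝒜.sup id).card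

/-- The `k`-shadow of `F`: all `k`-subsets of the vertex set contained in some edge of `F`. -/
def kShadow [DecidableEq α] (k : ℕ) (F : Finset (Finset α)) : Finset (Finset α) :=
  F.sup fun A => Finset.powersetCard k A

/-- `J'` is a copy of `J`: the image of `J` under a map injective on the vertex set of `J`. -/
def IsCopyOf [DecidableEq α] [DecidableEq β] (J' : Finset (Finset β))
    (J : Finset (Finset α)) : Prop :=
  ∃ f : α → β, Set.InjOn f ↑(J.sup id) ∧ J' = J.image fun A => A.image f

/-- The matching number of `H` is at most `b`: every subfamily of pairwise disjoint edges
has at most `b` members. -/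
def MatchingNumberLE [DecidableEq α] (H : Finset (Finset α)) (b : ℕ) : Prop :=
  ∀ M ⊆ H, (∀ A ∈ M, ∀ B ∈ M, A ≠ B → Disjoint A B) → M.card ≤ b

/-- `C_t(n, r)`: the maximum number of edges in an `n`-vertex `t`-cancellative `r`-graph. -/
noncomputable def maxCancellative (t n r : ℕ) : ℕ :=
  sSup {N | ∃ H : Finset (Finset (Fin n)),
    (∀ e ∈ H, e.card = r) ∧ IsCancellative t H ∧ H.card = N}

/-- `U_t(n, r)`: the maximum number of edges in an `n`-vertex `t`-union-free `r`-graph. -/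
noncomputable def maxUnionFree (t n r : ℕ) : ℕ :=
  sSup {N | ∃ H : Finset (Finset (Fin n)),
    (∀ e ∈ H, e.card = r) ∧ IsUnionFree t H ∧ H.card = N}

/-- `F_t(n, r)`: the maximum number of edges in an `n`-vertex `t`-cover-free `r`-graph. -/
noncomputable def maxCoverFree (t n r : ℕ) : ℕ :=
  sSup {N | ∃ H : Finset (Finset (Fin n)),
    (∀ e ∈ H, e.card = r) ∧ IsCoverFree t H ∧ H.card = N}

section Greedy

variable {P W : Type*} [DecidableEq P] [Fintype W] [DecidableEq W]

/-- A family of words is a packing when the point sets of its members are pairwise disjoint. -/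
def IsPacking (pts : W → Finset P) (S : Finset W) : Prop :=
  ∀ w ∈ S, ∀ w' ∈ S, w ≠ w' → Disjoint (pts w) (pts w')

/-- Add the word `w` to `S` if it shares no point with the words of `S`. -/
def greedyStep (pts : W → Finset P) (S : Finset W) (w : W) : Finset W :=
  if Disjoint (pts w) (S.biUnion pts) then insert w S else S

/-- Averaging over one step of the random greedy packing process. -/
noncomputable def greedyAverage (pts : W → Finset P) :
    (Finset W → ℝ) →ₗ[ℝ] (Finset W → ℝ) where
  toFun Φ S := (∑ w, Φ (greedyStep pts S w)) / Fintype.card W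
  map_add' Φ Ψ := by
    ext S
    simp [Finset.sum_add_distrib, add_div]
  map_smul' c Φ := by
    ext S
    simp [← Finset.mul_sum, mul_div_assoc]

/-- Expectation of a function of the state of the random greedy packing process after a given
number of steps. -/
noncomputable def greedyMean (pts : W → Finset P) : ℕ → (Finset W → ℝ) →ₗ[ℝ] ℝ
  | 0 => LinearMap.proj ∅
  | τ + 1 => greedyMean pts τ ∘ₗ greedyAverage pts

theorem greedyMean_succ (pts : W → Finset P) (τ : ℕ) (Φ : Finset W → ℝ) :
    greedyMean pts (τ + 1) Φ =
      greedyMean pts τ (fun S => (∑ w, Φ (greedyStep pts S w)) / Fintype.card W) := rfl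

omit [Fintype W] in
theorem isPacking_greedyStep {pts : W → Finset P} {S : Finset W} (hS : IsPacking pts S) (w : W) :
    IsPacking pts (greedyStep pts S w) := by
  unfold greedyStep
  split_ifs with h
  · rw [Finset.disjoint_biUnion_right] at h
    intro a ha b hb hab
    rw [Finset.mem_insert] at ha hb
    rcases ha with rfl | ha <;> rcases hb with rfl | hb
    · exact absurd rfl hab
    · exact h b hb
    · exact (h a ha).symm
    · exact hS a ha b hb hab
  · exact hS

theorem greedyMean_nonneg (pts : W → Finset P) (τ : ℕ) :
    ∀ Φ : Finset W → ℝ, (∀ S, IsPacking pts S → 0 ≤ Φ S) → 0 ≤ greedyMean pts τ Φ := by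
  induction τ with
  | zero =>
    intro Φ h
    exact h ∅ (by simp [IsPacking])
  | succ τ ih =>
    intro Φ h
    rw [greedyMean_succ]
    refine ih _ fun S hS => ?_
    exact div_nonneg (Finset.sum_nonneg fun w _ => h _ (isPacking_greedyStep hS w))
      (Nat.cast_nonneg _)

theorem greedyMean_mono (pts : W → Finset P) (τ : ℕ) {Φ Ψ : Finset W → ℝ}
    (h : ∀ S, IsPacking pts S → Φ S ≤ Ψ S) : greedyMean pts τ Φ ≤ greedyMean pts τ Ψ := by
  have := greedyMean_nonneg pts τ (Ψ - Φ) fun S hS => by simpa using h S hS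
  rw [map_sub] at this
  linarith

theorem greedyMean_one [Nonempty W] (pts : W → Finset P) (τ : ℕ) :
    greedyMean pts τ (fun _ => 1) = 1 := by
  induction τ with
  | zero => rfl
  | succ τ ih =>
    rw [greedyMean_succ]
    simpa using ih

/-- The probability that a given set of words is contained in the greedy packing. -/
theorem greedyMean_superset_le [Nonempty W] (pts : W → Finset P) (τ : ℕ) :
    ∀ T : Finset W, greedyMean pts τ (fun S => if T ⊆ S then 1 else 0) ≤
      (τ / Fintype.card W : ℝ) ^ T.card := by
  have hn : (0 : ℝ) < Fintype.card W := by exact_mod_cast Fintype.card_pos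
  induction τ with
  | zero =>
    intro T
    change (if T ⊆ ∅ then (1 : ℝ) else 0) ≤ _
    rcases T.eq_empty_or_nonempty with rfl | h
    · simp
    · rw [if_neg (by simpa using h.ne_empty)]
      positivity
  | succ τ ih =>
    intro T
    rw [greedyMean_succ]
    have key : ∀ S : Finset W,
        (∑ w, if T ⊆ greedyStep pts S w then (1 : ℝ) else 0) / Fintype.card W ≤
          (if T ⊆ S then 1 else 0) +
            (1 / Fintype.card W : ℝ) * ∑ w ∈ T, if T.erase w ⊆ S then (1 : ℝ) else 0 := by
      intro S
      rw [div_le_iff₀ hn, add_mul, mul_right_comm, one_div_mul_cancel hn.ne', one_mul]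
      have h1 : ∀ w : W, (if T ⊆ greedyStep pts S w then (1 : ℝ) else 0) ≤
          (if T ⊆ S then 1 else 0) + if w ∈ T then (if T.erase w ⊆ S then (1 : ℝ) else 0) else 0 := by
        intro w
        by_cases hT : T ⊆ greedyStep pts S w
        · have h2 : T ⊆ insert w S := by
            refine hT.trans ?_
            unfold greedyStep
            split_ifs
            · rfl
            · exact Finset.subset_insert _ _
          have h3 : T.erase w ⊆ S := Finset.subset_insert_iff.mp h2
          by_cases hw : w ∈ T
          · simp only [hT, hw, h3, if_true]
            split_ifs <;> norm_num
          · rw [Finset.erase_eq_of_notMem hw] at h3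
            simp [hT, hw, h3]
        · rw [if_neg hT]
          split_ifs <;> norm_num
      refine (Finset.sum_le_sum fun w _ => h1 w).trans ?_
      rw [Finset.sum_add_distrib]
      simp [mul_comm, Finset.sum_ite_mem]
    refine (greedyMean_mono pts τ fun S _ => key S).trans ?_
    have h4 : (fun S : Finset W => (if T ⊆ S then (1 : ℝ) else 0) +
          (1 / Fintype.card W : ℝ) * ∑ w ∈ T, if T.erase w ⊆ S then (1 : ℝ) else 0) =
        (fun S => if T ⊆ S then (1 : ℝ) else 0) + (1 / Fintype.card W : ℝ) •
          ∑ w ∈ T, fun S => if T.erase w ⊆ S then (1 : ℝ) else 0 := by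
      ext S
      simp [Finset.sum_apply]
    rw [h4, map_add, map_smul, map_sum]
    have h5 : ∑ w ∈ T, greedyMean pts τ (fun S => if T.erase w ⊆ S then (1 : ℝ) else 0) ≤
        T.card * (τ / Fintype.card W : ℝ) ^ (T.card - 1) := by
      rw [← nsmul_eq_mul]
      refine Finset.sum_le_card_nsmul _ _ _ fun w hw => ?_
      rw [← Finset.card_erase_of_mem hw]
      exact ih _
    have h6 := ih T
    have h7 : (τ / Fintype.card W : ℝ) ^ T.card +
        (1 / Fintype.card W : ℝ) * (T.card * (τ / Fintype.card W : ℝ) ^ (T.card - 1)) ≤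
        ((τ + 1 : ℕ) / Fintype.card W : ℝ) ^ T.card := by
      have hx : (0 : ℝ) ≤ τ / Fintype.card W := by positivity
      have hy : (0 : ℝ) ≤ 1 / Fintype.card W := by positivity
      have : ((τ + 1 : ℕ) / Fintype.card W : ℝ) = τ / Fintype.card W + 1 / Fintype.card W := by
        push_cast
        ring
      rw [this]
      generalize (τ / Fintype.card W : ℝ) = x at hx
      generalize (1 / Fintype.card W : ℝ) = y at hy
      generalize T.card = m
      induction m with
      | zero => simp
      | succ m ihm =>
        calc x ^ (m + 1) + y * ((m + 1 : ℕ) * x ^ (m + 1 - 1))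
            ≤ (x ^ m + y * (m * x ^ (m - 1))) * (x + y) := by
              rcases m with _ | m
              · simp
              · push_cast
                have : 0 ≤ y * ((m + 1) * x ^ m) * y := by positivity
                ring_nf at this ⊢
                linarith
          _ ≤ (x + y) ^ m * (x + y) := by gcongr
          _ = (x + y) ^ (m + 1) := by ring
    calc _ ≤ (τ / Fintype.card W : ℝ) ^ T.card +
        (1 / Fintype.card W : ℝ) * (T.card * (τ / Fintype.card W : ℝ) ^ (T.card - 1)) := by
          rw [smul_eq_mul]
          gcongr
      _ ≤ _ := h7

end Greedy

theorem abs_one_sub_pow_sub_le {x : ℝ} (h0 : 0 ≤ x) (h1 : x ≤ 1) (s : ℕ) :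
    |(1 - x) ^ s - (1 - s * x)| ≤ (s * x) ^ 2 := by
  have hlow : 1 - s * x ≤ (1 - x) ^ s := by
    have := one_add_mul_le_pow (a := -x) (by linarith) s
    rw [sub_eq_add_neg 1 x]
    linarith
  have hup : (1 - x) ^ s ≤ 1 - s * x + (s * x) ^ 2 := by
    induction s with
    | zero => simp
    | succ s ih =>
      have ih := ih (by
        have := one_add_mul_le_pow (a := -x) (by linarith) s
        rw [sub_eq_add_neg 1 x]
        linarith)
      rw [pow_succ]
      have h2 : (1 - x) ^ s * (1 - x) ≤ (1 - s * x + (s * x) ^ 2) * (1 - x) :=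
        mul_le_mul_of_nonneg_right ih (by linarith)
      refine h2.trans ?_
      push_cast
      have h3 : 0 ≤ (s : ℝ) ^ 2 * x ^ 3 := by positivity
      have h4 : 0 ≤ (s : ℝ) * x ^ 2 := by positivity
      nlinarith
  rw [abs_le]
  constructor <;> nlinarith [sq_nonneg ((s : ℝ) * x)]

section ErrorPropagation

/-- Propagation of error bounds through a bounded stretch of an infinite hierarchy of difference
inequalities, in which the error at level `s` is driven by the error at level `s + g`. -/
theorem hierarchy_bound_block {Bd : ℕ → ℕ → ℝ → Prop} {g S τ₀ : ℕ} {ε κ : ℝ} (hε : 0 ≤ ε)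
    (mono : ∀ τ s a b, Bd τ s a → a ≤ b → Bd τ s b) (one : ∀ τ s, Bd τ s 1)
    (step : ∀ τ s a b, s ≤ S → Bd τ s a → Bd τ (s + g) b → 0 ≤ b →
      Bd (τ + 1) s (a + ε * s * b + ε * s * κ))
    (hκ : κ ≤ (1 / 2) ^ S) (h0 : ∀ s ≤ S, Bd τ₀ s ((1 / 2) ^ S)) (i : ℕ)
    (hi : ε * i * 4 ^ (g + 1) ≤ 1) (s : ℕ) :
    Bd (τ₀ + i) s ((1 / 2) ^ S * (2 + 2 * (ε * i * 4 ^ (g + 1))) ^ s) := by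
  induction i generalizing s with
  | zero =>
    rcases le_or_gt s S with hs | hs
    · refine mono _ _ _ _ (h0 s hs) ?_
      have : (1 : ℝ) ≤ 2 ^ s := one_le_pow₀ (by norm_num)
      have h2 : (0 : ℝ) < (1 / 2) ^ S := by positivity
      simp only [Nat.cast_zero, mul_zero, zero_mul, add_zero]
      nlinarith
    · refine mono _ _ _ _ (one _ _) ?_
      simp only [Nat.cast_zero, mul_zero, zero_mul, add_zero]
      calc (1 : ℝ) = (1 / 2) ^ S * 2 ^ S := by rw [← mul_pow]; norm_num
        _ ≤ (1 / 2) ^ S * 2 ^ s := by gcongr; norm_num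
  | succ i ih =>
    have hx0 : 0 ≤ ε * i * 4 ^ (g + 1) := by positivity
    have hxi : ε * i * 4 ^ (g + 1) ≤ 1 := by
      refine le_trans ?_ hi
      gcongr
      simp
    set x : ℝ := ε * i * 4 ^ (g + 1) with hx
    have hx' : ε * (i + 1 : ℕ) * 4 ^ (g + 1) = x + ε * 4 ^ (g + 1) := by
      rw [hx]; push_cast; ring
    rw [hx'] at hi ⊢
    have hy0 : 0 ≤ ε * 4 ^ (g + 1) := by positivity
    rcases le_or_gt s S with hs | hs
    · refine mono _ _ _ _ (step _ s _ _ hs (ih hxi s) (ih hxi (s + g)) (by positivity)) ?_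
      set ρ : ℝ := 2 + 2 * x with hρ
      have hρ2 : 2 ≤ ρ := by linarith
      have hρ4 : ρ ≤ 4 := by linarith
      have hρs : 1 ≤ ρ ^ s := one_le_pow₀ (by linarith)
      have hρg : ρ ^ g ≤ 4 ^ g := by gcongr
      have h4g : (1 : ℝ) ≤ 4 ^ g := one_le_pow₀ (by norm_num)
      have hbern : ρ ^ s + s * (ε * 4 ^ g * 2) * ρ ^ s ≤ (2 + 2 * (x + ε * 4 ^ (g + 1))) ^ s := by
        have h1 : ρ * (1 + ε * 4 ^ g * 2) ≤ 2 + 2 * (x + ε * 4 ^ (g + 1)) := by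
          have : 2 + 2 * (x + ε * 4 ^ (g + 1)) = ρ + 4 * (ε * 4 ^ g * 2) := by
            rw [hρ]; ring
          rw [this]
          have : 0 ≤ ε * 4 ^ g * 2 := by positivity
          nlinarith
        calc ρ ^ s + s * (ε * 4 ^ g * 2) * ρ ^ s = ρ ^ s * (1 + s * (ε * 4 ^ g * 2)) := by ring
          _ ≤ ρ ^ s * (1 + ε * 4 ^ g * 2) ^ s := by
            gcongr
            exact one_add_mul_le_pow (by
              have : 0 ≤ ε * 4 ^ g * 2 := by positivity
              linarith) s
          _ = (ρ * (1 + ε * 4 ^ g * 2)) ^ s := by rw [mul_pow]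
          _ ≤ _ := by gcongr
      have hlam : (0 : ℝ) < (1 / 2) ^ S := by positivity
      set l : ℝ := (1 / 2) ^ S
      calc l * ρ ^ s + ε * s * (l * ρ ^ (s + g)) + ε * s * κ
          ≤ l * ρ ^ s + ε * s * (l * (ρ ^ s * 4 ^ g)) + ε * s * (l * (ρ ^ s * 4 ^ g)) := by
            rw [pow_add]
            gcongr
            calc κ ≤ l := hκ
              _ = l * (1 * 1) := by ring
              _ ≤ l * (ρ ^ s * 4 ^ g) := by gcongr
        _ = l * (ρ ^ s + s * (ε * 4 ^ g * 2) * ρ ^ s) := by ring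
        _ ≤ _ := by gcongr
    · refine mono _ _ _ _ (one _ _) ?_
      calc (1 : ℝ) = (1 / 2) ^ S * 2 ^ S := by rw [← mul_pow]; norm_num
        _ ≤ (1 / 2) ^ S * 2 ^ s := by gcongr; norm_num
        _ ≤ _ := by gcongr; linarith

theorem hierarchy_bound (g j : ℕ) : ∀ (σ : ℕ) (η : ℝ), 0 < η → ∃ S : ℕ, ∃ κ : ℝ, 0 < κ ∧
    ∀ (Bd : ℕ → ℕ → ℝ → Prop) (ε : ℝ) (L : ℕ), 0 ≤ ε → ε * L * 4 ^ (g + 1) ≤ 1 →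
    (∀ τ s a b, Bd τ s a → a ≤ b → Bd τ s b) → (∀ τ s, Bd τ s 1) → (∀ s, Bd 0 s 0) →
    (∀ τ s a b, s ≤ S → Bd τ s a → Bd τ (s + g) b → 0 ≤ b →
      Bd (τ + 1) s (a + ε * s * b + ε * s * κ)) →
    ∀ τ ≤ j * L, ∀ s ≤ σ, Bd τ s η := by
  induction j with
  | zero =>
    intro σ η hη
    refine ⟨0, 1, one_pos, ?_⟩
    intro Bd ε L _ _ mono _ h0 _ τ hτ s _
    obtain rfl : τ = 0 := by simpa using hτ
    exact mono _ _ _ _ (h0 s) hη.le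
  | succ j ih =>
    intro σ η hη
    obtain ⟨m, hm⟩ := exists_pow_lt_of_lt_one (show (0 : ℝ) < η / 4 ^ σ by positivity)
      (show (1 / 2 : ℝ) < 1 by norm_num)
    set S₁ := max m σ with hS₁
    have hS₁' : (1 / 2 : ℝ) ^ S₁ * 4 ^ σ ≤ η := by
      have : (1 / 2 : ℝ) ^ S₁ ≤ (1 / 2) ^ m :=
        pow_le_pow_of_le_one (by norm_num) (by norm_num) (le_max_left _ _)
      rw [← le_div_iff₀ (by positivity)]
      linarith
    obtain ⟨S₂, κ₂, hκ₂, h⟩ := ih S₁ ((1 / 2) ^ S₁) (by positivity)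
    refine ⟨max S₁ S₂, min κ₂ ((1 / 2) ^ S₁), lt_min hκ₂ (by positivity), ?_⟩
    intro Bd ε L hε hL mono one h0 step τ hτ s hs
    have h1 : ∀ τ ≤ j * L, ∀ s ≤ S₁, Bd τ s ((1 / 2) ^ S₁) := by
      refine h Bd ε L hε hL mono one h0 fun τ s a b hs ha hb hb0 => ?_
      refine mono _ _ _ _ (step τ s a b (hs.trans (le_max_right _ _)) ha hb hb0) ?_
      gcongr
      exact min_le_left _ _
    obtain ⟨i, hi⟩ : ∃ i, τ = min τ (j * L) + i := ⟨τ - min τ (j * L), by omega⟩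
    have hiL : i ≤ L := by
      rw [add_mul, one_mul] at hτ
      omega
    have hεi : ε * i * 4 ^ (g + 1) ≤ 1 := by
      refine le_trans ?_ hL
      gcongr
    have h2 := hierarchy_bound_block (S := S₁) hε mono one
      (fun τ s a b hs => step τ s a b (hs.trans (le_max_left _ _))) (min_le_right _ _)
      (h1 (min τ (j * L)) (min_le_right _ _)) i hεi s
    rw [← hi] at h2
    refine mono _ _ _ _ h2 (le_trans ?_ hS₁')
    have h0i : 0 ≤ ε * i * 4 ^ (g + 1) := by positivity
    calc (1 / 2 : ℝ) ^ S₁ * (2 + 2 * (ε * i * 4 ^ (g + 1))) ^ s ≤ (1 / 2) ^ S₁ * 4 ^ s := by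
          gcongr
          linarith
      _ ≤ _ := by gcongr; norm_num

end ErrorPropagation

section Greedy

variable {P W : Type*} [DecidableEq P] [Fintype W] [DecidableEq W]

/-- The probability that the greedy packing leaves all points of `J` uncovered. -/
noncomputable def uncoveredProb (pts : W → Finset P) (τ : ℕ) (J : Finset P) : ℝ :=
  greedyMean pts τ (fun S => if Disjoint J (S.biUnion pts) then 1 else 0)

theorem uncoveredProb_zero (pts : W → Finset P) (J : Finset P) : uncoveredProb pts 0 J = 1 := by
  change (if Disjoint J ((∅ : Finset W).biUnion pts) then (1 : ℝ) else 0) = 1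
  simp

theorem uncoveredProb_nonneg (pts : W → Finset P) (τ : ℕ) (J : Finset P) :
    0 ≤ uncoveredProb pts τ J :=
  greedyMean_nonneg _ _ _ fun S _ => by split_ifs <;> norm_num

theorem uncoveredProb_le_one [Nonempty W] (pts : W → Finset P) (τ : ℕ) (J : Finset P) :
    uncoveredProb pts τ J ≤ 1 := by
  rw [← greedyMean_one pts τ]
  exact greedyMean_mono _ _ fun S _ => by split_ifs <;> norm_num

theorem uncoveredProb_succ [Nonempty W] (pts : W → Finset P) (τ : ℕ) (J : Finset P) :
    uncoveredProb pts (τ + 1) J = uncoveredProb pts τ J -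
      (∑ w, if Disjoint J (pts w) then 0 else uncoveredProb pts τ (J ∪ pts w)) /
        Fintype.card W := by
  have hn : (Fintype.card W : ℝ) ≠ 0 := by exact_mod_cast Fintype.card_ne_zero
  have key : ∀ (S : Finset W) (w : W),
      (if Disjoint J ((greedyStep pts S w).biUnion pts) then (1 : ℝ) else 0) =
        (if Disjoint J (S.biUnion pts) then 1 else 0) -
          if Disjoint J (pts w) then 0 else
            if Disjoint (J ∪ pts w) (S.biUnion pts) then 1 else 0 := by
    intro S w
    unfold greedyStep
    by_cases h1 : Disjoint (pts w) (S.biUnion pts) <;> by_cases h2 : Disjoint J (pts w) <;>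
      by_cases h3 : Disjoint J (S.biUnion pts) <;>
      simp only [h1, h2, h3, if_true, if_false, Finset.biUnion_insert, Finset.disjoint_union_left,
        Finset.disjoint_union_right, and_true, and_false] <;> norm_num
  unfold uncoveredProb
  rw [greedyMean_succ]
  have h4 : (fun S => (∑ w, if Disjoint J ((greedyStep pts S w).biUnion pts) then (1 : ℝ) else 0) /
        Fintype.card W) =
      (fun S => if Disjoint J (S.biUnion pts) then (1 : ℝ) else 0) - (1 / Fintype.card W : ℝ) •
        ∑ w, (if Disjoint J (pts w) then (0 : ℝ) else 1) •
          fun S => if Disjoint (J ∪ pts w) (S.biUnion pts) then (1 : ℝ) else 0 := by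
    ext S
    simp only [key, Finset.sum_sub_distrib, Pi.sub_apply, Pi.smul_apply, Finset.sum_apply,
      smul_eq_mul, ite_mul, one_mul, zero_mul, Finset.sum_const, Finset.card_univ, nsmul_eq_mul]
    field_simp
  rw [h4, map_sub, map_smul, map_sum]
  congr 1
  rw [smul_eq_mul, one_div_mul_eq_div]
  congr 1
  refine Finset.sum_congr rfl fun w _ => ?_
  rw [map_smul, smul_eq_mul]
  split_ifs <;> simp

omit [DecidableEq W] in
theorem sum_card_inter_eq_of_regular {pts : W → Finset P} {Δ : ℕ} {J : Finset P}
    (hdeg : ∀ p ∈ J, (univ.filter fun w => p ∈ pts w).card = Δ) :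
    ∑ w, (J ∩ pts w).card = J.card * Δ := by
  have h1 : ∀ w : W, (J ∩ pts w).card = ∑ p ∈ J, if p ∈ pts w then 1 else 0 := by
    intro w
    rw [Finset.card_eq_sum_ones, ← Finset.filter_mem_eq_inter, Finset.sum_filter]
  simp_rw [h1]
  rw [Finset.sum_comm]
  simp_rw [← Finset.card_filter]
  rw [Finset.sum_congr rfl hdeg, Finset.sum_const, smul_eq_mul]

omit [DecidableEq W] in
theorem sum_card_offDiag_inter_le {pts : W → Finset P} {c : ℝ} {J : Finset P}
    (hco : ∀ p ∈ J, ∀ p' ∈ J, p ≠ p' →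
      ((univ.filter fun w => p ∈ pts w ∧ p' ∈ pts w).card : ℝ) ≤ c) :
    (∑ w, ((J ∩ pts w).offDiag.card : ℝ)) ≤ J.offDiag.card * c := by
  have h1 : ∀ w : W, (((J ∩ pts w).offDiag).card : ℝ) =
      ∑ x ∈ J.offDiag, if x.1 ∈ pts w ∧ x.2 ∈ pts w then (1 : ℝ) else 0 := by
    intro w
    rw [← Finset.sum_filter, Finset.sum_const, nsmul_eq_mul, mul_one]
    congr 2
    ext x
    simp only [Finset.mem_offDiag, Finset.mem_inter, Finset.mem_filter]
    tauto
  simp_rw [h1]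
  rw [Finset.sum_comm, ← nsmul_eq_mul]
  refine Finset.sum_le_card_nsmul _ _ _ fun x hx => ?_
  rw [Finset.mem_offDiag] at hx
  rw [← Finset.sum_filter, Finset.sum_const, nsmul_eq_mul, mul_one]
  exact hco _ hx.1 _ hx.2.1 hx.2.2

theorem abs_uncoveredProb_succ_sub_le [Nonempty W] {pts : W → Finset P} {g Δ τ : ℕ}
    {δ u B : ℝ} {J : Finset P} (hB : 0 ≤ B) (hu0 : 0 ≤ u) (hu1 : u ≤ 1) (hδ : 0 ≤ δ)
    (hg : ∀ w, (pts w).card = g + 1)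
    (hdeg : ∀ p ∈ J, (univ.filter fun w => p ∈ pts w).card = Δ)
    (hco : ∀ p ∈ J, ∀ p' ∈ J, p ≠ p' →
      ((univ.filter fun w => p ∈ pts w ∧ p' ∈ pts w).card : ℝ) ≤ δ * Δ)
    (hΔ : (Δ : ℝ) / Fintype.card W ≤ 1)
    (ih : ∀ w, (J ∪ pts w).card = J.card + g →
      |uncoveredProb pts τ (J ∪ pts w) - u ^ (J.card + g)| ≤ B) :
    |uncoveredProb pts (τ + 1) J - (u - Δ / Fintype.card W * u ^ (g + 1)) ^ J.card| ≤
      |uncoveredProb pts τ J - u ^ J.card| + Δ / Fintype.card W * J.card * B +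
        Δ / Fintype.card W * J.card * (J.card * (δ + Δ / Fintype.card W)) := by
  have hn : (0 : ℝ) < Fintype.card W := by exact_mod_cast Fintype.card_pos
  set s := J.card with hs
  set n : ℝ := (Fintype.card W : ℝ)
  set ε : ℝ := Δ / n with hε
  have hε0 : 0 ≤ ε := by positivity
  set X : ℝ := ∑ w, if Disjoint J (pts w) then 0 else uncoveredProb pts τ (J ∪ pts w) with hX
  have hY : ∑ w, ((J ∩ pts w).card : ℝ) = s * Δ := by
    exact_mod_cast sum_card_inter_eq_of_regular hdeg
  have hXY : |X - s * Δ * u ^ (s + g)| ≤ s * Δ * B + s ^ 2 * (δ * Δ) := by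
    have hpt : ∀ w, |(if Disjoint J (pts w) then 0 else uncoveredProb pts τ (J ∪ pts w)) -
        (J ∩ pts w).card * u ^ (s + g)| ≤ (J ∩ pts w).card * B + ((J ∩ pts w).offDiag.card : ℝ) := by
      intro w
      have hcard := Finset.card_union_add_card_inter J (pts w)
      rw [hg w] at hcard
      by_cases hd : Disjoint J (pts w)
      · have hd' := Finset.disjoint_iff_inter_eq_empty.mp hd
        simp [hd, hd']
      · rw [if_neg hd]
        have hc0 : (J ∩ pts w).card ≠ 0 := by
          rwa [Ne, Finset.card_eq_zero, ← Finset.disjoint_iff_inter_eq_empty]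
        have hoff := Finset.offDiag_card (J ∩ pts w)
        generalize (J ∩ pts w).offDiag.card = o at hoff ⊢
        generalize (J ∩ pts w).card = c at *
        by_cases hc1 : c = 1
        · subst hc1
          have := ih w (by omega)
          have ho : (0 : ℝ) ≤ o := by positivity
          simp only [Nat.cast_one, one_mul]
          linarith
        · have hc2 : 2 ≤ c := by omega
          have ho : c ≤ o := by
            rw [hoff]
            have : 2 * c ≤ c * c := Nat.mul_le_mul_right c hc2
            omega
          have ho' : (c : ℝ) ≤ o := by exact_mod_cast ho
          have hc2' : (2 : ℝ) ≤ c := by exact_mod_cast hc2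
          have hp0 := uncoveredProb_nonneg pts τ (J ∪ pts w)
          have hp1 := uncoveredProb_le_one pts τ (J ∪ pts w)
          have hv0 : 0 ≤ u ^ (s + g) := by positivity
          have hv1 : u ^ (s + g) ≤ 1 := pow_le_one₀ hu0 hu1
          have hcB : 0 ≤ c * B := by positivity
          rw [abs_le]
          constructor <;> nlinarith
    rw [← hY, Finset.sum_mul, hX, ← Finset.sum_sub_distrib]
    refine (Finset.abs_sum_le_sum_abs _ _).trans ((Finset.sum_le_sum fun w _ => hpt w).trans ?_)
    rw [Finset.sum_add_distrib, ← Finset.sum_mul]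
    gcongr
    refine (sum_card_offDiag_inter_le hco).trans ?_
    gcongr
    rw [Finset.offDiag_card, ← hs]
    have : s * s - s ≤ s ^ 2 := by rw [sq]; omega
    exact_mod_cast this
  have hXn : |X / n - ε * s * u ^ (s + g)| ≤ ε * s * B + ε * s * (s * δ) := by
    have h1 : X / n - ε * s * u ^ (s + g) = (X - s * Δ * u ^ (s + g)) / n := by
      rw [hε]; ring
    rw [h1, abs_div, abs_of_pos hn, div_le_iff₀ hn]
    refine hXY.trans (le_of_eq ?_)
    rw [hε]
    field_simp
  have hz0 : 0 ≤ ε * u ^ g := by positivity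
  have hug : u ^ g ≤ 1 := pow_le_one₀ hu0 hu1
  have hz1 : ε * u ^ g ≤ 1 := by nlinarith [pow_nonneg hu0 g]
  have hpow : |(u - ε * u ^ (g + 1)) ^ s - (u ^ s - ε * s * u ^ (s + g))| ≤ ε * s * (s * ε) := by
    have h1 : (u - ε * u ^ (g + 1)) ^ s - (u ^ s - ε * s * u ^ (s + g)) =
        u ^ s * ((1 - ε * u ^ g) ^ s - (1 - s * (ε * u ^ g))) := by
      have : u - ε * u ^ (g + 1) = u * (1 - ε * u ^ g) := by ring
      rw [this, mul_pow]
      ring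
    rw [h1, abs_mul, abs_of_nonneg (by positivity)]
    have h2 := abs_one_sub_pow_sub_le hz0 hz1 s
    have h3 : u ^ s ≤ 1 := pow_le_one₀ hu0 hu1
    calc u ^ s * |(1 - ε * u ^ g) ^ s - (1 - s * (ε * u ^ g))| ≤ 1 * (s * (ε * u ^ g)) ^ 2 := by
          gcongr
      _ ≤ 1 * (s * (ε * 1)) ^ 2 := by gcongr
      _ = _ := by ring
  rw [uncoveredProb_succ]
  have : uncoveredProb pts τ J - X / n - (u - ε * u ^ (g + 1)) ^ s =
      (uncoveredProb pts τ J - u ^ s) - (X / n - ε * s * u ^ (s + g)) -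
        ((u - ε * u ^ (g + 1)) ^ s - (u ^ s - ε * s * u ^ (s + g))) := by ring
  rw [this]
  refine (abs_sub _ _).trans ?_
  have h5 := abs_sub (uncoveredProb pts τ J - u ^ s) (X / n - ε * s * u ^ (s + g))
  nlinarith

end Greedy

universe u v

theorem exists_le_of_recursion {u : ℕ → ℝ} {ε θ : ℝ} {g n : ℕ} (hε : 0 ≤ ε) (hε1 : ε ≤ 1)
    (h0 : u 0 = 1) (hrec : ∀ τ, u (τ + 1) = u τ - ε * u τ ^ (g + 1)) (hθ : 0 < θ)
    (hn : 1 ≤ n * (ε * θ ^ (g + 1))) :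
    (∀ τ, 0 ≤ u τ ∧ u τ ≤ 1) ∧ u n ≤ θ := by
  have hb : ∀ τ, 0 ≤ u τ ∧ u τ ≤ 1 := by
    intro τ
    induction τ with
    | zero => simp [h0]
    | succ τ ih =>
      obtain ⟨h1, h2⟩ := ih
      have h3 : u τ ^ g ≤ 1 := pow_le_one₀ h1 h2
      have h4 : 0 ≤ u τ ^ g := by positivity
      have h5 : ε * u τ ^ g ≤ 1 := by nlinarith
      have h6 : 0 ≤ ε * u τ ^ g := by positivity
      have h7 : u (τ + 1) = u τ * (1 - ε * u τ ^ g) := by rw [hrec]; ring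
      rw [h7]
      constructor
      · exact mul_nonneg h1 (by linarith)
      · nlinarith
  refine ⟨hb, ?_⟩
  by_contra! hlt
  have hanti : Antitone u := antitone_nat_of_succ_le fun τ => by
    rw [hrec]
    have := (hb τ).1
    have : 0 ≤ ε * u τ ^ (g + 1) := by positivity
    linarith
  have hdec : ∀ m ≤ n, u m ≤ 1 - m * (ε * θ ^ (g + 1)) := by
    intro m
    induction m with
    | zero => intro _; simp [h0]
    | succ m ih =>
      intro hm
      have h1 := ih (by omega)
      have h2 : θ ≤ u m := hlt.le.trans (hanti (by omega))
      have h3 : ε * θ ^ (g + 1) ≤ ε * u m ^ (g + 1) := by gcongr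
      rw [hrec]
      push_cast
      linarith
  have := hdec n le_rfl
  linarith

/-- In a regular uniform hypergraph with small codegrees, there is a random packing which covers
every point with high probability and contains given sets of words with the probability expected
from independence, up to a constant factor for each word. -/
theorem exists_random_packing (g : ℕ) (hg : 2 ≤ g) (η : ℝ) (hη : 0 < η) :
    ∃ D : ℕ, ∃ δ : ℝ, 0 < δ ∧
    ∀ (P : Type u) (W : Type v) [DecidableEq P] [Fintype W] [DecidableEq W] [Nonempty W]
      (pts : W → Finset P) (Pts : Finset P) (Δ : ℕ), 0 < Δ →
      (∀ w, pts w ⊆ Pts) → (∀ w, (pts w).card = g) →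
      (∀ p ∈ Pts, (univ.filter fun w => p ∈ pts w).card = Δ) →
      (∀ p ∈ Pts, ∀ p' ∈ Pts, p ≠ p' →
        ((univ.filter fun w => p ∈ pts w ∧ p' ∈ pts w).card : ℝ) ≤ δ * Δ) →
      ∃ E : (Finset W → ℝ) →ₗ[ℝ] ℝ,
        (∀ Φ : Finset W → ℝ, (∀ S, IsPacking pts S → 0 ≤ Φ S) → 0 ≤ E Φ) ∧
        E (fun _ => 1) = 1 ∧
        (∀ p ∈ Pts, 1 - η ≤ E (fun S => if p ∈ S.biUnion pts then 1 else 0)) ∧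
        ∀ T : Finset W, E (fun S => if T ⊆ S then 1 else 0) ≤ ((D : ℝ) / Δ) ^ T.card := by
  obtain ⟨g', rfl⟩ : ∃ g', g = g' + 1 := ⟨g - 1, by omega⟩
  have h4 : (0 : ℝ) < 4 ^ (g' + 1) := by positivity
  have hθ : 0 < (η / 2) ^ (g' + 1) := by positivity
  obtain ⟨j, hj⟩ := exists_nat_ge (2 * 4 ^ (g' + 1) / (η / 2) ^ (g' + 1))
  rw [div_le_iff₀ hθ] at hj
  obtain ⟨S, κ, hκ, hS⟩ := hierarchy_bound g' j 1 (η / 2) (by positivity)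
  set δ : ℝ := min (κ / (3 * (S + 1))) (1 / (4 * 4 ^ (g' + 1))) with hδdef
  have hδ : 0 < δ := lt_min (by positivity) (by positivity)
  refine ⟨j, δ, hδ, ?_⟩
  intro P W _ _ _ _ pts Pts Δ hΔ hsub hcard hdeg hco
  have hn : (0 : ℝ) < Fintype.card W := by exact_mod_cast Fintype.card_pos
  have hΔ' : (0 : ℝ) < Δ := by exact_mod_cast hΔ
  set n : ℝ := (Fintype.card W : ℝ) with hndef
  set ε : ℝ := Δ / n with hε
  have hε0 : 0 < ε := by positivity
  have hεδ : ε ≤ 2 * δ := by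
    obtain ⟨w₀⟩ := ‹Nonempty W›
    obtain ⟨p₀, hp₀⟩ : (pts w₀).Nonempty := by
      rw [← Finset.card_pos, hcard]; omega
    have hcount : ((g' + 1 : ℕ) : ℝ) * n = Pts.card * Δ := by
      have h1 := sum_card_inter_eq_of_regular hdeg
      have h2 : ∀ w, (Pts ∩ pts w).card = g' + 1 := fun w => by
        rw [Finset.inter_eq_right.mpr (hsub w), hcard]
      simp only [h2, Finset.sum_const, Finset.card_univ, smul_eq_mul] at h1
      rw [hndef, mul_comm]
      exact_mod_cast h1
    have hdc : (Δ : ℝ) * g' ≤ Pts.card * (δ * Δ) := by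
      have h1 : ∑ w ∈ univ.filter (fun w => p₀ ∈ pts w), ((pts w).erase p₀).card = Δ * g' := by
        rw [Finset.sum_congr rfl (g := fun _ => g')]
        · rw [Finset.sum_const, hdeg p₀ (hsub _ hp₀), smul_eq_mul]
        · intro w hw
          rw [Finset.mem_filter] at hw
          rw [Finset.card_erase_of_mem hw.2, hcard, Nat.add_sub_cancel]
      have h2 : ∑ w ∈ univ.filter (fun w => p₀ ∈ pts w), ((pts w).erase p₀).card =
          ∑ p ∈ Pts.erase p₀, (univ.filter fun w => p₀ ∈ pts w ∧ p ∈ pts w).card := by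
        rw [Finset.sum_congr rfl (g := fun w => ∑ p ∈ Pts.erase p₀, if p ∈ pts w then 1 else 0)]
        · rw [Finset.sum_comm]
          refine Finset.sum_congr rfl fun p _ => ?_
          rw [← Finset.card_filter, Finset.filter_filter]
        · intro w _
          rw [← Finset.card_filter]
          congr 1
          ext p
          simp only [Finset.mem_erase, Finset.mem_filter]
          exact ⟨fun h => ⟨⟨h.1, hsub w h.2⟩, h.2⟩, fun h => ⟨h.1.1, h.2⟩⟩
      have h3 : (∑ p ∈ Pts.erase p₀,
          ((univ.filter fun w => p₀ ∈ pts w ∧ p ∈ pts w).card : ℝ)) ≤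
            (Pts.erase p₀).card * (δ * Δ) := by
        rw [← nsmul_eq_mul]
        refine Finset.sum_le_card_nsmul _ _ _ fun p hp => ?_
        rw [Finset.mem_erase] at hp
        exact hco p₀ (hsub _ hp₀) p hp.2 hp.1.symm
      calc (Δ : ℝ) * g' = ∑ p ∈ Pts.erase p₀,
          ((univ.filter fun w => p₀ ∈ pts w ∧ p ∈ pts w).card : ℝ) := by
            exact_mod_cast (h1.symm.trans h2)
        _ ≤ _ := h3
        _ ≤ _ := by
          gcongr
          exact Finset.erase_subset _ _
    have hg' : (1 : ℝ) ≤ g' := by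
      have : 1 ≤ g' := by omega
      exact_mod_cast this
    rw [hε, div_le_iff₀ hn]
    push_cast at hcount
    have h5 : (g' : ℝ) ≤ Pts.card * δ := by nlinarith
    have h6 : (g' + 1) * (2 * δ * n) = 2 * (Pts.card * δ) * Δ := by
      calc (g' + 1) * (2 * δ * n) = 2 * δ * ((g' + 1) * n) := by ring
        _ = _ := by rw [hcount]; ring
    have h7 : ((g' : ℝ) + 1) * Δ ≤ (g' + 1) * (2 * δ * n) := by
      rw [h6]
      gcongr
      linarith
    exact le_of_mul_le_mul_left h7 (by positivity)
  have hδ4 : δ * (4 * 4 ^ (g' + 1)) ≤ 1 := by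
    rw [← le_div_iff₀ (by positivity)]
    exact min_le_right _ _
  have hδκ : δ * (3 * (S + 1)) ≤ κ := by
    rw [← le_div_iff₀ (by positivity)]
    exact min_le_left _ _
  have hε4 : ε * 4 ^ (g' + 1) ≤ 1 / 2 := by nlinarith
  have hε1 : ε ≤ 1 := by
    have : (1 : ℝ) ≤ 4 ^ (g' + 1) := one_le_pow₀ (by norm_num)
    nlinarith
  set L : ℕ := ⌊1 / (ε * 4 ^ (g' + 1))⌋₊ with hL
  have hε4' : 0 < ε * 4 ^ (g' + 1) := by positivity
  have hL1 : ε * L * 4 ^ (g' + 1) ≤ 1 := by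
    have h1 : (L : ℝ) ≤ 1 / (ε * 4 ^ (g' + 1)) := Nat.floor_le (by positivity)
    rw [le_div_iff₀ hε4'] at h1
    linarith
  have hL2 : 1 / 2 ≤ ε * L * 4 ^ (g' + 1) := by
    have h1 : 1 / (ε * 4 ^ (g' + 1)) < L + 1 := Nat.lt_floor_add_one _
    rw [div_lt_iff₀ hε4'] at h1
    nlinarith
  obtain ⟨u, hu0, hurec⟩ : ∃ u : ℕ → ℝ, u 0 = 1 ∧
      ∀ τ, u (τ + 1) = u τ - ε * u τ ^ (g' + 1) :=
    ⟨fun τ => Nat.rec 1 (fun _ x => x - ε * x ^ (g' + 1)) τ, rfl, fun _ => rfl⟩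
  have hτ : (1 : ℝ) ≤ (j * L : ℕ) * (ε * (η / 2) ^ (g' + 1)) := by
    have h1 : 2 * 4 ^ (g' + 1) * (1 / 2) ≤
        j * (η / 2) ^ (g' + 1) * (ε * L * 4 ^ (g' + 1)) := by gcongr
    have h2 : (1 : ℝ) * 4 ^ (g' + 1) ≤
        ((j * L : ℕ) * (ε * (η / 2) ^ (g' + 1))) * 4 ^ (g' + 1) := by
      push_cast
      linarith
    exact le_of_mul_le_mul_right h2 h4
  obtain ⟨hub, huend⟩ := exists_le_of_recursion hε0.le hε1 hu0 hurec (half_pos hη) hτ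
  have hbound := hS (fun τ s a => ∀ J ⊆ Pts, J.card = s → |uncoveredProb pts τ J - u τ ^ s| ≤ a)
    ε L hε0.le hL1 (fun τ s a b h hab J hJ hs => (h J hJ hs).trans hab)
    (fun τ s J _ _ => by
      have h1 := uncoveredProb_nonneg pts τ J
      have h2 := uncoveredProb_le_one pts τ J
      have h3 := pow_nonneg (hub τ).1 s
      have h4 := pow_le_one₀ (n := s) (hub τ).1 (hub τ).2
      rw [abs_le]
      constructor <;> linarith)
    (fun s J _ _ => by simp [uncoveredProb_zero, hu0])
    (fun τ s a b hs ha hb hb0 J hJ hJs => by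
      subst hJs
      rw [hurec]
      refine (abs_uncoveredProb_succ_sub_le hb0 (hub τ).1 (hub τ).2 hδ.le hcard
        (fun p hp => hdeg p (hJ hp)) (fun p hp p' hp' => hco p (hJ hp) p' (hJ hp')) hε1
        fun w hw => hb _ (Finset.union_subset hJ (hsub w)) hw).trans ?_
      have h1 := ha J hJ rfl
      have h2 : (J.card : ℝ) * (δ + ε) ≤ κ := by
        have : (J.card : ℝ) ≤ S := by exact_mod_cast hs
        have h3 : (J.card : ℝ) * (δ + ε) ≤ S * (δ + 2 * δ) := by gcongr
        nlinarith
      gcongr)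
    (j * L) le_rfl
  refine ⟨greedyMean pts (j * L), greedyMean_nonneg pts _, greedyMean_one pts _, ?_, ?_⟩
  · intro p hp
    have h1 := hbound 1 le_rfl {p} (by simpa using hp) (by simp)
    rw [pow_one, abs_le] at h1
    have h2 : (fun S : Finset W => if p ∈ S.biUnion pts then (1 : ℝ) else 0) =
        (fun _ => 1) - fun S => if Disjoint {p} (S.biUnion pts) then 1 else 0 := by
      ext S
      have h3 := @Finset.disjoint_singleton_left P (S.biUnion pts) p
      by_cases h : p ∈ S.biUnion pts
      · rw [Pi.sub_apply, if_pos h, if_neg fun h4 => h3.mp h4 h, sub_zero]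
      · rw [Pi.sub_apply, if_neg h, if_pos (h3.mpr h), sub_self]
    rw [h2, map_sub, greedyMean_one]
    change 1 - η ≤ 1 - uncoveredProb pts (j * L) {p}
    linarith [h1.2]
  · intro T
    refine (greedyMean_superset_le pts (j * L) T).trans ?_
    have h1 : ((j * L : ℕ) : ℝ) / n ≤ j / Δ := by
      rw [div_le_div_iff₀ hn hΔ']
      have h2 : (L : ℝ) * Δ ≤ n := by
        have h5 : (1 : ℝ) ≤ 4 ^ (g' + 1) := one_le_pow₀ (by norm_num)
        have h6 : ε * L ≤ 1 := by
          refine le_trans ?_ hL1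
          exact le_mul_of_one_le_right (by positivity) h5
        rw [hε, div_mul_eq_mul_div, div_le_iff₀ hn] at h6
        linarith
      push_cast
      calc (j : ℝ) * L * Δ = j * (L * Δ) := by ring
        _ ≤ _ := by gcongr
    gcongr

/-- The first-moment principle for a positive functional supported on packings. -/
theorem exists_packing_ge {P W : Type*} [DecidableEq P] [Fintype W] [DecidableEq W]
    {pts : W → Finset P} {E : (Finset W → ℝ) →ₗ[ℝ] ℝ}
    (hpos : ∀ Φ : Finset W → ℝ, (∀ S, IsPacking pts S → 0 ≤ Φ S) → 0 ≤ E Φ)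
    (hone : E (fun _ => 1) = 1) (Φ : Finset W → ℝ) : ∃ S, IsPacking pts S ∧ E Φ ≤ Φ S := by
  classical
  obtain ⟨S, hS, hmax⟩ := Finset.exists_max_image (univ.filter fun S => IsPacking pts S) Φ
    ⟨∅, Finset.mem_filter.mpr ⟨Finset.mem_univ _, by simp [IsPacking]⟩⟩
  rw [Finset.mem_filter] at hS
  refine ⟨S, hS.2, ?_⟩
  have := hpos (Φ S • (fun _ => 1) - Φ) fun T hT => by
    simpa using hmax T (by simp [hT])
  rw [map_sub, map_smul, hone] at this
  simpa using this

section UnionFree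

variable [DecidableEq α]

theorem card_sup_id_le {H : Finset (Finset α)} {r : ℕ} (hcard : ∀ A ∈ H, A.card = r)
    {𝒮 : Finset (Finset α)} (h : 𝒮 ⊆ H) : (𝒮.sup id).card ≤ 𝒮.card * r := by
  rw [Finset.sup_eq_biUnion]
  exact Finset.card_biUnion_le_card_mul _ _ _ fun A hA => (hcard A (h hA)).le

/-- In a family with pairwise intersections of size at most `k` and a distinguished vertex in each
edge lying only in smaller intersections, no edge of size `t * k` is covered by `t` others. -/
theorem lt_card_of_subset_sup {t k : ℕ} {H : Finset (Finset α)}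
    (hcard : ∀ A ∈ H, A.card = t * k) {x : Finset α → α} (hx : ∀ A ∈ H, x A ∈ A)
    (hpair : ∀ A ∈ H, ∀ B ∈ H, A ≠ B → (A ∩ B).card ≤ k)
    (hcenter : ∀ A ∈ H, ∀ B ∈ H, A ≠ B → x A ∈ B → (A ∩ B).card < k)
    {𝒮 : Finset (Finset α)} (h𝒮 : 𝒮 ⊆ H) {A : Finset α} (hA : A ∈ H) (hA𝒮 : A ∉ 𝒮)
    (hcov : A ⊆ 𝒮.sup id) : t < 𝒮.card := by
  obtain ⟨B, hB, hxB⟩ := Finset.mem_sup.mp (hcov (hx A hA))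
  have hne : ∀ C ∈ 𝒮, A ≠ C := fun C hC h => hA𝒮 (h ▸ hC)
  have h1 : A.card ≤ ∑ C ∈ 𝒮, (A ∩ C).card := by
    refine le_trans (Finset.card_le_card fun y hy => ?_) Finset.card_biUnion_le
    obtain ⟨C, hC, hyC⟩ := Finset.mem_sup.mp (hcov hy)
    exact Finset.mem_biUnion.mpr ⟨C, hC, Finset.mem_inter.mpr ⟨hy, hyC⟩⟩
  have h2 : ∑ C ∈ 𝒮, (A ∩ C).card < ∑ C ∈ 𝒮, k :=
    Finset.sum_lt_sum (fun C hC => hpair A hA C (h𝒮 hC) (hne C hC))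
      ⟨B, hB, hcenter A hA B (h𝒮 hB) (hne B hB) hxB⟩
  rw [hcard A hA] at h1
  rw [Finset.sum_const, smul_eq_mul] at h2
  exact lt_of_mul_lt_mul_right (h1.trans_lt h2) (Nat.zero_le k)

set_option maxHeartbeats 800000 in
/-- A criterion for union-freeness in terms of the number of vertices spanned by few edges. -/
theorem isUnionFree_of_sparse {t k : ℕ} (ht : 2 ≤ t) (hk : 1 ≤ k) {H : Finset (Finset α)}
    (hcard : ∀ A ∈ H, A.card = t * k) (x : Finset α → α) (hx : ∀ A ∈ H, x A ∈ A)
    (hspan : ∀ 𝒮 ⊆ H, 𝒮.Nonempty → 𝒮.card ≤ 2 * t + 2 →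
      𝒮.card * (t * k) + k ≤ (𝒮.sup id).card + 𝒮.card * k)
    (hcenter : ∀ A ∈ H, ∀ B ∈ H, A ≠ B → x A ∈ B → (A ∩ B).card < k)
    (hthird : ∀ A ∈ H, ∀ B ∈ H, ∀ C ∈ H, A ≠ B → C ≠ A → (A ∩ B).card = k → x A ∈ C →
      Disjoint C (A ∩ B) → (C ∩ (A ∪ B)).card < k) :
    IsUnionFree (t + 1) H := by
  have hpair : ∀ A ∈ H, ∀ B ∈ H, A ≠ B → (A ∩ B).card ≤ k := by
    intro A hA B hB hAB
    have h1 := hspan {A, B} (by simp [Finset.insert_subset_iff, hA, hB]) (by simp)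
      (by rw [Finset.card_pair hAB]; omega)
    rw [Finset.card_pair hAB, Finset.sup_insert, Finset.sup_singleton] at h1
    have h2 := Finset.card_union_add_card_inter A B
    rw [hcard A hA, hcard B hB] at h2
    simp only [id, Finset.sup_eq_union] at h1
    omega
  have hcover : ∀ 𝒜 ⊆ H, ∀ ℬ ⊆ H, 𝒜.card ≤ t + 1 → ℬ.card ≤ t + 1 → 𝒜.sup id = ℬ.sup id →
      (𝒜 \ ℬ).Nonempty → ℬ.card = t + 1 ∧ (ℬ \ 𝒜).Nonempty := by
    intro 𝒜 h𝒜 ℬ hℬ h𝒜t hℬt hU hne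
    obtain ⟨A, hA⟩ := hne
    rw [Finset.mem_sdiff] at hA
    have h1 := lt_card_of_subset_sup hcard hx hpair hcenter hℬ (h𝒜 hA.1) hA.2
      (hU ▸ Finset.le_sup (f := id) hA.1)
    refine ⟨by omega, ?_⟩
    rw [Finset.sdiff_nonempty]
    intro hsub
    have := Finset.eq_of_subset_of_card_le hsub (by omega)
    exact hA.2 (this ▸ hA.1)
  intro 𝒜 h𝒜 ℬ hℬ _ _ h𝒜t hℬt hne hU
  have hboth : 𝒜.card = t + 1 ∧ ℬ.card = t + 1 ∧ (𝒜 \ ℬ).Nonempty := by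
    by_cases h : (𝒜 \ ℬ).Nonempty
    · have h1 := hcover 𝒜 h𝒜 ℬ hℬ h𝒜t hℬt hU h
      exact ⟨(hcover ℬ hℬ 𝒜 h𝒜 hℬt h𝒜t hU.symm h1.2).1, h1.1, h⟩
    · have h' : (ℬ \ 𝒜).Nonempty := by
        rw [Finset.sdiff_nonempty] at h ⊢
        exact fun hs => hne (Finset.Subset.antisymm (not_not.mp h) hs)
      have h1 := hcover ℬ hℬ 𝒜 h𝒜 hℬt h𝒜t hU.symm h'
      exact absurd h1.2 h
  obtain ⟨h𝒜c, hℬc, hdiff⟩ := hboth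
  set X := (𝒜 \ ℬ).sup id with hX
  set Y := (ℬ \ 𝒜).sup id with hY
  set Z := (𝒜 ∩ ℬ).sup id with hZ
  set m := (𝒜 \ ℬ).card with hm
  have hm1 : 1 ≤ m := Finset.card_pos.mpr hdiff
  have hinter : (𝒜 ∩ ℬ).card + m = t + 1 := by
    have := Finset.card_sdiff_add_card_inter 𝒜 ℬ
    omega
  have hm' : (ℬ \ 𝒜).card = m := by
    have := Finset.card_sdiff_add_card_inter ℬ 𝒜
    rw [Finset.inter_comm] at this
    omega
  have hXZ : X ∪ Z = 𝒜.sup id := by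
    rw [hX, hZ, ← Finset.sup_eq_union, ← Finset.sup_union, Finset.sdiff_union_inter]
  have hYZ : Y ∪ Z = 𝒜.sup id := by
    rw [hY, hZ, ← Finset.sup_eq_union, ← Finset.sup_union, Finset.inter_comm,
      Finset.sdiff_union_inter, hU]
  have hall := hspan (𝒜 ∪ ℬ) (Finset.union_subset h𝒜 hℬ)
    (hdiff.mono (Finset.sdiff_subset.trans Finset.subset_union_left)) (by
      have := Finset.card_union_le 𝒜 ℬ
      omega)
  have hcu : (𝒜 ∪ ℬ).card = t + 1 + m := by
    have := Finset.card_union_add_card_inter 𝒜 ℬ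
    omega
  rw [hcu, Finset.sup_union, ← hU, sup_idem] at hall
  have hUle : (𝒜.sup id).card ≤ (t + 1) * (t * k) := h𝒜c ▸ card_sup_id_le hcard h𝒜
  have hmt : m * t ≤ t + m := by
    have : (m * t) * k ≤ (t + m) * k := by nlinarith
    exact le_of_mul_le_mul_right this hk
  have hcases : m = 1 ∨ (m = 2 ∧ t = 2) := by
    rcases Nat.lt_or_ge m 2 with h | h
    · left; omega
    · right
      constructor <;> nlinarith
  have hZle : Z.card ≤ (𝒜 ∩ ℬ).card * (t * k) :=
    card_sup_id_le hcard (Finset.inter_subset_left.trans h𝒜)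
  have hXle : X.card ≤ m * (t * k) := card_sup_id_le hcard (Finset.sdiff_subset.trans h𝒜)
  have hYle : Y.card ≤ m * (t * k) := hm' ▸ card_sup_id_le hcard (Finset.sdiff_subset.trans hℬ)
  clear_value X Y Z m
  have hiX := Finset.card_union_add_card_inter X Z
  have hiY := Finset.card_union_add_card_inter Y Z
  rw [hXZ] at hiX
  rw [hYZ] at hiY
  rcases hcases with h | ⟨h, h'⟩
  · rw [h] at hm hm' hinter hall
    obtain ⟨A, hA⟩ := Finset.card_eq_one.mp hm.symm
    obtain ⟨B, hB⟩ := Finset.card_eq_one.mp hm'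
    have hA' : A ∈ 𝒜 \ ℬ := by simp [hA]
    have hB' : B ∈ ℬ \ 𝒜 := by simp [hB]
    rw [Finset.mem_sdiff] at hA' hB'
    have hAH := h𝒜 hA'.1
    have hBH := hℬ hB'.1
    have hAB : A ≠ B := fun h => hA'.2 (h ▸ hB'.1)
    obtain rfl : X = A := by rw [hX, hA, Finset.sup_singleton, id]
    obtain rfl : Y = B := by rw [hY, hB, Finset.sup_singleton, id]
    have hk2 := hpair X hAH Y hBH hAB
    have hsd : X \ Z = Y \ Z := by
      rw [← Finset.union_sdiff_right, hXZ, ← hYZ, Finset.union_sdiff_right]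
    have hXZsub : X \ Z ⊆ X ∩ Y :=
      Finset.subset_inter Finset.sdiff_subset (hsd ▸ Finset.sdiff_subset)
    have hUcard : (𝒜.sup id).card = (X \ Z).card + Z.card := by
      rw [← hXZ, Finset.card_sdiff_add_card]
    have hXZle := Finset.card_le_card hXZsub
    have hint : (𝒜 ∩ ℬ).card = t := by omega
    rw [hint] at hZle
    obtain rfl : t = 2 := by
      have : t * k ≤ 2 * k := by nlinarith
      have := le_of_mul_le_mul_right this hk
      omega
    have hXYk : (X ∩ Y).card = k := by omega
    have hXZeq : X \ Z = X ∩ Y := Finset.eq_of_subset_of_card_le hXZsub (by omega)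
    have hdisj : Disjoint (X ∩ Y) Z := hXZeq ▸ Finset.sdiff_disjoint
    have hxY : x X ∉ Y := fun hxy => by
      have := hcenter X hAH Y hBH hAB hxy
      omega
    have hxZ : x X ∈ Z := by
      have h1 : x X ∈ Y ∪ Z := by
        rw [hYZ, ← hXZ]
        exact Finset.mem_union_left _ (hx X hAH)
      exact (Finset.mem_union.mp h1).resolve_left hxY
    obtain ⟨C, hC, hxC⟩ := Finset.mem_sup.mp (hZ ▸ hxZ)
    simp only [id] at hxC
    obtain ⟨C', hC'⟩ : ∃ C', (𝒜 ∩ ℬ).erase C = {C'} := by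
      rw [← Finset.card_eq_one, Finset.card_erase_of_mem hC, hint]
    have hC'mem : C' ∈ (𝒜 ∩ ℬ).erase C := by simp [hC']
    have hZeq : Z = C ∪ C' := by
      rw [hZ, ← Finset.insert_erase hC, hC', Finset.sup_insert, Finset.sup_singleton]
      rfl
    have hC'm := Finset.mem_of_mem_erase hC'mem
    rw [Finset.mem_inter] at hC hC'm
    have hXU := Finset.card_union_add_card_inter X Y
    rw [hcard X hAH, hcard Y hBH] at hXU
    have hCX : C ≠ X := fun h => hA'.2 (h ▸ hC.2)
    have h3 := hthird X hAH Y hBH C (h𝒜 hC.1) hAB hCX hXYk hxC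
      (hdisj.symm.mono_left (hZeq ▸ Finset.subset_union_left))
    have hC'X : C' ≠ X := fun h => hA'.2 (h ▸ hC'm.2)
    have hC'Y : C' ≠ Y := fun h => hB'.2 (h ▸ hC'm.1)
    have h4 := hspan {C', X, Y} (by simp [Finset.insert_subset_iff, hAH, hBH, h𝒜 hC'm.1])
      (by simp) (by rw [Finset.card_eq_three.mpr ⟨C', X, Y, hC'X, hC'Y, hAB, rfl⟩]; omega)
    rw [Finset.card_eq_three.mpr ⟨C', X, Y, hC'X, hC'Y, hAB, rfl⟩, Finset.sup_insert,
      Finset.sup_insert, Finset.sup_singleton] at h4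
    simp only [id, Finset.sup_eq_union] at h4
    have h5 := Finset.card_union_add_card_inter C' (X ∪ Y)
    rw [hcard C' (h𝒜 hC'm.1)] at h5
    have h6 : ((X ∪ Y) \ Z).card = k := by
      rw [Finset.union_sdiff_distrib, ← hsd, Finset.union_self, hXZeq, hXYk]
    have h7 : (X ∪ Y) ⊆ ((X ∪ Y) \ Z) ∪ ((C ∩ (X ∪ Y)) ∪ (C' ∩ (X ∪ Y))) := by
      rw [hZeq]
      intro y hy
      simp only [Finset.mem_union, Finset.mem_sdiff, Finset.mem_inter] at hy ⊢
      tauto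
    have h8 := Finset.card_le_card h7
    have h9 := Finset.card_union_le ((X ∪ Y) \ Z) ((C ∩ (X ∪ Y)) ∪ (C' ∩ (X ∪ Y)))
    have h10 := Finset.card_union_le (C ∩ (X ∪ Y)) (C' ∩ (X ∪ Y))
    omega
  · subst h'
    rw [h] at hm hm' hinter hall hXle hYle
    have hint : (𝒜 ∩ ℬ).card = 1 := by omega
    rw [hint] at hZle
    have hX0 : X ∩ Z = ∅ := by rw [← Finset.card_eq_zero]; omega
    have hY0 : Y ∩ Z = ∅ := by rw [← Finset.card_eq_zero]; omega
    have hXY : X = Y := by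
      rw [← Finset.sdiff_eq_self_of_disjoint (Finset.disjoint_iff_inter_eq_empty.mpr hX0),
        ← Finset.sdiff_eq_self_of_disjoint (Finset.disjoint_iff_inter_eq_empty.mpr hY0),
        ← Finset.union_sdiff_right, hXZ, ← hYZ, Finset.union_sdiff_right]
    have h4 : ((𝒜 \ ℬ) ∪ (ℬ \ 𝒜)).card = 4 := by
      rw [Finset.card_union_of_disjoint disjoint_sdiff_sdiff]
      omega
    have h5 := hspan ((𝒜 \ ℬ) ∪ (ℬ \ 𝒜))
      (Finset.union_subset (Finset.sdiff_subset.trans h𝒜) (Finset.sdiff_subset.trans hℬ))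
      (hdiff.mono Finset.subset_union_left) (by omega)
    rw [h4, Finset.sup_union, ← hX, ← hY, ← hXY, sup_idem] at h5
    omega

end UnionFree

/-- The expected size of the random packing. -/
theorem exists_random_packing_card (g : ℕ) (hg : 2 ≤ g) (η : ℝ) (hη : 0 < η) :
    ∃ D : ℕ, ∃ δ : ℝ, 0 < δ ∧
    ∀ (P : Type u) (W : Type v) [DecidableEq P] [Fintype W] [DecidableEq W] [Nonempty W]
      (pts : W → Finset P) (Δ : ℕ), 0 < Δ →
      (∀ w, (pts w).card = g) →
      (∀ w, ∀ p ∈ pts w, (univ.filter fun w => p ∈ pts w).card = Δ) →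
      (∀ w, ∀ p ∈ pts w, ∀ p' ∈ pts w, p ≠ p' →
        ((univ.filter fun w => p ∈ pts w ∧ p' ∈ pts w).card : ℝ) ≤ δ * Δ) →
      ∃ E : (Finset W → ℝ) →ₗ[ℝ] ℝ,
        (∀ Φ : Finset W → ℝ, (∀ S, IsPacking pts S → 0 ≤ Φ S) → 0 ≤ E Φ) ∧
        E (fun _ => 1) = 1 ∧
        (1 - η) * (Fintype.card W / Δ) ≤ E (fun S => (S.card : ℝ)) ∧
        ∀ T : Finset W, E (fun S => if T ⊆ S then 1 else 0) ≤ ((D : ℝ) / Δ) ^ T.card := by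
  obtain ⟨D, δ, hδ, h⟩ := exists_random_packing.{u, v} g hg η hη
  refine ⟨D, δ, hδ, ?_⟩
  intro P W _ _ _ _ pts Δ hΔ hcard hdeg hco
  have hΔ' : (0 : ℝ) < Δ := by exact_mod_cast hΔ
  set Pts := univ.biUnion pts with hPts
  have hmem : ∀ p ∈ Pts, ∃ w, p ∈ pts w := fun p hp => by simpa [hPts] using hp
  have hsub : ∀ w, pts w ⊆ Pts := fun w => Finset.subset_biUnion_of_mem pts (Finset.mem_univ w)
  have hdeg' : ∀ p ∈ Pts, (univ.filter fun w => p ∈ pts w).card = Δ := fun p hp => by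
    obtain ⟨w, hw⟩ := hmem p hp
    exact hdeg w p hw
  obtain ⟨E, hpos, hone, hcov, hT⟩ := h P W pts Pts Δ hΔ hsub hcard hdeg' (by
    intro p _ p' _ hpp
    rcases (univ.filter fun w => p ∈ pts w ∧ p' ∈ pts w).eq_empty_or_nonempty with h0 | ⟨w, hw⟩
    · rw [h0, Finset.card_empty, Nat.cast_zero]
      positivity
    · rw [Finset.mem_filter] at hw
      exact hco w p hw.2.1 p' hw.2.2 hpp)
  refine ⟨E, hpos, hone, ?_, hT⟩
  have hg0 : (0 : ℝ) < g := by exact_mod_cast (by omega : 0 < g)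
  have hcount : (g : ℝ) * Fintype.card W = Pts.card * Δ := by
    have h1 := sum_card_inter_eq_of_regular hdeg'
    have h2 : ∀ w, (Pts ∩ pts w).card = g := fun w => by
      rw [Finset.inter_eq_right.mpr (hsub w), hcard]
    simp only [h2, Finset.sum_const, Finset.card_univ, smul_eq_mul] at h1
    rw [mul_comm]
    exact_mod_cast h1
  have hsum : ∑ p ∈ Pts, E (fun S => if p ∈ S.biUnion pts then 1 else 0) ≤
      E ((g : ℝ) • fun S : Finset W => (S.card : ℝ)) := by
    rw [← map_sum, ← sub_nonneg, ← map_sub]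
    refine hpos _ fun S hS => ?_
    rw [Pi.sub_apply, sub_nonneg, Finset.sum_apply, ← Finset.sum_filter, Finset.sum_const,
      nsmul_eq_mul, mul_one]
    have h1 : (Pts.filter fun p => p ∈ S.biUnion pts).card ≤ S.card * g :=
      (Finset.card_le_card fun p hp => (Finset.mem_filter.mp hp).2).trans
        (Finset.card_biUnion_le_card_mul _ _ _ fun w _ => (hcard w).le)
    rw [Pi.smul_apply, smul_eq_mul, mul_comm]
    exact_mod_cast h1
  have hlow : (Pts.card : ℝ) * (1 - η) ≤
      ∑ p ∈ Pts, E (fun S => if p ∈ S.biUnion pts then 1 else 0) := by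
    rw [← nsmul_eq_mul]
    exact Finset.card_nsmul_le_sum _ _ _ hcov
  rw [map_smul, smul_eq_mul] at hsum
  have h3 : (g : ℝ) * ((1 - η) * (Fintype.card W / Δ)) = Pts.card * (1 - η) := by
    calc (g : ℝ) * ((1 - η) * (Fintype.card W / Δ)) = (1 - η) * (g * Fintype.card W) / Δ := by ring
      _ = Pts.card * (1 - η) := by
        rw [hcount]
        field_simp
  exact le_of_mul_le_mul_left (h3 ▸ hlow.trans hsum) hg0

/-- A linear system of designs from which union-free hypergraphs are obtained by blowing up. Each
edge has a distinguished vertex, at position `o`, around which intersections are smaller. -/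
structure IsBlowupBase {ι R B : Type*} [Fintype R] [DecidableEq B] (pos : ι → R → B) (o : R)
    (k : ℕ) : Prop where
  inj : ∀ b, Function.Injective (pos b)
  inter_le : ∀ b b', b ≠ b' → (univ.image (pos b) ∩ univ.image (pos b')).card ≤ k
  center_lt : ∀ b b', b ≠ b' → pos b o ∈ univ.image (pos b') →
    (univ.image (pos b) ∩ univ.image (pos b')).card < k
  third_lt : ∀ b b' b'', b ≠ b' → (univ.image (pos b) ∩ univ.image (pos b')).card = k → b'' ≠ b →
    pos b o ∈ univ.image (pos b'') →
    (univ.image (pos b'') ∩ (univ.image (pos b) ∪ univ.image (pos b'))).card < k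

section Blowup

variable {ι R B F : Type*} [Fintype R] [DecidableEq B] [DecidableEq F]

/-- The edge of the blow-up given by an edge of the base and a choice of one clone of each of its
vertices. -/
def blowupEdge (pos : ι → R → B) (w : ι × (R → F)) : Finset (B × F) :=
  univ.image fun i => (pos w.1 i, w.2 i)

theorem mem_blowupEdge {pos : ι → R → B} {w : ι × (R → F)} {y : B × F} :
    y ∈ blowupEdge pos w ↔ ∃ i, pos w.1 i = y.1 ∧ w.2 i = y.2 := by
  simp [blowupEdge, Prod.ext_iff]

theorem fst_mem_of_mem_blowupEdge {pos : ι → R → B} {w : ι × (R → F)} {y : B × F}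
    (h : y ∈ blowupEdge pos w) : y.1 ∈ univ.image (pos w.1) := by
  obtain ⟨i, hi, -⟩ := mem_blowupEdge.mp h
  exact Finset.mem_image.mpr ⟨i, Finset.mem_univ i, hi⟩

theorem card_blowupEdge {pos : ι → R → B} {o : R} {k : ℕ} (hb : IsBlowupBase pos o k)
    (w : ι × (R → F)) : (blowupEdge pos w).card = Fintype.card R := by
  rw [blowupEdge, Finset.card_image_of_injective, Finset.card_univ]
  intro i j hij
  exact hb.inj _ (Prod.ext_iff.mp hij).1

theorem injOn_fst_blowupEdge {pos : ι → R → B} {o : R} {k : ℕ} (hb : IsBlowupBase pos o k)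
    (w : ι × (R → F)) : Set.InjOn Prod.fst (blowupEdge pos w : Set (B × F)) := by
  intro y hy z hz hyz
  obtain ⟨i, hi, hi'⟩ := mem_blowupEdge.mp hy
  obtain ⟨j, hj, hj'⟩ := mem_blowupEdge.mp hz
  have : i = j := hb.inj _ (by rw [hi, hj, hyz])
  subst this
  exact Prod.ext hyz (hi'.symm.trans hj')

theorem card_le_card_of_subset_blowupEdge {pos : ι → R → B} {o : R} {k : ℕ}
    (hb : IsBlowupBase pos o k) {w : ι × (R → F)} {Y : Finset (B × F)} {Z : Finset B}
    (hY : Y ⊆ blowupEdge pos w) (hZ : ∀ y ∈ Y, y.1 ∈ Z) : Y.card ≤ Z.card :=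
  Finset.card_le_card_of_injOn Prod.fst (fun y hy => hZ y hy)
    ((injOn_fst_blowupEdge hb w).mono fun _ hy => hY hy)

theorem card_blowupEdge_inter_le {pos : ι → R → B} {o : R} {k : ℕ} (hb : IsBlowupBase pos o k)
    (w w' : ι × (R → F)) : (blowupEdge pos w ∩ blowupEdge pos w').card ≤
      (univ.image (pos w.1) ∩ univ.image (pos w'.1)).card := by
  refine card_le_card_of_subset_blowupEdge hb (w := w) Finset.inter_subset_left fun y hy => ?_
  rw [Finset.mem_inter] at hy ⊢
  exact ⟨fst_mem_of_mem_blowupEdge hy.1, fst_mem_of_mem_blowupEdge hy.2⟩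

theorem card_blowupEdge_inter_same_le {pos : ι → R → B} {o : R} {k : ℕ}
    (hb : IsBlowupBase pos o k) (b : ι) (x x' : R → F) :
    (blowupEdge pos (b, x) ∩ blowupEdge pos (b, x')).card ≤
      (univ.filter fun i => x i = x' i).card := by
  rw [← Finset.card_image_of_injective (univ.filter fun i => x i = x' i) (hb.inj b)]
  refine card_le_card_of_subset_blowupEdge hb (w := (b, x)) Finset.inter_subset_left fun y hy => ?_
  rw [Finset.mem_inter] at hy
  obtain ⟨i, hi, hi'⟩ := mem_blowupEdge.mp hy.1
  obtain ⟨j, hj, hj'⟩ := mem_blowupEdge.mp hy.2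
  have : i = j := hb.inj b (hi.trans hj.symm)
  subst this
  exact Finset.mem_image.mpr ⟨i, Finset.mem_filter.mpr
    ⟨Finset.mem_univ i, hi'.trans hj'.symm⟩, hi⟩

theorem blowupEdge_injective {pos : ι → R → B} {o : R} {k : ℕ} (hb : IsBlowupBase pos o k)
    (hk : k < Fintype.card R) : Function.Injective (blowupEdge pos : ι × (R → F) → _) := by
  rintro ⟨b, x⟩ ⟨b', x'⟩ h
  have hbb : b = b' := by
    by_contra hne
    have h1 := card_blowupEdge_inter_le hb (b, x) (b', x')
    rw [h, Finset.inter_self, card_blowupEdge hb] at h1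
    exact absurd (h1.trans (hb.inter_le b b' hne)) (by omega)
  subst hbb
  congr 1
  ext i
  have h1 : (pos b i, x i) ∈ blowupEdge pos (b, x') := h ▸ mem_blowupEdge.mpr ⟨i, rfl, rfl⟩
  obtain ⟨j, hj, hj'⟩ := mem_blowupEdge.mp h1
  have : j = i := hb.inj b hj
  subst this
  exact hj'.symm

/-- A set of words of the blow-up any two of which agree in fewer than `k` places, and which
spans enough vertices locally, is union-free. -/
theorem isUnionFree_blowup [Nonempty (ι × (R → F))] [DecidableEq (ι × (R → F))]
    {pos : ι → R → B} {o : R} {t k : ℕ} (ht : 2 ≤ t) (hk : 1 ≤ k)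
    (hR : Fintype.card R = t * k) (hb : IsBlowupBase pos o k) {S : Finset (ι × (R → F))}
    (hagree : ∀ b x x', (b, x) ∈ S → (b, x') ∈ S → x ≠ x' →
      (univ.filter fun i => x i = x' i).card < k)
    (hspan : ∀ T ⊆ S, T.Nonempty → T.card ≤ 2 * t + 2 →
      T.card * (t * k) + k ≤ (T.biUnion (blowupEdge pos)).card + T.card * k) :
    IsUnionFree (t + 1) (S.image (blowupEdge pos)) := by
  have hkR : k < Fintype.card R := by rw [hR]; nlinarith
  have hinj := blowupEdge_injective (F := F) hb hkR
  have hinv := Function.leftInverse_invFun hinj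
  have hsame : ∀ w ∈ S, ∀ w' ∈ S, w ≠ w' → w.1 = w'.1 →
      (blowupEdge pos w ∩ blowupEdge pos w').card < k := by
    rintro ⟨b, x⟩ hw ⟨b', x'⟩ hw' hne hbb
    obtain rfl : b = b' := hbb
    exact (card_blowupEdge_inter_same_le hb b x x').trans_lt
      (hagree b x x' hw hw' fun h => hne (by rw [h]))
  have hcen : ∀ w w' : ι × (R → F), (pos w.1 o, w.2 o) ∈ blowupEdge pos w' →
      pos w.1 o ∈ univ.image (pos w'.1) := fun w w' h => fst_mem_of_mem_blowupEdge h
  refine isUnionFree_of_sparse ht hk (H := S.image (blowupEdge pos)) ?_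
    (fun A => (pos (Function.invFun (blowupEdge pos) A).1 o,
      (Function.invFun (blowupEdge pos) A).2 o)) ?_ ?_ ?_ ?_
  · intro A hA
    obtain ⟨w, -, rfl⟩ := Finset.mem_image.mp hA
    rw [card_blowupEdge hb, hR]
  · intro A hA
    obtain ⟨w, -, rfl⟩ := Finset.mem_image.mp hA
    rw [hinv]
    exact mem_blowupEdge.mpr ⟨o, rfl, rfl⟩
  · intro 𝒮 h𝒮 hne hcard
    obtain ⟨T, hT, rfl⟩ := Finset.subset_image_iff.mp h𝒮
    rw [Finset.card_image_of_injective _ hinj] at hcard ⊢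
    rw [Finset.sup_image, Function.id_comp, Finset.sup_eq_biUnion]
    exact hspan T (by exact_mod_cast hT) (Finset.image_nonempty.mp hne) hcard
  · intro A hA A' hA' hne hc
    obtain ⟨w, hw, rfl⟩ := Finset.mem_image.mp hA
    obtain ⟨w', hw', rfl⟩ := Finset.mem_image.mp hA'
    rw [hinv] at hc
    have hww : w ≠ w' := fun h => hne (by rw [h])
    by_cases hbb : w.1 = w'.1
    · exact hsame w hw w' hw' hww hbb
    · exact (card_blowupEdge_inter_le hb w w').trans_lt (hb.center_lt _ _ hbb (hcen w w' hc))
  · intro A hA A' hA' C hC hne hCA hAA' hc hdisj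
    obtain ⟨w, hw, rfl⟩ := Finset.mem_image.mp hA
    obtain ⟨w', hw', rfl⟩ := Finset.mem_image.mp hA'
    obtain ⟨z, hz, rfl⟩ := Finset.mem_image.mp hC
    rw [hinv] at hc
    have hww : w ≠ w' := fun h => hne (by rw [h])
    have hzw : z ≠ w := fun h => hCA (by rw [h])
    have hbb : w.1 ≠ w'.1 := fun h => (hsame w hw w' hw' hww h).ne hAA'
    have hle := card_blowupEdge_inter_le hb w w'
    have hE : (univ.image (pos w.1) ∩ univ.image (pos w'.1)).card = k :=
      le_antisymm (hb.inter_le _ _ hbb) (hAA' ▸ hle)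
    by_cases hzb : z.1 = w.1
    · have hfst : (blowupEdge pos w ∩ blowupEdge pos w').image Prod.fst =
          univ.image (pos w.1) ∩ univ.image (pos w'.1) := by
        refine Finset.eq_of_subset_of_card_le ?_ ?_
        · intro y hy
          obtain ⟨y', hy', rfl⟩ := Finset.mem_image.mp hy
          rw [Finset.mem_inter] at hy' ⊢
          exact ⟨fst_mem_of_mem_blowupEdge hy'.1, fst_mem_of_mem_blowupEdge hy'.2⟩
        · rw [Finset.card_image_of_injOn, hE, hAA']
          exact (injOn_fst_blowupEdge hb w).mono fun _ hy => Finset.mem_of_mem_inter_left hy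
      refine lt_of_le_of_lt (Finset.card_le_card ?_) (hsame z hz w hw hzw hzb)
      intro y hy
      rw [Finset.mem_inter, Finset.mem_union] at hy
      refine Finset.mem_inter.mpr ⟨hy.1, hy.2.resolve_right fun hyw' => ?_⟩
      have h1 : y.1 ∈ univ.image (pos w.1) ∩ univ.image (pos w'.1) :=
        Finset.mem_inter.mpr ⟨hzb ▸ fst_mem_of_mem_blowupEdge hy.1, fst_mem_of_mem_blowupEdge hyw'⟩
      rw [← hfst] at h1
      obtain ⟨y', hy', hyy⟩ := Finset.mem_image.mp h1
      have h2 : y' = y := injOn_fst_blowupEdge hb w' (Finset.mem_of_mem_inter_right hy') hyw' hyy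
      exact Finset.disjoint_left.mp hdisj hy.1 (h2 ▸ hy')
    · refine lt_of_le_of_lt ?_ (hb.third_lt _ _ _ hbb hE hzb (hcen w z hc))
      refine card_le_card_of_subset_blowupEdge hb (w := z) Finset.inter_subset_left fun y hy => ?_
      rw [Finset.mem_inter, Finset.mem_union] at hy ⊢
      exact ⟨fst_mem_of_mem_blowupEdge hy.1,
        hy.2.imp fst_mem_of_mem_blowupEdge fst_mem_of_mem_blowupEdge⟩

end Blowup

theorem exists_subset_avoiding {W : Type*} [DecidableEq W] (S : Finset W)
    (Bad : Finset (Finset W)) (hne : ∀ T ∈ Bad, T.Nonempty) :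
    ∃ S' ⊆ S, (∀ T ∈ Bad, ¬T ⊆ S') ∧ S.card ≤ S'.card + (Bad.filter fun T => T ⊆ S).card := by
  have h0 : ∀ T : Finset W, ∃ U : Finset W, U.card ≤ 1 ∧ (T ∈ Bad → ∃ a ∈ T, a ∈ U) := by
    intro T
    by_cases hT : T ∈ Bad
    · obtain ⟨a, ha⟩ := hne T hT
      exact ⟨{a}, by simp, fun _ => ⟨a, ha, Finset.mem_singleton_self a⟩⟩
    · exact ⟨∅, by simp, fun h => absurd h hT⟩
  choose f hf1 hf using h0
  refine ⟨S \ (Bad.filter fun T => T ⊆ S).biUnion f, Finset.sdiff_subset, ?_, ?_⟩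
  · intro T hT hTS
    obtain ⟨a, haT, haf⟩ := hf T hT
    exact (Finset.mem_sdiff.mp (hTS haT)).2 (Finset.mem_biUnion.mpr
      ⟨T, Finset.mem_filter.mpr ⟨hT, hTS.trans Finset.sdiff_subset⟩, haf⟩)
  · have h1 := Finset.card_le_card_sdiff_add_card
      (s := S) (t := (Bad.filter fun T => T ⊆ S).biUnion f)
    have h2 := Finset.card_biUnion_le_card_mul (Bad.filter fun T => T ⊆ S) f 1 fun T _ => hf1 T
    omega

section Code

variable {ι R F : Type*} [Fintype R] [DecidableEq R] [Fintype F] [DecidableEq F]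
  [DecidableEq ι]

theorem card_filter_agree (I : Finset R) (x : R → F) :
    (univ.filter fun y : R → F => ∀ i ∈ I, y i = x i).card =
      Fintype.card F ^ (Fintype.card R - I.card) := by
  have h1 : (univ.filter fun y : R → F => ∀ i ∈ I, y i = x i) =
      Fintype.piFinset fun i => if i ∈ I then {x i} else univ := by
    ext y
    simp only [Finset.mem_filter, Finset.mem_univ, true_and, Fintype.mem_piFinset]
    refine forall_congr' fun i => ?_
    by_cases h : i ∈ I <;> simp [h]
  rw [h1, Fintype.card_piFinset]
  have h2 : ∀ i, (if i ∈ I then ({x i} : Finset F) else univ).card =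
      if i ∈ I then 1 else Fintype.card F := by
    intro i
    split_ifs <;> simp
  simp_rw [h2]
  rw [Finset.prod_ite, Finset.prod_const_one, one_mul, Finset.prod_const]
  congr 1
  rw [Finset.filter_not, Finset.filter_mem_eq_inter, Finset.univ_inter,
    ← Finset.compl_eq_univ_sdiff, Finset.card_compl]

/-- The restriction of a word to a set of coordinates. -/
def partialWord (I : Finset R) (x : R → F) : R → Option F :=
  fun i => if i ∈ I then some (x i) else none

omit [Fintype R] [Fintype F] [DecidableEq F] in
theorem partialWord_eq_iff {I I' : Finset R} {x x' : R → F} :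
    partialWord I x = partialWord I' x' ↔ I = I' ∧ ∀ i ∈ I, x i = x' i := by
  constructor
  · intro h
    have h1 : ∀ i, (i ∈ I ↔ i ∈ I') ∧ (i ∈ I → x i = x' i) := by
      intro i
      have h2 := congrFun h i
      by_cases hi : i ∈ I <;> by_cases hi' : i ∈ I' <;> simp_all [partialWord]
    exact ⟨Finset.ext fun i => (h1 i).1, fun i => (h1 i).2⟩
  · rintro ⟨rfl, h⟩
    ext i : 1
    by_cases hi : i ∈ I
    · simp [partialWord, hi, h i hi]
    · simp [partialWord, hi]

/-- The restrictions of a word to all sets of `k` coordinates. -/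
def codePoints (k : ℕ) (w : ι × (R → F)) : Finset (ι × (R → Option F)) :=
  (powersetCard k univ).image fun I => (w.1, partialWord I w.2)

omit [Fintype F] in
theorem mem_codePoints {k : ℕ} {w : ι × (R → F)} {p : ι × (R → Option F)} :
    p ∈ codePoints k w ↔ ∃ I : Finset R, I.card = k ∧ (w.1, partialWord I w.2) = p := by
  simp [codePoints]

omit [Fintype F] in
theorem card_codePoints (k : ℕ) (w : ι × (R → F)) :
    (codePoints k w).card = (Fintype.card R).choose k := by
  rw [codePoints, Finset.card_image_of_injective, Finset.card_powersetCard, Finset.card_univ]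
  intro I I' h
  exact (partialWord_eq_iff.mp (Prod.ext_iff.mp h).2).1

omit [Fintype F] in
theorem mem_codePoints_partialWord {k : ℕ} {b : ι} {I : Finset R} (hI : I.card = k) {x : R → F}
    {w : ι × (R → F)} :
    (b, partialWord I x) ∈ codePoints k w ↔ w.1 = b ∧ ∀ i ∈ I, w.2 i = x i := by
  rw [mem_codePoints]
  constructor
  · rintro ⟨I', -, h⟩
    rw [Prod.mk.injEq, partialWord_eq_iff] at h
    exact ⟨h.1, fun i hi => h.2.2 i (h.2.1 ▸ hi)⟩
  · rintro ⟨h1, h2⟩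
    exact ⟨I, hI, Prod.ext h1 (partialWord_eq_iff.mpr ⟨rfl, h2⟩)⟩

variable [Fintype ι]

theorem card_filter_fst_eq_agree (b : ι) (I : Finset R) (x : R → F) :
    (univ.filter fun w : ι × (R → F) => w.1 = b ∧ ∀ i ∈ I, w.2 i = x i).card =
      Fintype.card F ^ (Fintype.card R - I.card) := by
  rw [← card_filter_agree I x, ← Finset.card_image_of_injective
    (univ.filter fun y : R → F => ∀ i ∈ I, y i = x i) (Prod.mk_right_injective b)]
  refine congrArg Finset.card (Finset.ext fun ⟨b', y⟩ => ?_)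
  simp only [Finset.mem_filter, Finset.mem_univ, true_and, Finset.mem_image, Prod.mk.injEq]
  constructor
  · rintro ⟨rfl, h⟩
    exact ⟨y, h, rfl, rfl⟩
  · rintro ⟨y', h, rfl, rfl⟩
    exact ⟨rfl, h⟩

theorem card_filter_mem_codePoints {k : ℕ} {w : ι × (R → F)} {p : ι × (R → Option F)}
    (hp : p ∈ codePoints k w) :
    (univ.filter fun w : ι × (R → F) => p ∈ codePoints k w).card =
      Fintype.card F ^ (Fintype.card R - k) := by
  obtain ⟨I, hI, rfl⟩ := mem_codePoints.mp hp
  simp_rw [mem_codePoints_partialWord hI]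
  rw [card_filter_fst_eq_agree, hI]

theorem card_filter_mem_codePoints_pair_le {k : ℕ} (hF : 1 ≤ Fintype.card F) {w : ι × (R → F)}
    {p p' : ι × (R → Option F)} (hp : p ∈ codePoints k w) (hp' : p' ∈ codePoints k w)
    (hne : p ≠ p') :
    (univ.filter fun w : ι × (R → F) => p ∈ codePoints k w ∧ p' ∈ codePoints k w).card ≤
      Fintype.card F ^ (Fintype.card R - (k + 1)) := by
  obtain ⟨I, hI, rfl⟩ := mem_codePoints.mp hp
  obtain ⟨I', hI', rfl⟩ := mem_codePoints.mp hp'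
  have hII : I ≠ I' := fun h => hne (by rw [h])
  have hcard : k + 1 ≤ (I ∪ I').card := by
    by_contra! h
    have h1 : I = I ∪ I' :=
      Finset.eq_of_subset_of_card_le Finset.subset_union_left (by omega)
    have h2 : I' = I ∪ I' :=
      Finset.eq_of_subset_of_card_le Finset.subset_union_right (by omega)
    exact hII (h1.trans h2.symm)
  refine le_trans (Finset.card_le_card ?_)
    ((card_filter_fst_eq_agree w.1 (I ∪ I') w.2).le.trans
      (Nat.pow_le_pow_right hF (by omega)))
  intro z hz
  rw [Finset.mem_filter, mem_codePoints_partialWord hI, mem_codePoints_partialWord hI'] at hz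
  refine Finset.mem_filter.mpr ⟨Finset.mem_univ _, hz.2.1.1, fun i hi => ?_⟩
  exact (Finset.mem_union.mp hi).elim (hz.2.1.2 i) (hz.2.2.2 i)

omit [Fintype ι] [Fintype F] in
theorem card_agree_lt_of_isPacking {k : ℕ} {S : Finset (ι × (R → F))}
    (hS : IsPacking (codePoints k) S) {b : ι} {x x' : R → F} (hx : (b, x) ∈ S)
    (hx' : (b, x') ∈ S) (hne : x ≠ x') : (univ.filter fun i => x i = x' i).card < k := by
  by_contra! h
  obtain ⟨I, hI, hIk⟩ := Finset.exists_subset_card_eq h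
  have h1 : (b, partialWord I x') ∈ codePoints k (b, x) :=
    (mem_codePoints_partialWord hIk).mpr ⟨rfl, fun i hi => (Finset.mem_filter.mp (hI hi)).2⟩
  have h2 : (b, partialWord I x') ∈ codePoints k (b, x') :=
    (mem_codePoints_partialWord hIk).mpr ⟨rfl, fun i _ => rfl⟩
  exact Finset.disjoint_left.mp (hS _ hx _ hx' fun h => hne (Prod.ext_iff.mp h).2) h1 h2

end Code

section Counting

variable {ι R B F : Type*} [Fintype ι] [Fintype R] [DecidableEq R] [Fintype B] [DecidableEq B]
  [Fintype F] [DecidableEq F] [DecidableEq ι]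

omit [Fintype B] [DecidableEq ι] in
theorem card_filter_blowupEdge_subset_le (pos : ι → R → B) (Y : Finset (B × F)) :
    (univ.filter fun w : ι × (R → F) => blowupEdge pos w ⊆ Y).card ≤
      Fintype.card ι * Y.card ^ Fintype.card R := by
  have h1 : (univ.filter fun w : ι × (R → F) => blowupEdge pos w ⊆ Y) ⊆
      univ ×ˢ Fintype.piFinset fun _ : R => Y.image Prod.snd := by
    intro w hw
    rw [Finset.mem_filter] at hw
    refine Finset.mem_product.mpr ⟨Finset.mem_univ _, Fintype.mem_piFinset.mpr fun i => ?_⟩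
    exact Finset.mem_image.mpr ⟨(pos w.1 i, w.2 i), hw.2 (mem_blowupEdge.mpr ⟨i, rfl, rfl⟩), rfl⟩
  refine (Finset.card_le_card h1).trans ?_
  rw [Finset.card_product, Finset.card_univ, Fintype.card_piFinset, Finset.prod_const,
    Finset.card_univ]
  gcongr
  exact Finset.card_image_le

theorem exists_subset_image_of_card_le {V : Type*} [DecidableEq V] {U : Finset V}
    (hU : U.Nonempty) {v : ℕ} (hv : U.card ≤ v) : ∃ y : Fin v → V, U ⊆ univ.image y := by
  obtain ⟨a, -⟩ := hU
  refine ⟨fun i => U.toList.getD i a, fun z hz => ?_⟩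
  obtain ⟨n, hn, rfl⟩ := List.getElem_of_mem (Finset.mem_toList.mpr hz)
  have hn' : n < v := by
    rw [Finset.length_toList] at hn
    omega
  exact Finset.mem_image.mpr ⟨⟨n, hn'⟩, Finset.mem_univ _, by
    simp [List.getElem?_eq_getElem hn]⟩

theorem card_filter_small_span_le [Nonempty R] (pos : ι → R → B) {e : ℕ} (he : 1 ≤ e) (v : ℕ) :
    (univ.filter fun T : Finset (ι × (R → F)) =>
        T.card = e ∧ (T.biUnion (blowupEdge pos)).card ≤ v).card ≤
      (Fintype.card B * Fintype.card F) ^ v * (Fintype.card ι * v ^ Fintype.card R) ^ e := by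
  have h1 : (univ.filter fun T : Finset (ι × (R → F)) =>
      T.card = e ∧ (T.biUnion (blowupEdge pos)).card ≤ v) ⊆
      (univ : Finset (Fin v → B × F)).biUnion fun y => powersetCard e
        (univ.filter fun w : ι × (R → F) => blowupEdge pos w ⊆ univ.image y) := by
    intro T hT
    rw [Finset.mem_filter] at hT
    obtain ⟨w, hw⟩ : T.Nonempty := by
      rw [← Finset.card_pos]; omega
    have hne : (T.biUnion (blowupEdge pos)).Nonempty :=
      ⟨(pos w.1 (Classical.arbitrary R), w.2 (Classical.arbitrary R)),
        Finset.mem_biUnion.mpr ⟨w, hw, mem_blowupEdge.mpr ⟨Classical.arbitrary R, rfl, rfl⟩⟩⟩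
    obtain ⟨y, hy⟩ := exists_subset_image_of_card_le hne hT.2.2
    refine Finset.mem_biUnion.mpr ⟨y, Finset.mem_univ _, Finset.mem_powersetCard.mpr
      ⟨fun w hw => Finset.mem_filter.mpr ⟨Finset.mem_univ _, ?_⟩, hT.2.1⟩⟩
    exact (Finset.subset_biUnion_of_mem (blowupEdge pos) hw).trans hy
  refine (Finset.card_le_card h1).trans ((Finset.card_biUnion_le_card_mul _ _
    ((Fintype.card ι * v ^ Fintype.card R) ^ e) fun y _ => ?_).trans (le_of_eq ?_))
  · rw [Finset.card_powersetCard]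
    refine (Nat.choose_le_pow _ _).trans (Nat.pow_le_pow_left ?_ e)
    refine (card_filter_blowupEdge_subset_le pos _).trans ?_
    gcongr
    exact Finset.card_image_le.trans (by simp)
  · simp

end Counting

/-- The families of at most `m` edges of the blow-up spanning few vertices have small total
weight. -/
theorem sum_pow_card_small_span_le {ι R B : Type*} [Fintype ι] [DecidableEq ι] [Fintype R]
    [DecidableEq R] [Nonempty R] [Fintype B] [DecidableEq B] (pos : ι → R → B) {r k m D q : ℕ}
    (hr : Fintype.card R = r) (hkr : k ≤ r) (hk : 1 ≤ k) (hq : 1 ≤ q) :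
    ∑ T ∈ univ.filter (fun T : Finset (ι × (R → Fin q)) => T.Nonempty ∧ T.card ≤ m ∧
        (T.biUnion (blowupEdge pos)).card + T.card * k < T.card * r + k),
      ((D : ℝ) / (q ^ (r - k) : ℕ)) ^ T.card ≤
    (∑ e ∈ range (m + 1), (Fintype.card B : ℝ) ^ (e * (r - k) + (k - 1)) *
      (Fintype.card ι * ((e * (r - k) + (k - 1) : ℕ) : ℝ) ^ r) ^ e * (D : ℝ) ^ e) *
      (q : ℝ) ^ (k - 1) := by
  have hq0 : (0 : ℝ) < q := by exact_mod_cast hq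
  rw [← Finset.sum_fiberwise_of_maps_to (g := Finset.card) (t := range (m + 1)) fun T hT =>
    Finset.mem_range.mpr (Nat.lt_succ_of_le (Finset.mem_filter.mp hT).2.2.1), Finset.sum_mul]
  refine Finset.sum_le_sum fun e _ => ?_
  set Bad := univ.filter (fun T : Finset (ι × (R → Fin q)) => T.Nonempty ∧ T.card ≤ m ∧
    (T.biUnion (blowupEdge pos)).card + T.card * k < T.card * r + k) with hBad
  set v := e * (r - k) + (k - 1) with hv
  have h1 : ∑ T ∈ Bad.filter (fun T => T.card = e), ((D : ℝ) / (q ^ (r - k) : ℕ)) ^ T.card =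
      (Bad.filter fun T => T.card = e).card * ((D : ℝ) / (q ^ (r - k) : ℕ)) ^ e := by
    rw [← nsmul_eq_mul, ← Finset.sum_const]
    exact Finset.sum_congr rfl fun T hT => by rw [(Finset.mem_filter.mp hT).2]
  have h2 : (Bad.filter fun T => T.card = e).card ≤
      (Fintype.card B * q) ^ v * (Fintype.card ι * v ^ r) ^ e := by
    rcases Nat.eq_zero_or_pos e with rfl | he
    · rw [Finset.card_eq_zero.mpr]
      · exact Nat.zero_le _
      · refine Finset.filter_eq_empty_iff.mpr fun T hT h0 => ?_
        have h3 := (Finset.mem_filter.mp hT).2.1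
        rw [Finset.card_eq_zero] at h0
        exact h3.ne_empty h0
    · have h3 := card_filter_small_span_le (F := Fin q) pos he v
      rw [Fintype.card_fin, hr] at h3
      refine le_trans (Finset.card_le_card fun T hT => ?_) h3
      rw [Finset.mem_filter, hBad, Finset.mem_filter] at hT
      refine Finset.mem_filter.mpr ⟨Finset.mem_univ _, hT.2, ?_⟩
      have h4 := hT.1.2.2.2
      rw [hT.2] at h4
      have h5 : e * r = e * (r - k) + e * k := by
        rw [← Nat.mul_add, Nat.sub_add_cancel hkr]
      omega
  rw [h1]
  have h3 : ((Bad.filter fun T => T.card = e).card : ℝ) ≤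
      ((Fintype.card B : ℝ) * q) ^ v * (Fintype.card ι * (v : ℝ) ^ r) ^ e := by
    exact_mod_cast h2
  refine (mul_le_mul_of_nonneg_right h3 (by positivity)).trans (le_of_eq ?_)
  have h4 : (q : ℝ) ^ v = ((q : ℝ) ^ (r - k)) ^ e * (q : ℝ) ^ (k - 1) := by
    rw [hv, pow_add, ← pow_mul, mul_comm e]
  rw [mul_pow, h4, div_pow]
  push_cast
  field_simp

theorem exists_isUnionFree_blowup {ι R B : Type} [Fintype ι] [Nonempty ι] [Fintype R]
    [Fintype B] [DecidableEq B] {pos : ι → R → B} {o : R} {t k : ℕ} (ht : 2 ≤ t) (hk : 1 ≤ k)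
    (hR : Fintype.card R = t * k) (hb : IsBlowupBase pos o k) {η : ℝ} (hη : 0 < η) :
    ∃ q₀ : ℕ, ∀ q ≥ q₀, ∃ H : Finset (Finset (B × Fin q)), (∀ e ∈ H, e.card = t * k) ∧
      IsUnionFree (t + 1) H ∧ (1 - η) * (Fintype.card ι * (q : ℝ) ^ k) ≤ H.card := by
  classical
  have hkr : k < t * k := by nlinarith
  have : Nonempty R := ⟨o⟩
  have hg : 2 ≤ (t * k).choose k := by
    have h1 : (k + 1).choose k ≤ (t * k).choose k := Nat.choose_le_choose k (by omega)
    rw [Nat.choose_succ_self_right] at h1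
    omega
  obtain ⟨D, δ, hδ, hpack⟩ :=
    exists_random_packing_card.{0, 0} ((t * k).choose k) hg (η / 2) (by positivity)
  set K : ℝ := ∑ e ∈ range (2 * t + 2 + 1),
    (Fintype.card B : ℝ) ^ (e * (t * k - k) + (k - 1)) *
      (Fintype.card ι * ((e * (t * k - k) + (k - 1) : ℕ) : ℝ) ^ (t * k)) ^ e * (D : ℝ) ^ e with hK
  have hι : (0 : ℝ) < Fintype.card ι := by exact_mod_cast Fintype.card_pos
  obtain ⟨q₁, hq₁⟩ := exists_nat_ge (1 / δ)
  obtain ⟨q₂, hq₂⟩ := exists_nat_ge (K / (η / 2 * Fintype.card ι))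
  refine ⟨max 1 (max q₁ q₂), fun q hq => ?_⟩
  have hq1 : 1 ≤ q := (le_max_left _ _).trans hq
  have hqδ : 1 / δ ≤ q := hq₁.trans (by
    exact_mod_cast ((le_max_left _ _).trans (le_max_right _ _)).trans hq)
  have hqK : K / (η / 2 * Fintype.card ι) ≤ q := hq₂.trans (by
    exact_mod_cast ((le_max_right _ _).trans (le_max_right _ _)).trans hq)
  have hq0 : (0 : ℝ) < q := by exact_mod_cast hq1
  have : Nonempty (Fin q) := ⟨⟨0, hq1⟩⟩
  obtain ⟨E, hpos, hone, hcard, hT⟩ := hpack (ι × (R → Option (Fin q))) (ι × (R → Fin q))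
    (codePoints k) (q ^ (t * k - k)) (by positivity) (fun w => by rw [card_codePoints, hR])
    (fun w p hp => by rw [card_filter_mem_codePoints hp, hR, Fintype.card_fin])
    (fun w p hp p' hp' hne => by
      have h1 := card_filter_mem_codePoints_pair_le (by rwa [Fintype.card_fin]) hp hp' hne
      rw [hR, Fintype.card_fin] at h1
      have h2 : ((q ^ (t * k - (k + 1)) : ℕ) : ℝ) ≤ δ * (q ^ (t * k - k) : ℕ) := by
        rw [show t * k - k = (t * k - (k + 1)) + 1 by omega]
        push_cast
        rw [pow_succ]
        have h3 : 1 ≤ δ * q := by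
          rw [div_le_iff₀ hδ] at hqδ
          linarith
        have h4 : (0 : ℝ) < (q : ℝ) ^ (t * k - (k + 1)) := by positivity
        nlinarith
      exact le_trans (by exact_mod_cast h1) h2)
  set Bad := univ.filter (fun T : Finset (ι × (R → Fin q)) => T.Nonempty ∧ T.card ≤ 2 * t + 2 ∧
    (T.biUnion (blowupEdge pos)).card + T.card * k < T.card * (t * k) + k) with hBad
  obtain ⟨S, hS, hES⟩ := exists_packing_ge hpos hone
    ((fun S : Finset (ι × (R → Fin q)) => (S.card : ℝ)) -
      ∑ T ∈ Bad, fun S => if T ⊆ S then 1 else 0)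
  obtain ⟨S', hS', hav, hSS⟩ := exists_subset_avoiding S Bad
    fun T hT => (Finset.mem_filter.mp hT).2.1
  have hbad : ∑ T ∈ Bad, E (fun S => if T ⊆ S then 1 else 0) ≤ K * (q : ℝ) ^ (k - 1) :=
    (Finset.sum_le_sum fun T _ => hT T).trans
      (sum_pow_card_small_span_le pos hR hkr.le hk hq1)
  have hlow : (1 - η) * (Fintype.card ι * (q : ℝ) ^ k) ≤ S'.card := by
    rw [map_sub, map_sum, Pi.sub_apply, Finset.sum_apply, Finset.sum_boole] at hES
    have h1 : (S.card : ℝ) ≤ S'.card + (Bad.filter fun T => T ⊆ S).card := by exact_mod_cast hSS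
    have h2 : (Fintype.card (ι × (R → Fin q)) : ℝ) / (q ^ (t * k - k) : ℕ) =
        Fintype.card ι * (q : ℝ) ^ k := by
      rw [Fintype.card_prod, Fintype.card_fun, Fintype.card_fin, hR]
      push_cast
      rw [div_eq_iff (by positivity), mul_assoc, ← pow_add]
      congr 3
      omega
    have h3 : K * (q : ℝ) ^ (k - 1) ≤ η / 2 * (Fintype.card ι * (q : ℝ) ^ k) := by
      rw [div_le_iff₀ (by positivity)] at hqK
      have h4 : (q : ℝ) ^ k = q ^ (k - 1) * q := by rw [← pow_succ, Nat.sub_add_cancel hk]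
      have h5 : (0 : ℝ) < (q : ℝ) ^ (k - 1) := by positivity
      rw [h4]
      nlinarith
    rw [h2] at hcard
    linarith
  refine ⟨S'.image (blowupEdge pos), fun e he => ?_, ?_, ?_⟩
  · obtain ⟨w, -, rfl⟩ := Finset.mem_image.mp he
    rw [card_blowupEdge hb, hR]
  · refine isUnionFree_blowup ht hk hR hb (fun b x x' hx hx' hne => ?_) fun T hTS hne hTc => ?_
    · exact card_agree_lt_of_isPacking hS (hS' hx) (hS' hx') hne
    · by_contra! h
      exact hav T (Finset.mem_filter.mpr ⟨Finset.mem_univ _, hne, hTc, h⟩) hTS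
  · rwa [Finset.card_image_of_injective _ (blowupEdge_injective hb (by omega))]

/-- In a transitive action, an element is moved into a given set by the expected number of group
elements. -/
theorem card_filter_inv_smul_mem {G C : Type*} [Group G] [Fintype G] [MulAction G C] [Fintype C]
    [DecidableEq C] [MulAction.IsPretransitive G C] (𝒢 : Finset C) (c : C) :
    (univ.filter fun g : G => g⁻¹ • c ∈ 𝒢).card * Fintype.card C =
      Fintype.card G * 𝒢.card := by
  have h1 : ∀ c', (univ.filter fun g : G => g⁻¹ • c' ∈ 𝒢).card =
      (univ.filter fun g : G => g⁻¹ • c ∈ 𝒢).card := by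
    intro c'
    obtain ⟨s, rfl⟩ := MulAction.exists_smul_eq G c c'
    refine Finset.card_bij (fun g _ => s⁻¹ * g) (fun g hg => ?_)
      (fun g _ g' _ h => mul_left_cancel h) fun g hg => ⟨s * g, ?_, by group⟩
    · simpa [mul_smul] using hg
    · simpa [mul_smul] using hg
  have h2 := Finset.sum_card_bipartiteAbove_eq_sum_card_bipartiteBelow
    (s := (univ : Finset G)) (t := (univ : Finset C)) (fun g c => g⁻¹ • c ∈ 𝒢)
  simp only [Finset.bipartiteAbove, Finset.bipartiteBelow, h1, Finset.sum_const,
    Finset.card_univ, smul_eq_mul] at h2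
  rw [mul_comm, ← h2, ← smul_eq_mul, ← Finset.card_univ, ← Finset.sum_const]
  refine Finset.sum_congr rfl fun g _ => ?_
  refine Finset.card_bij (fun c _ => g⁻¹ • c) (fun c hc => by simpa using hc)
    (fun c _ c' _ h => MulAction.injective _ h) fun c hc => ⟨g • c, ?_, by simp⟩
  simpa using hc

section Label

variable {X F : Type*} [Fintype X] [DecidableEq X] [Fintype F] [DecidableEq F] [AddCommGroup F]

theorem card_filter_agree_sum_eq {I J : Finset X} (h : ¬J ⊆ I) (y : X → F) (a : F) :
    (univ.filter fun u : X → F => (∀ i ∈ I, u i = y i) ∧ ∑ i ∈ J, u i = a).card =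
      Fintype.card F ^ (Fintype.card X - (I.card + 1)) := by
  obtain ⟨j, hjJ, hjI⟩ := Finset.not_subset.mp h
  rw [← Finset.card_insert_of_notMem hjI, ← card_filter_agree (insert j I) y]
  have hsum : ∀ (u : X → F) (b : F), ∑ i ∈ J, Function.update u j b i =
      b + ∑ i ∈ J.erase j, u i := by
    intro u b
    rw [← Finset.add_sum_erase _ _ hjJ, Function.update_self]
    congr 1
    exact Finset.sum_congr rfl fun i hi =>
      Function.update_of_ne (Finset.ne_of_mem_erase hi) _ _
  refine Finset.card_nbij' (fun u => Function.update u j (y j))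
    (fun u => Function.update u j (a - ∑ i ∈ J.erase j, u i)) ?_ ?_ ?_ ?_
  · intro u hu
    simp only [Finset.coe_filter, Finset.mem_univ, true_and, Set.mem_ofPred_eq] at hu ⊢
    intro i hi
    by_cases hij : i = j
    · rw [hij, Function.update_self]
    · rw [Function.update_of_ne hij]
      exact hu.1 i (Finset.mem_of_mem_insert_of_ne hi hij)
  · intro u hu
    simp only [Finset.coe_filter, Finset.mem_univ, true_and, Set.mem_ofPred_eq] at hu ⊢
    refine ⟨fun i hi => ?_, ?_⟩
    · rw [Function.update_of_ne (ne_of_mem_of_not_mem hi hjI)]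
      exact hu i (Finset.mem_insert_of_mem hi)
    · rw [hsum]
      abel
  · intro u hu
    simp only [Finset.coe_filter, Finset.mem_univ, true_and, Set.mem_ofPred_eq] at hu
    ext i
    by_cases hij : i = j
    · subst hij
      simp only [Function.update_self]
      rw [← hu.2, ← Finset.add_sum_erase _ _ hjJ, sub_eq_iff_eq_add]
      congr 1
      exact Finset.sum_congr rfl fun i hi =>
        (Function.update_of_ne (Finset.ne_of_mem_erase hi) _ _).symm
    · simp [Function.update_of_ne hij]
  · intro u hu
    simp only [Finset.coe_filter, Finset.mem_univ, true_and, Set.mem_ofPred_eq] at hu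
    ext i
    by_cases hij : i = j
    · subst hij
      simp [hu i (Finset.mem_insert_self _ _)]
    · simp [Function.update_of_ne hij]

theorem card_filter_agree_sum_ne {I J : Finset X} (h : ¬J ⊆ I) (y : X → F) :
    (univ.filter fun u : X → F => (∀ i ∈ I, u i = y i) ∧ ∑ i ∈ J, u i ≠ 0).card =
      Fintype.card F ^ (Fintype.card X - I.card) -
        Fintype.card F ^ (Fintype.card X - (I.card + 1)) := by
  rw [← card_filter_agree I y, ← card_filter_agree_sum_eq h y 0]
  have h1 := Finset.card_filter_add_card_filter_not (s := univ.filter fun u : X → F =>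
    ∀ i ∈ I, u i = y i) (fun u => ∑ i ∈ J, u i = 0)
  rw [Finset.filter_filter, Finset.filter_filter] at h1
  exact Nat.eq_sub_of_add_eq' (by convert h1 using 2)

variable {C : Type*} [Fintype C] [DecidableEq C] {S : C → Finset X}

theorem card_filter_label (hS : ∀ c, (S c).Nonempty) (𝒢 : Finset C) :
    (univ.filter fun x : C → X → F => ∀ c, ∑ i ∈ S c, x c i ≠ 0 ↔ c ∈ 𝒢).card =
      (Fintype.card F ^ Fintype.card X - Fintype.card F ^ (Fintype.card X - 1)) ^ 𝒢.card *
        (Fintype.card F ^ (Fintype.card X - 1)) ^ (Fintype.card C - 𝒢.card) := by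
  have h1 : (univ.filter fun x : C → X → F => ∀ c, ∑ i ∈ S c, x c i ≠ 0 ↔ c ∈ 𝒢) =
      Fintype.piFinset fun c => univ.filter fun u : X → F => ∑ i ∈ S c, u i ≠ 0 ↔ c ∈ 𝒢 := by
    ext x
    simp
  have h2 : ∀ c, (univ.filter fun u : X → F => ∑ i ∈ S c, u i ≠ 0 ↔ c ∈ 𝒢).card =
      if c ∈ 𝒢 then Fintype.card F ^ Fintype.card X - Fintype.card F ^ (Fintype.card X - 1)
      else Fintype.card F ^ (Fintype.card X - 1) := by
    intro c
    have hc : ¬S c ⊆ ∅ := fun h => (hS c).ne_empty (Finset.subset_empty.mp h)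
    split_ifs with h
    · simpa [h] using card_filter_agree_sum_ne hc (0 : X → F)
    · simpa [h] using card_filter_agree_sum_eq hc (0 : X → F) 0
  rw [h1, Fintype.card_piFinset]
  simp_rw [h2]
  rw [Finset.prod_ite, Finset.prod_const, Finset.prod_const, Finset.filter_mem_eq_inter,
    Finset.univ_inter, Finset.filter_not, Finset.filter_mem_eq_inter, Finset.univ_inter,
    ← Finset.compl_eq_univ_sdiff, Finset.card_compl]

theorem card_filter_label_agree {k : ℕ} (hS : ∀ c, (S c).card = k)
    (hinj : Function.Injective S) {𝒢 : Finset C} {c₀ : C} (hc₀ : c₀ ∈ 𝒢) {y : C → X → F}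
    (hy : ∑ i ∈ S c₀, y c₀ i ≠ 0) :
    (univ.filter fun x : C → X → F => (∀ i ∈ S c₀, ∀ c, x c i = y c i) ∧
      ∀ c, ∑ i ∈ S c, x c i ≠ 0 ↔ c ∈ 𝒢).card =
      Fintype.card F ^ (Fintype.card X - k) *
        ((Fintype.card F ^ (Fintype.card X - k) -
          Fintype.card F ^ (Fintype.card X - (k + 1))) ^ (𝒢.card - 1) *
        (Fintype.card F ^ (Fintype.card X - (k + 1))) ^ (Fintype.card C - 𝒢.card)) := by
  have h1 : (univ.filter fun x : C → X → F => (∀ i ∈ S c₀, ∀ c, x c i = y c i) ∧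
      ∀ c, ∑ i ∈ S c, x c i ≠ 0 ↔ c ∈ 𝒢) =
      Fintype.piFinset fun c => univ.filter fun u : X → F =>
        (∀ i ∈ S c₀, u i = y c i) ∧ (∑ i ∈ S c, u i ≠ 0 ↔ c ∈ 𝒢) := by
    ext x
    simp only [Finset.mem_filter, Finset.mem_univ, true_and, Fintype.mem_piFinset]
    exact ⟨fun h c => ⟨fun i hi => h.1 i hi c, h.2 c⟩,
      fun h => ⟨fun i hi c => (h c).1 i hi, fun c => (h c).2⟩⟩
  have h2 : ∀ c, c ≠ c₀ → (univ.filter fun u : X → F =>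
      (∀ i ∈ S c₀, u i = y c i) ∧ (∑ i ∈ S c, u i ≠ 0 ↔ c ∈ 𝒢)).card =
      if c ∈ 𝒢 then Fintype.card F ^ (Fintype.card X - k) -
          Fintype.card F ^ (Fintype.card X - (k + 1))
      else Fintype.card F ^ (Fintype.card X - (k + 1)) := by
    intro c hne
    have hc : ¬S c ⊆ S c₀ := fun h =>
      hne (hinj (Finset.eq_of_subset_of_card_le h (by rw [hS, hS])))
    split_ifs with h
    · simpa [h, hS] using card_filter_agree_sum_ne hc (y c)
    · simpa [h, hS] using card_filter_agree_sum_eq hc (y c) 0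
  have h3 : (univ.filter fun u : X → F =>
      (∀ i ∈ S c₀, u i = y c₀ i) ∧ (∑ i ∈ S c₀, u i ≠ 0 ↔ c₀ ∈ 𝒢)).card =
      Fintype.card F ^ (Fintype.card X - k) := by
    rw [← hS c₀, ← card_filter_agree (S c₀) (y c₀)]
    congr 1
    ext u
    simp only [Finset.mem_filter, Finset.mem_univ, true_and, hc₀, iff_true, and_iff_left_iff_imp]
    intro h
    rwa [Finset.sum_congr rfl h]
  rw [h1, Fintype.card_piFinset, ← Finset.mul_prod_erase _ _ (Finset.mem_univ c₀), h3,
    Finset.prod_congr rfl fun c hc => h2 c (Finset.ne_of_mem_erase hc), Finset.prod_ite,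
    Finset.prod_const, Finset.prod_const]
  congr 3
  · rw [← Finset.card_erase_of_mem hc₀]
    congr 1
    ext c
    simp
  · rw [← Finset.card_compl]
    congr 1
    ext c
    simp only [Finset.mem_filter, Finset.mem_erase, Finset.mem_univ, and_true, Finset.mem_compl,
      and_iff_right_iff_imp]
    rintro h rfl
    exact h hc₀

end Label

theorem card_filter_univ_subtype {γ : Type*} [Fintype γ] (p q : γ → Prop) [DecidablePred p]
    [DecidablePred q] : (univ.filter fun x : {x // p x} => q x.1).card =
      (univ.filter fun x => q x ∧ p x).card := by
  rw [← Finset.card_map (Function.Embedding.subtype p)]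
  congr 1
  ext x
  simp [and_comm]

section LabelWord

variable {X C T : Type*}

/-- A word consists of a pattern `τ`, given by the set `𝒢 τ` of colours, and of labels, one for each
vertex and each colour, such that the labels in a colour sum to a nonzero value over the set of that
colour exactly if the colour belongs to the pattern. -/
abbrev LabelWord (S : C → Finset X) (𝒢 : T → Finset C) (F : Type*) [AddCommGroup F] :=
  Σ τ : T, {x : C → X → F // ∀ c, ∑ i ∈ S c, x c i ≠ 0 ↔ c ∈ 𝒢 τ}

variable {F : Type*} [AddCommGroup F] {S : C → Finset X} {𝒢 : T → Finset C}

/-- A vertex together with its labels. -/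
def labelVertex (x : C → X → F) (i : X) : X × (C → F) := (i, fun c => x c i)

variable [DecidableEq X] [DecidableEq C] [DecidableEq F]

section

variable [Fintype C]

/-- The labelled set of colour `c`. -/
def labelPoint (S : C → Finset X) (x : C → X → F) (c : C) : Finset (X × (C → F)) :=
  (S c).image (labelVertex x)

/-- The labelled sets whose colours belong to the pattern of a word. -/
def labelPoints (w : LabelWord S 𝒢 F) : Finset (Finset (X × (C → F))) :=
  (𝒢 w.1).image (labelPoint S w.2.1)

omit [AddCommGroup F] [DecidableEq C] in
theorem labelPoint_eq_iff (hinj : Function.Injective S) {x x' : C → X → F} {c c' : C} :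
    labelPoint S x c = labelPoint S x' c' ↔ c = c' ∧ ∀ i ∈ S c, ∀ d, x d i = x' d i := by
  constructor
  · intro h
    have h1 : ∀ z : X × (C → F), (∃ i ∈ S c, labelVertex x i = z) ↔
        ∃ i ∈ S c', labelVertex x' i = z := by
      intro z
      simpa [labelPoint] using Finset.ext_iff.mp h z
    have h2 : ∀ i ∈ S c, i ∈ S c' ∧ ∀ d, x d i = x' d i := by
      intro i hi
      obtain ⟨j, hj, hij⟩ := (h1 _).mp ⟨i, hi, rfl⟩
      obtain ⟨rfl, h3⟩ := Prod.ext_iff.mp hij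
      exact ⟨hj, fun d => (congrFun h3 d).symm⟩
    have h3 : ∀ i ∈ S c', i ∈ S c := by
      intro i hi
      obtain ⟨j, hj, hij⟩ := (h1 _).mpr ⟨i, hi, rfl⟩
      obtain ⟨rfl, -⟩ := Prod.ext_iff.mp hij
      exact hj
    exact ⟨hinj (Finset.ext fun i => ⟨fun hi => (h2 i hi).1, h3 i⟩), fun i hi => (h2 i hi).2⟩
  · rintro ⟨rfl, h⟩
    refine Finset.image_congr fun i hi => ?_
    exact Prod.ext rfl (funext fun d => h i hi d)

omit [DecidableEq C] in
theorem labelPoint_mem_labelPoints (hinj : Function.Injective S) {x : C → X → F} {c : C}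
    {w : LabelWord S 𝒢 F} : labelPoint S x c ∈ labelPoints w ↔
      c ∈ 𝒢 w.1 ∧ ∀ i ∈ S c, ∀ d, w.2.1 d i = x d i := by
  rw [labelPoints, Finset.mem_image]
  constructor
  · rintro ⟨c', hc', h⟩
    obtain ⟨rfl, h'⟩ := (labelPoint_eq_iff hinj).mp h
    exact ⟨hc', fun i hi d => h' i hi d⟩
  · rintro ⟨hc, h⟩
    exact ⟨c, hc, (labelPoint_eq_iff hinj).mpr ⟨rfl, h⟩⟩

omit [DecidableEq C] in
theorem card_labelPoints (hinj : Function.Injective S) (w : LabelWord S 𝒢 F) :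
    (labelPoints w).card = (𝒢 w.1).card := by
  rw [labelPoints, Finset.card_image_of_injective]
  exact fun c c' h => ((labelPoint_eq_iff hinj).mp h).1

omit [DecidableEq C] in
/-- In a packing, a labelled set of one word is not contained in the vertex set of another. -/
theorem exists_labelVertex_ne_of_isPacking (hinj : Function.Injective S)
    {U : Finset (LabelWord S 𝒢 F)} (hU : IsPacking labelPoints U) {w w' : LabelWord S 𝒢 F}
    (hw : w ∈ U) (hw' : w' ∈ U) (hne : w ≠ w') {c : C} (hc : c ∈ 𝒢 w.1) :
    ∃ i ∈ S c, ∀ j, labelVertex w'.2.1 j ≠ labelVertex w.2.1 i := by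
  by_contra! h
  have h1 : ∀ i ∈ S c, ∀ d, w'.2.1 d i = w.2.1 d i := by
    intro i hi d
    obtain ⟨j, hj⟩ := h i hi
    obtain ⟨rfl, h2⟩ := Prod.ext_iff.mp hj
    exact congrFun h2 d
  have h2 : c ∈ 𝒢 w'.1 := by
    rw [← w'.2.2, Finset.sum_congr rfl fun i hi => h1 i hi c]
    exact (w.2.2 c).mpr hc
  exact Finset.disjoint_left.mp (hU w hw w' hw' hne)
    ((labelPoint_mem_labelPoints (x := w.2.1) hinj).mpr ⟨hc, fun _ _ _ => rfl⟩)
    ((labelPoint_mem_labelPoints hinj).mpr ⟨h2, h1⟩)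

end

variable [Fintype X] [Fintype C] [Fintype T] [Fintype F]

theorem card_labelWord (hS : ∀ c, (S c).Nonempty) {f : ℕ} (hf : ∀ τ, (𝒢 τ).card = f) :
    Fintype.card (LabelWord S 𝒢 F) = Fintype.card T *
      ((Fintype.card F ^ Fintype.card X - Fintype.card F ^ (Fintype.card X - 1)) ^ f *
        (Fintype.card F ^ (Fintype.card X - 1)) ^ (Fintype.card C - f)) := by
  rw [Fintype.card_sigma]
  simp_rw [Fintype.card_subtype]
  simp_rw [card_filter_label hS, hf]
  rw [Finset.sum_const, Finset.card_univ, smul_eq_mul]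

theorem card_filter_mem_labelPoints {k f M : ℕ} (hS : ∀ c, (S c).card = k)
    (hinj : Function.Injective S) (hf : ∀ τ, (𝒢 τ).card = f)
    (hM : ∀ c, (univ.filter fun τ => c ∈ 𝒢 τ).card = M) {w : LabelWord S 𝒢 F}
    {p : Finset (X × (C → F))} (hp : p ∈ labelPoints w) :
    (univ.filter fun w : LabelWord S 𝒢 F => p ∈ labelPoints w).card = M *
      (Fintype.card F ^ (Fintype.card X - k) *
        ((Fintype.card F ^ (Fintype.card X - k) -
          Fintype.card F ^ (Fintype.card X - (k + 1))) ^ (f - 1) *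
        (Fintype.card F ^ (Fintype.card X - (k + 1))) ^ (Fintype.card C - f))) := by
  obtain ⟨c, hc, rfl⟩ := Finset.mem_image.mp hp
  simp_rw [labelPoint_mem_labelPoints hinj]
  have h1 : (univ.filter fun v : LabelWord S 𝒢 F =>
      c ∈ 𝒢 v.1 ∧ ∀ i ∈ S c, ∀ d, v.2.1 d i = w.2.1 d i) =
      (univ.filter fun τ => c ∈ 𝒢 τ).sigma fun τ =>
        univ.filter fun x : {x : C → X → F // ∀ c, ∑ i ∈ S c, x c i ≠ 0 ↔ c ∈ 𝒢 τ} =>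
          ∀ i ∈ S c, ∀ d, x.1 d i = w.2.1 d i := by
    ext v
    simp
  rw [h1, Finset.card_sigma, ← hM c, ← smul_eq_mul, ← Finset.sum_const]
  refine Finset.sum_congr rfl fun τ hτ => ?_
  rw [Finset.mem_filter] at hτ
  rw [card_filter_univ_subtype _ fun x : C → X → F => ∀ i ∈ S c, ∀ d, x d i = w.2.1 d i,
    card_filter_label_agree hS hinj hτ.2 ((w.2.2 c).mpr hc), hf]

theorem card_filter_mem_labelPoints_pair_le {k : ℕ} (hS : ∀ c, (S c).card = k)
    (hinj : Function.Injective S) {w : LabelWord S 𝒢 F} {p p' : Finset (X × (C → F))}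
    (hp : p ∈ labelPoints w) (hp' : p' ∈ labelPoints w) (hne : p ≠ p') :
    Fintype.card F *
      (univ.filter fun w : LabelWord S 𝒢 F => p ∈ labelPoints w ∧ p' ∈ labelPoints w).card ≤
      (univ.filter fun w : LabelWord S 𝒢 F => p ∈ labelPoints w).card := by
  obtain ⟨c, hc, rfl⟩ := Finset.mem_image.mp hp
  obtain ⟨c', hc', rfl⟩ := Finset.mem_image.mp hp'
  have hcc : c ≠ c' := fun h => hne (by rw [h])
  obtain ⟨j, hj', hj⟩ := Finset.not_subset.mp fun h : S c' ⊆ S c =>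
    hcc (hinj (Finset.eq_of_subset_of_card_le h (by rw [hS, hS])).symm)
  simp_rw [labelPoint_mem_labelPoints hinj]
  rw [← Finset.card_univ, ← Finset.card_product]
  have hsum : ∀ (x : C → X → F) (a : F) (d : C),
      ∑ i ∈ S d, (x + (Pi.single c (Pi.single j a : X → F) : C → X → F)) d i = ∑ i ∈ S d, x d i := by
    intro x a d
    by_cases hd : d = c
    · subst hd
      refine Finset.sum_congr rfl fun i hi => ?_
      simp [ne_of_mem_of_not_mem hi hj]
    · simp [hd]
  refine Finset.card_le_card_of_injOn
    (fun z : F × LabelWord S 𝒢 F => (⟨z.2.1, z.2.2.1 + (Pi.single c (Pi.single j z.1 : X → F) : C → X → F), fun d => by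
      rw [hsum]; exact z.2.2.2 d⟩ : LabelWord S 𝒢 F)) ?_ ?_
  · rintro ⟨a, v⟩ hv
    simp only [Finset.coe_product, Finset.coe_univ, Finset.coe_filter, Finset.mem_univ, true_and,
      Set.mem_prod, Set.mem_univ, Set.mem_ofPred_eq] at hv ⊢
    refine ⟨hv.1.1, fun i hi d => ?_⟩
    by_cases hd : d = c
    · subst hd
      simp [ne_of_mem_of_not_mem hi hj, hv.1.2 i hi]
    · simp [hd, hv.1.2 i hi]
  · rintro ⟨a, τ, x, hx⟩ hv ⟨a', τ', x', hx'⟩ hv' h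
    simp only [Finset.coe_product, Finset.coe_univ, Finset.coe_filter, Finset.mem_univ, true_and,
      Set.mem_prod, Set.mem_univ, Set.mem_ofPred_eq] at hv hv'
    obtain ⟨h1, h2⟩ := Sigma.mk.inj_iff.mp h
    obtain rfl : τ = τ' := h1
    have h3 : x + (Pi.single c (Pi.single j a : X → F) : C → X → F) = x' + (Pi.single c (Pi.single j a' : X → F) : C → X → F) :=
      congrArg Subtype.val (eq_of_heq h2)
    have h4 : a = a' := by
      have h5 := congrFun (congrFun h3 c) j
      simpa [hv.2.2 j hj' c, hv'.2.2 j hj' c] using h5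
    subst h4
    obtain rfl : x = x' := add_right_cancel h3
    rfl

end LabelWord

set_option maxHeartbeats 1000000 in
open scoped Pointwise in
/-- Copies of a `k`-graph can be packed almost perfectly into the `k`-subsets of a larger vertex set
so that no edge of a copy is contained in the vertex set of another copy. -/
theorem exists_packing_of_copies {X : Type} [Fintype X] {k : ℕ} (hk : 1 ≤ k)
    (hX : k < Fintype.card X) (𝓕 : Finset (Set.powersetCard X k)) (hf : 2 ≤ 𝓕.card) {η : ℝ}
    (hη : 0 < η) :
    ∃ (V J : Type) (_ : Fintype V) (_ : Fintype J) (φ : J → X → V),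
      Nonempty V ∧ (∀ j, Function.Injective (φ j)) ∧
      (∀ j j', j ≠ j' → ∀ c ∈ 𝓕, ∃ i ∈ (c : Finset X), ∀ i', φ j' i' ≠ φ j i) ∧
      (1 - η) * ((Fintype.card X).choose k * (Fintype.card V / Fintype.card X : ℝ) ^ k) ≤
        Fintype.card J * 𝓕.card := by
  classical
  obtain ⟨D, δ, hδ, hpack⟩ := exists_random_packing_card.{0, 0} 𝓕.card hf (η / 2) (by positivity)
  obtain ⟨q₁, hq₁⟩ := exists_nat_ge (1 / δ)
  obtain ⟨q₂, hq₂⟩ := exists_nat_ge (2 / η)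
  obtain ⟨q, hq2, hqδ, hqη⟩ : ∃ q : ℕ, 2 ≤ q ∧ 1 / δ ≤ q ∧ 2 / η ≤ q :=
    ⟨q₁ + q₂ + 2, by omega, hq₁.trans (by push_cast; linarith [(q₂.cast_nonneg : (0 : ℝ) ≤ q₂)]),
      hq₂.trans (by push_cast; linarith [(q₁.cast_nonneg : (0 : ℝ) ≤ q₁)])⟩
  have : NeZero q := ⟨by omega⟩
  have : Nonempty X := Fintype.card_pos_iff.mp (by omega)
  have hq0 : (0 : ℝ) < q := by exact_mod_cast (by omega : 0 < q)
  set S : Set.powersetCard X k → Finset X := fun c => c with hS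
  have hScard : ∀ c, (S c).card = k := fun c => Set.powersetCard.card_eq c
  have hSinj : Function.Injective S := Subtype.val_injective
  set 𝒢 : Equiv.Perm X → Finset (Set.powersetCard X k) :=
    fun τ => univ.filter fun c => τ⁻¹ • c ∈ 𝓕 with h𝒢
  have hmem : ∀ τ c, c ∈ 𝒢 τ ↔ τ⁻¹ • c ∈ 𝓕 := fun τ c => by simp [h𝒢]
  have h𝒢card : ∀ τ, (𝒢 τ).card = 𝓕.card := fun τ =>
    Finset.card_bij (fun c _ => τ⁻¹ • c) (fun c hc => (hmem _ _).mp hc)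
      (fun c _ c' _ h => MulAction.injective _ h) fun c hc =>
        ⟨τ • c, (hmem _ _).mpr (by simpa using hc), by simp⟩
  have : MulAction.IsPretransitive (Equiv.Perm X) (Set.powersetCard X k) :=
    Set.powersetCard.isPretransitive
  obtain ⟨c₀, hc₀⟩ : 𝓕.Nonempty := Finset.card_pos.mp (by omega)
  have hC : Fintype.card (Set.powersetCard X k) = (Fintype.card X).choose k := by
    rw [← Nat.card_eq_fintype_card, Set.powersetCard.card, Nat.card_eq_fintype_card]
  set N := Fintype.card (Set.powersetCard X k) with hN
  have hN0 : 0 < N := Fintype.card_pos_iff.mpr ⟨c₀⟩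
  set M := (univ.filter fun τ => c₀ ∈ 𝒢 τ).card with hM
  have hMc : ∀ c, (univ.filter fun τ => c ∈ 𝒢 τ).card * N =
      Fintype.card (Equiv.Perm X) * 𝓕.card := by
    intro c
    simp_rw [hmem]
    exact card_filter_inv_smul_mem 𝓕 c
  have hMc' : ∀ c, (univ.filter fun τ => c ∈ 𝒢 τ).card = M := fun c =>
    Nat.eq_of_mul_eq_mul_right hN0 ((hMc c).trans (hMc c₀).symm)
  have hM0 : 0 < M := by
    have h1 : 0 < M * N := by
      rw [hMc]
      exact Nat.mul_pos Fintype.card_pos (by omega)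
    exact Nat.pos_of_ne_zero fun h => by simp [h] at h1
  set Q := Fintype.card X with hQ
  set a := q ^ (Q - (k + 1)) with ha
  have ha0 : 0 < a := by positivity
  have hqa : q ^ (Q - k) = q * a := by
    rw [ha, ← pow_succ']
    congr 1
    omega
  have hqa1 : q ^ (Q - 1) = q ^ k * a := by
    rw [ha, ← pow_add]
    congr 1
    omega
  have hqa2 : q ^ Q = q ^ k * (q * a) := by
    rw [← hqa, ← pow_add]
    congr 1
    omega
  set L := (q * a - a) ^ (𝓕.card - 1) * a ^ (N - 𝓕.card) with hL
  have hL0 : 0 < L := by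
    have : 0 < q * a - a := by
      have : a < q * a := by nlinarith
      omega
    positivity
  have hWcard : Fintype.card (LabelWord S 𝒢 (ZMod q)) = Fintype.card (Equiv.Perm X) *
      (q ^ (k * N) * ((q * a - a) * L)) := by
    rw [card_labelWord (fun c => Finset.card_pos.mp (by rw [hScard]; omega)) h𝒢card, ZMod.card,
      ← hQ, ← hN, hqa1, hqa2, ← Nat.mul_sub, hL]
    have hfN : 𝓕.card ≤ N := Finset.card_le_univ 𝓕
    have h1 : q ^ (k * N) = (q ^ k) ^ 𝓕.card * (q ^ k) ^ (N - 𝓕.card) := by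
      rw [← pow_add, ← pow_mul, Nat.add_sub_cancel' hfN]
    have h2 : (q * a - a) ^ 𝓕.card = (q * a - a) * (q * a - a) ^ (𝓕.card - 1) :=
      (mul_pow_sub_one (by omega) _).symm
    rw [mul_pow, mul_pow, h1, h2]
    ring
  have hdeg : ∀ (w : LabelWord S 𝒢 (ZMod q)), ∀ p ∈ labelPoints w,
      (univ.filter fun w : LabelWord S 𝒢 (ZMod q) => p ∈ labelPoints w).card =
        M * (q * a * L) := by
    intro w p hp
    rw [card_filter_mem_labelPoints hScard hSinj h𝒢card hMc' hp, ZMod.card, ← hQ, ← hN, hqa, hL]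
  have hW : Nonempty (LabelWord S 𝒢 (ZMod q)) := by
    rw [← Fintype.card_pos_iff, hWcard]
    have : a < q * a := by nlinarith
    have h1 : 0 < q * a - a := by omega
    have h2 : 0 < Fintype.card (Equiv.Perm X) := Fintype.card_pos
    positivity
  obtain ⟨E, hpos, hone, hcard, -⟩ := hpack (Finset (X × (Set.powersetCard X k → ZMod q)))
    (LabelWord S 𝒢 (ZMod q)) labelPoints (M * (q * a * L)) (by positivity)
    (fun w => by rw [card_labelPoints hSinj, h𝒢card]) hdeg
    (fun w p hp p' hp' hne => by
      have h1 := card_filter_mem_labelPoints_pair_le hScard hSinj hp hp' hne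
      rw [hdeg w p hp, ZMod.card] at h1
      have h2 : (q : ℝ) * (univ.filter fun w : LabelWord S 𝒢 (ZMod q) =>
          p ∈ labelPoints w ∧ p' ∈ labelPoints w).card ≤ (M * (q * a * L) : ℕ) := by
        exact_mod_cast h1
      rw [div_le_iff₀ hδ] at hqδ
      have h3 : (0 : ℝ) ≤ (univ.filter fun w : LabelWord S 𝒢 (ZMod q) =>
          p ∈ labelPoints w ∧ p' ∈ labelPoints w).card := Nat.cast_nonneg _
      nlinarith)
  obtain ⟨U, hU, hEU⟩ := exists_packing_ge hpos hone
    (fun U : Finset (LabelWord S 𝒢 (ZMod q)) => (U.card : ℝ))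
  refine ⟨X × (Set.powersetCard X k → ZMod q), U, inferInstance, inferInstance,
    fun w i => labelVertex w.1.2.1 (w.1.1 i), inferInstance, fun w i i' h => ?_,
    fun w w' hne c hc => ?_, ?_⟩
  · exact w.1.1.injective (Prod.ext_iff.mp h).1
  · obtain ⟨i, hi, h⟩ := exists_labelVertex_ne_of_isPacking hSinj hU w.2 w'.2
      (fun h => hne (Subtype.ext h)) (c := w.1.1 • c) ((hmem _ _).mpr (by simpa using hc))
    have hi' : i ∈ w.1.1 • (c : Finset X) := hi
    obtain ⟨i, hi2, rfl⟩ := Finset.mem_smul_finset.mp hi'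
    exact ⟨i, hi2, fun i' => h _⟩
  · have h1 := hcard.trans hEU
    have hf0 : (0 : ℝ) < 𝓕.card := by exact_mod_cast (by omega : 0 < 𝓕.card)
    have hM' : (M : ℝ) * N = Fintype.card (Equiv.Perm X) * 𝓕.card := by exact_mod_cast hMc c₀
    have hsub : ((q * a - a : ℕ) : ℝ) = q * a - a := by
      rw [Nat.cast_sub (by nlinarith)]
      push_cast
      rfl
    have hM0' : (0 : ℝ) < M := by exact_mod_cast hM0
    have hL0' : (0 : ℝ) < L := by exact_mod_cast hL0
    have ha0' : (0 : ℝ) < a := by exact_mod_cast ha0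
    have hratio : (Fintype.card (LabelWord S 𝒢 (ZMod q)) : ℝ) / (M * (q * a * L) : ℕ) * 𝓕.card =
        (1 - 1 / q) * (N * (q : ℝ) ^ (k * N)) := by
      rw [hWcard]
      push_cast
      rw [hsub]
      field_simp
      linear_combination (-(q : ℝ) + 1) * hM'
    have hV : (Fintype.card (X × (Set.powersetCard X k → ZMod q)) / Q : ℝ) ^ k =
        (q : ℝ) ^ (k * N) := by
      have hQ0 : (0 : ℝ) < Q := by exact_mod_cast (by omega : 0 < Q)
      rw [Fintype.card_prod, Fintype.card_fun, ZMod.card, ← hN, ← hQ]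
      push_cast
      rw [mul_div_cancel_left₀ _ hQ0.ne', ← pow_mul, mul_comm]
    rw [hV, Fintype.card_coe, ← hC]
    have h2 : 1 - η ≤ (1 - η / 2) * (1 - 1 / q) := by
      have h3 : (1 : ℝ) / q ≤ η / 2 := by
        rw [div_le_iff₀ hη] at hqη
        rw [div_le_iff₀ hq0]
        linarith
      have h4 : (0 : ℝ) ≤ 1 / q := by positivity
      nlinarith
    have h3 : (0 : ℝ) ≤ N * (q : ℝ) ^ (k * N) := by positivity
    refine (mul_le_mul_of_nonneg_right h2 h3).trans ?_
    rw [mul_assoc, ← hratio, ← mul_assoc]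
    exact mul_le_mul_of_nonneg_right h1 hf0.le

theorem exists_isBlowupBase_of_family {ι₀ R X : Type} [Fintype ι₀] [Nonempty ι₀] [Fintype R]
    [Fintype X] [DecidableEq X] {e : ι₀ → R → X} {o : R} {k : ℕ} (hk : 1 ≤ k)
    (hkR : k < Fintype.card R) (hinj : ∀ b, Function.Injective (e b))
    (hinter : ∀ b b', b ≠ b' → (univ.image (e b) ∩ univ.image (e b')).card ≤ k)
    (hcenter : ∀ b b', b ≠ b' → e b o ∉ univ.image (e b')) {f : ℕ}
    (hf : ((powersetCard k univ).filter fun T => ∃ b, T ⊆ univ.image (e b)).card ≤ f) {η : ℝ}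
    (hη : 0 < η) (hη1 : η < 1) :
    ∃ (ι B : Type) (_ : Fintype ι) (_ : Nonempty ι) (_ : Fintype B) (_ : Nonempty B)
      (_ : DecidableEq B) (pos : ι → R → B), IsBlowupBase pos o k ∧
      (1 - η) * (Fintype.card ι₀ *
        ((Fintype.card X).choose k * (Fintype.card B / Fintype.card X : ℝ) ^ k)) ≤
        Fintype.card ι * f := by
  classical
  have hX : k < Fintype.card X :=
    hkR.trans_le (Fintype.card_le_of_injective _ (hinj (Classical.arbitrary ι₀)))
  set 𝓕 : Finset (Set.powersetCard X k) :=
    univ.filter fun c => ∃ b, (c : Finset X) ⊆ univ.image (e b) with h𝓕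
  have h𝓕map : 𝓕.map (Function.Embedding.subtype _) =
      (powersetCard k univ).filter fun T => ∃ b, T ⊆ univ.image (e b) := by
    ext T
    rw [Finset.mem_map, Finset.mem_filter, Finset.mem_powersetCard]
    constructor
    · rintro ⟨c, hc, rfl⟩
      exact ⟨⟨Finset.subset_univ _, Set.powersetCard.card_eq c⟩, (Finset.mem_filter.mp hc).2⟩
    · rintro ⟨⟨-, hT⟩, h⟩
      exact ⟨⟨T, hT⟩, Finset.mem_filter.mpr ⟨Finset.mem_univ _, h⟩, rfl⟩
  have h𝓕f : 𝓕.card ≤ f := by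
    rwa [← Finset.card_map (Function.Embedding.subtype _), h𝓕map]
  have h𝓕2 : 2 ≤ 𝓕.card := by
    rw [← Finset.card_map (Function.Embedding.subtype _), h𝓕map]
    have h1 : (powersetCard k (univ.image (e (Classical.arbitrary ι₀)))).card ≤
        ((powersetCard k univ).filter fun T => ∃ b, T ⊆ univ.image (e b)).card := by
      refine Finset.card_le_card fun T hT => ?_
      rw [Finset.mem_powersetCard] at hT
      exact Finset.mem_filter.mpr ⟨Finset.mem_powersetCard.mpr ⟨Finset.subset_univ _, hT.2⟩,
        _, hT.1⟩
    rw [Finset.card_powersetCard, Finset.card_image_of_injective _ (hinj _),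
      Finset.card_univ] at h1
    have h2 : (k + 1).choose k ≤ (Fintype.card R).choose k := Nat.choose_le_choose k hkR
    rw [Nat.choose_succ_self_right] at h2
    omega
  obtain ⟨V, J, _, _, φ, hV, hφ, hsep, hcard⟩ := exists_packing_of_copies hk hX 𝓕 h𝓕2 hη
  have hJ : Nonempty J := by
    by_contra h
    rw [not_nonempty_iff] at h
    rw [Fintype.card_eq_zero (α := J), Nat.cast_zero, zero_mul] at hcard
    have h1 : (0 : ℝ) < (Fintype.card X).choose k := by
      exact_mod_cast Nat.choose_pos hX.le
    have h2 : (0 : ℝ) < Fintype.card V := by exact_mod_cast Fintype.card_pos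
    have h3 : (0 : ℝ) < Fintype.card X := by exact_mod_cast (by omega : 0 < Fintype.card X)
    have h4 : 0 < 1 - η := by linarith
    have : 0 < (1 - η) *
      ((Fintype.card X).choose k * (Fintype.card V / Fintype.card X : ℝ) ^ k) := by positivity
    linarith
  have hE : ∀ (b : ι₀) (j : J), univ.image (fun i => φ j (e b i)) =
      (univ.image (e b)).image (φ j) := fun b j => by
    rw [Finset.image_image]
    rfl
  have hdiff : ∀ b j j', j ≠ j' → ∀ Y : Finset V, (∀ y ∈ Y, ∃ i, φ j' i = y) →
      (univ.image (fun i => φ j (e b i)) ∩ Y).card < k := by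
    intro b j j' hj Y hY
    by_contra! h
    obtain ⟨U, hU, hUk⟩ := Finset.exists_subset_card_eq h
    have h1 : U ⊆ (univ.image (e b)).image (φ j) := by
      rw [← hE]
      exact hU.trans Finset.inter_subset_left
    obtain ⟨c, hc, rfl⟩ := Finset.subset_image_iff.mp h1
    rw [Finset.card_image_of_injective _ (hφ j)] at hUk
    obtain ⟨i, hi, hne⟩ := hsep j j' hj ⟨c, hUk⟩
      (Finset.mem_filter.mpr ⟨Finset.mem_univ _, b, by exact_mod_cast hc⟩)
    obtain ⟨i', hi'⟩ := hY _ (Finset.mem_inter.mp (hU (Finset.mem_image_of_mem _ hi))).2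
    exact hne i' hi'
  have hrange : ∀ b j, ∀ y ∈ univ.image (fun i => φ j (e b i)), ∃ i, φ j i = y := by
    intro b j y hy
    obtain ⟨i, -, rfl⟩ := Finset.mem_image.mp hy
    exact ⟨_, rfl⟩
  have hcen : ∀ b b' j, b ≠ b' → φ j (e b o) ∉ univ.image (fun i => φ j (e b' i)) := by
    intro b b' j hne h
    obtain ⟨i, -, hi⟩ := Finset.mem_image.mp h
    exact hcenter b b' hne (Finset.mem_image.mpr ⟨i, Finset.mem_univ _, hφ j hi⟩)
  refine ⟨ι₀ × J, V, inferInstance, inferInstance, inferInstance, hV, inferInstance,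
    fun z i => φ z.2 (e z.1 i), ⟨?_, ?_, ?_, ?_⟩, ?_⟩
  · exact fun z i i' h => hinj _ (hφ _ h)
  · rintro ⟨b, j⟩ ⟨b', j'⟩ hne
    by_cases hj : j = j'
    · subst hj
      simp only [hE]
      rw [← Finset.image_inter _ _ (hφ j), Finset.card_image_of_injective _ (hφ j)]
      exact hinter b b' fun h => hne (by rw [h])
    · exact (hdiff b j j' hj _ (hrange b' j')).le
  · rintro ⟨b, j⟩ ⟨b', j'⟩ hne h
    by_cases hj : j = j'
    · subst hj
      exact absurd h (hcen b b' j fun h => hne (by rw [h]))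
    · exact hdiff b j j' hj _ (hrange b' j')
  · rintro ⟨b, j⟩ ⟨b', j'⟩ ⟨b'', j''⟩ hne hk' hne' h
    have hj : j = j' := by
      by_contra hj
      exact (hdiff b j j' hj _ (hrange b' j')).ne hk'
    subst hj
    have hj' : j'' ≠ j := by
      rintro rfl
      exact hcen b b'' j'' (fun h => hne' (by rw [h])) h
    exact hdiff b'' j'' j hj' _ fun y hy =>
      (Finset.mem_union.mp hy).elim (hrange b j y) (hrange b' j y)
  · rw [Fintype.card_prod]
    push_cast
    have h1 : (𝓕.card : ℝ) ≤ f := by exact_mod_cast h𝓕f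
    calc _ = (Fintype.card ι₀ : ℝ) * ((1 - η) *
          ((Fintype.card X).choose k * (Fintype.card V / Fintype.card X : ℝ) ^ k)) := by ring
      _ ≤ Fintype.card ι₀ * (Fintype.card J * 𝓕.card) := by gcongr
      _ ≤ Fintype.card ι₀ * (Fintype.card J * f) := by gcongr
      _ = _ := by ring

section PolynomialEdge

variable {p k m : ℕ}

/-- The value at `i` of the polynomial with the coefficients `a`. -/
def polynomialValue (a : Fin (k + 1) → ZMod p) (i : Fin m) : ZMod p :=
  ∑ j : Fin (k + 1), ((i : ℕ) : ZMod p) ^ (j : ℕ) * a j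

/-- The edge consisting of a polynomial, as its centre, and its graph on `m` points. -/
def polynomialEdge (a : Fin (k + 1) → ZMod p) :
    Option (Fin m) → (Fin (k + 1) → ZMod p) ⊕ (Fin m × ZMod p)
  | none => Sum.inl a
  | some i => Sum.inr (i, polynomialValue a i)

theorem polynomialEdge_injective (a : Fin (k + 1) → ZMod p) :
    Function.Injective (polynomialEdge a : Option (Fin m) → _) := by
  rintro (_ | i) (_ | j) h
  · rfl
  · simp [polynomialEdge] at h
  · simp [polynomialEdge] at h
  · simp only [polynomialEdge, Sum.inr.injEq, Prod.mk.injEq] at h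
    rw [h.1]

theorem card_polynomialValue_eq_le [Fact p.Prime] (hm : m ≤ p) {a b : Fin (k + 1) → ZMod p}
    (hab : a ≠ b) :
    (univ.filter fun i : Fin m => polynomialValue a i = polynomialValue b i).card ≤ k := by
  by_contra! h
  obtain ⟨U, hU, hUk⟩ := Finset.exists_subset_card_eq (Nat.succ_le_of_lt h)
  have hinj : Function.Injective fun j : Fin (k + 1) =>
      (((U.orderEmbOfFin hUk j : Fin m) : ℕ) : ZMod p) := by
    intro j j' hj
    refine (U.orderEmbOfFin hUk).injective (Fin.ext ?_)
    have h1 := (ZMod.natCast_eq_natCast_iff' _ _ _).mp hj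
    rwa [Nat.mod_eq_of_lt ((Fin.is_lt _).trans_le hm),
      Nat.mod_eq_of_lt ((Fin.is_lt _).trans_le hm)] at h1
  refine hab (sub_eq_zero.mp (Matrix.eq_zero_of_forall_index_sum_pow_mul_eq_zero hinj fun j => ?_))
  have h1 := (Finset.mem_filter.mp (hU (U.orderEmbOfFin_mem hUk j))).2
  simp only [polynomialValue] at h1
  simp only [Pi.sub_apply, mul_sub, Finset.sum_sub_distrib, h1, sub_self]

theorem card_polynomialEdge_inter_le [Fact p.Prime] (hm : m ≤ p) {a b : Fin (k + 1) → ZMod p}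
    (hab : a ≠ b) : (univ.image (polynomialEdge a : Option (Fin m) → _) ∩
      univ.image (polynomialEdge b)).card ≤ k := by
  refine le_trans (Finset.card_le_card (t := (univ.filter fun i : Fin m =>
    polynomialValue a i = polynomialValue b i).image fun i => polynomialEdge a (some i)) ?_)
    (Finset.card_image_le.trans (card_polynomialValue_eq_le hm hab))
  intro z hz
  simp only [Finset.mem_inter, Finset.mem_image, Finset.mem_univ, true_and] at hz
  obtain ⟨⟨i, rfl⟩, j, hij⟩ := hz
  rcases i with _ | i <;> rcases j with _ | j
  · exact absurd (Sum.inl_injective hij).symm hab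
  · simp [polynomialEdge] at hij
  · simp [polynomialEdge] at hij
  · simp only [polynomialEdge, Sum.inr.injEq, Prod.mk.injEq] at hij
    obtain ⟨rfl, h⟩ := hij
    exact Finset.mem_image.mpr ⟨j, Finset.mem_filter.mpr ⟨Finset.mem_univ _, h.symm⟩, rfl⟩

theorem polynomialEdge_none_notMem [NeZero p] {a b : Fin (k + 1) → ZMod p} (hab : a ≠ b) :
    polynomialEdge a (none : Option (Fin m)) ∉ univ.image (polynomialEdge b) := by
  intro h
  obtain ⟨i, -, hi⟩ := Finset.mem_image.mp h
  rcases i with _ | i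
  · exact hab (Sum.inl_injective hi).symm
  · simp [polynomialEdge] at hi

theorem card_filter_subset_polynomialEdge_le [NeZero p] :
    ((powersetCard k (univ : Finset ((Fin (k + 1) → ZMod p) ⊕ (Fin m × ZMod p)))).filter
      fun T => ∃ a, T ⊆ univ.image (polynomialEdge a)).card ≤
      p ^ (k + 1) * m.choose (k - 1) + m.choose k * p ^ k := by
  classical
  have h1 : ((powersetCard k (univ : Finset ((Fin (k + 1) → ZMod p) ⊕ (Fin m × ZMod p)))).filter
      fun T => ∃ a, T ⊆ univ.image (polynomialEdge a)) ⊆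
      (((univ : Finset (Fin (k + 1) → ZMod p)) ×ˢ powersetCard (k - 1) univ).image fun z =>
        insert (Sum.inl z.1) (z.2.image fun i : Fin m => polynomialEdge z.1 (some i))) ∪
      ((powersetCard k (univ : Finset (Fin m))).biUnion fun I =>
        (univ : Finset (I → ZMod p)).image fun u => univ.image fun i => Sum.inr (i.1, u i)) := by
    intro T hT
    rw [Finset.mem_filter, Finset.mem_powersetCard] at hT
    obtain ⟨⟨-, hTk⟩, a, ha⟩ := hT
    obtain ⟨K, -, rfl⟩ := Finset.subset_image_iff.mp ha
    rw [Finset.card_image_of_injective _ (polynomialEdge_injective a)] at hTk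
    rw [Finset.mem_union]
    by_cases hK : none ∈ K
    · left
      refine Finset.mem_image.mpr ⟨(a, K.eraseNone), Finset.mem_product.mpr ⟨Finset.mem_univ _,
        Finset.mem_powersetCard.mpr ⟨Finset.subset_univ _, ?_⟩⟩, ?_⟩
      · rw [Finset.card_eraseNone_eq_card_erase, Finset.card_erase_of_mem hK, hTk]
      · ext z
        simp only [Finset.mem_insert, Finset.mem_image, Finset.mem_eraseNone]
        constructor
        · rintro (rfl | ⟨i, hi, rfl⟩)
          · exact ⟨none, hK, rfl⟩
          · exact ⟨some i, hi, rfl⟩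
        · rintro ⟨_ | i, hi, rfl⟩
          · exact Or.inl rfl
          · exact Or.inr ⟨i, hi, rfl⟩
    · right
      refine Finset.mem_biUnion.mpr ⟨K.eraseNone, Finset.mem_powersetCard.mpr
        ⟨Finset.subset_univ _, ?_⟩, Finset.mem_image.mpr
        ⟨fun i => polynomialValue a i.1, Finset.mem_univ _, ?_⟩⟩
      · rw [Finset.card_eraseNone_eq_card_erase, Finset.erase_eq_of_notMem hK, hTk]
      · ext z
        simp only [Finset.mem_image, Finset.mem_univ, true_and, Subtype.exists,
          Finset.mem_eraseNone]
        constructor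
        · rintro ⟨i, hi, rfl⟩
          exact ⟨some i, hi, rfl⟩
        · rintro ⟨_ | i, hi, rfl⟩
          · exact absurd hi hK
          · exact ⟨i, hi, rfl⟩
  refine (Finset.card_le_card h1).trans ((Finset.card_union_le _ _).trans (add_le_add ?_ ?_))
  · refine Finset.card_image_le.trans (le_of_eq ?_)
    rw [Finset.card_product, Finset.card_powersetCard, Finset.card_univ, Finset.card_univ,
      Fintype.card_fun, ZMod.card, Fintype.card_fin, Fintype.card_fin]
  · refine (Finset.card_biUnion_le_card_mul _ _ (p ^ k) fun I hI => ?_).trans (le_of_eq ?_)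
    · refine Finset.card_image_le.trans (le_of_eq ?_)
      rw [Finset.card_univ, Fintype.card_fun, ZMod.card, Fintype.card_coe,
        (Finset.mem_powersetCard.mp hI).2]
    · rw [Finset.card_powersetCard, Finset.card_univ, Fintype.card_fin]

end PolynomialEdge

/-- The density that the bases reach, depending on the number of points of the affine line. -/
theorem tendsto_base_density {k m : ℕ} (hk : 2 ≤ k) (hm : k ≤ m + 1) :
    Filter.Tendsto (fun p : ℕ => (p : ℝ) ^ (k + 1) *
      ((p ^ (k + 1) + m * p).choose k * (1 / ((p ^ (k + 1) + m * p : ℕ) : ℝ)) ^ k) /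
      ((p ^ (k + 1) * m.choose (k - 1) + m.choose k * p ^ k : ℕ) : ℝ)) Filter.atTop
      (nhds (1 / (k.factorial : ℝ) * (1 / (m.choose (k - 1) : ℝ)))) := by
  have hc : (0 : ℝ) < m.choose (k - 1) := by exact_mod_cast Nat.choose_pos (by omega)
  have h1 : Filter.Tendsto (fun n : ℕ => (n.choose k : ℝ) * (1 / (n : ℝ)) ^ k) Filter.atTop
      (nhds (1 / (k.factorial : ℝ))) := by
    have h := (isEquivalent_choose k).mul
      (Asymptotics.IsEquivalent.refl (u := fun n : ℕ => (1 / (n : ℝ)) ^ k))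
    refine (h.symm.tendsto_nhds ?_)
    refine tendsto_const_nhds.congr' ?_
    filter_upwards [Filter.eventually_gt_atTop 0] with n hn
    have hn' : (n : ℝ) ≠ 0 := by exact_mod_cast hn.ne'
    rw [Pi.mul_apply, div_mul_eq_mul_div, ← mul_pow, mul_one_div_cancel hn', one_pow]
  have h2 : Filter.Tendsto (fun p : ℕ => p ^ (k + 1) + m * p) Filter.atTop Filter.atTop :=
    Filter.tendsto_atTop_mono (fun p => (Nat.le_self_pow (by omega) p).trans (Nat.le_add_right _ _))
      Filter.tendsto_id
  have h3 : Filter.Tendsto (fun p : ℕ => 1 / ((m.choose (k - 1) : ℝ) + m.choose k * (1 / (p : ℝ))))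
      Filter.atTop (nhds (1 / ((m.choose (k - 1) : ℝ) + m.choose k * 0))) :=
    tendsto_const_nhds.div (tendsto_const_nhds.add
      (tendsto_const_nhds.mul tendsto_one_div_atTop_nhds_zero_nat)) (by simpa using hc.ne')
  rw [mul_zero, add_zero] at h3
  refine ((h1.comp h2).mul h3).congr' ?_
  filter_upwards [Filter.eventually_gt_atTop 0] with p hp
  have hp' : (0 : ℝ) < p := by exact_mod_cast hp
  have h4 : (0 : ℝ) ≤ m.choose k := Nat.cast_nonneg _
  simp only [Function.comp_apply]
  push_cast
  have h5 : (p : ℝ) ^ (k + 1) * m.choose (k - 1) + m.choose k * p ^ k =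
      p ^ (k + 1) * ((m.choose (k - 1) : ℝ) + m.choose k * (1 / (p : ℝ))) := by
    rw [pow_succ]
    field_simp
  have h6 : (0 : ℝ) < (m.choose (k - 1) : ℝ) + m.choose k * (1 / (p : ℝ)) := by positivity
  rw [h5, mul_div_mul_left _ _ (by positivity)]
  ring

/-- Bases of nearly optimal density exist. -/
theorem exists_isBlowupBase_density {k m : ℕ} (hk : 2 ≤ k) (hm : k ≤ m) {c : ℝ}
    (hc : c < 1 / (k.factorial : ℝ) * (1 / (m.choose (k - 1) : ℝ))) :
    ∃ (ι B : Type) (_ : Fintype ι) (_ : Nonempty ι) (_ : Fintype B) (_ : Nonempty B)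
      (_ : DecidableEq B) (pos : ι → Option (Fin m) → B), IsBlowupBase pos none k ∧
      c * (Fintype.card B : ℝ) ^ k ≤ Fintype.card ι := by
  set D : ℝ := 1 / (k.factorial : ℝ) * (1 / (m.choose (k - 1) : ℝ)) with hD
  have hchoose : 0 < m.choose (k - 1) := Nat.choose_pos (by omega)
  have hDpos : 0 < D := by positivity
  set c₀ := max c (D / 2) with hc₀
  have hc₀D : c₀ < D := max_lt hc (by linarith)
  have hc₀pos : 0 < c₀ := lt_of_lt_of_le (by linarith) (le_max_right _ _)
  set c₁ := (c₀ + D) / 2 with hc₁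
  have h01 : c₀ < c₁ := by linarith
  have h1D : c₁ < D := by linarith
  obtain ⟨P, hP⟩ := Filter.eventually_atTop.mp
    ((tendsto_base_density hk (by omega : k ≤ m + 1)).eventually_const_lt h1D)
  obtain ⟨p, hpP, hp⟩ := Nat.exists_infinite_primes (max P m)
  have := Fact.mk hp
  have hdens := hP p ((le_max_left _ _).trans hpP)
  have hcard : Fintype.card ((Fin (k + 1) → ZMod p) ⊕ (Fin m × ZMod p)) =
      p ^ (k + 1) + m * p := by
    rw [Fintype.card_sum, Fintype.card_fun, Fintype.card_prod, ZMod.card, Fintype.card_fin,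
      Fintype.card_fin]
  have hratio : 0 < c₀ / c₁ := by positivity
  have hratio1 : c₀ / c₁ < 1 := (div_lt_one (hc₀pos.trans h01)).mpr h01
  obtain ⟨ι, B, _, _, _, _, _, pos, hpos, hle⟩ := exists_isBlowupBase_of_family
    (e := fun a : Fin (k + 1) → ZMod p => (polynomialEdge a : Option (Fin m) → _)) (o := none)
    (k := k) (by omega) (by simpa using by omega) polynomialEdge_injective
    (fun a b hab => card_polynomialEdge_inter_le ((le_max_right _ _).trans hpP) hab)
    (fun a b hab => polynomialEdge_none_notMem hab) card_filter_subset_polynomialEdge_le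
    (η := 1 - c₀ / c₁) (by linarith) (by linarith)
  refine ⟨ι, B, ‹_›, ‹_›, ‹_›, ‹_›, ‹_›, pos, hpos, ?_⟩
  rw [hcard, Fintype.card_fun, ZMod.card, Fintype.card_fin] at hle
  have hf : (0 : ℝ) < ((p ^ (k + 1) * m.choose (k - 1) + m.choose k * p ^ k : ℕ) : ℝ) := by
    have := hp.pos
    exact_mod_cast (by positivity : 0 < p ^ (k + 1) * m.choose (k - 1) + m.choose k * p ^ k)
  rw [lt_div_iff₀ hf] at hdens
  refine le_of_mul_le_mul_right (le_trans ?_ hle) hf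
  have hB : (0 : ℝ) ≤ (Fintype.card B : ℝ) ^ k := by positivity
  calc c * (Fintype.card B : ℝ) ^ k * _ ≤ c₀ * (Fintype.card B : ℝ) ^ k * _ :=
        mul_le_mul_of_nonneg_right (mul_le_mul_of_nonneg_right (le_max_left _ _) hB) hf.le
    _ = c₀ / c₁ * (Fintype.card B : ℝ) ^ k * (c₁ *
        ((p ^ (k + 1) * m.choose (k - 1) + m.choose k * p ^ k : ℕ) : ℝ)) := by
      have := (hc₀pos.trans h01).ne'
      field_simp
    _ ≤ c₀ / c₁ * (Fintype.card B : ℝ) ^ k * _ :=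
      mul_le_mul_of_nonneg_left hdens.le (by positivity)
    _ = _ := by
      push_cast
      rw [div_pow, div_pow]
      ring

/-- If every partition of a set of size `t * k` into `t` blocks of size `k` has a block in `𝒢`,
then `𝒢` is large. -/
theorem choose_le_card_of_forall_perm {t k : ℕ} (ht : 1 ≤ t) (hk : 1 ≤ k)
    (𝒢 : Finset (Set.powersetCard (Fin t × Fin k) k))
    (c : Fin t → Set.powersetCard (Fin t × Fin k) k)
    (h : ∀ g : Equiv.Perm (Fin t × Fin k), ∃ i, g⁻¹ • c i ∈ 𝒢) :
    (t * k - 1).choose (k - 1) ≤ 𝒢.card := by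
  classical
  have : MulAction.IsPretransitive (Equiv.Perm (Fin t × Fin k))
      (Set.powersetCard (Fin t × Fin k) k) := Set.powersetCard.isPretransitive
  have hC : Fintype.card (Set.powersetCard (Fin t × Fin k) k) = (t * k).choose k := by
    rw [← Nat.card_eq_fintype_card, Set.powersetCard.card, Nat.card_eq_fintype_card,
      Fintype.card_prod, Fintype.card_fin, Fintype.card_fin]
  set G := Equiv.Perm (Fin t × Fin k) with hG
  have h1 : Fintype.card G ≤ ∑ i, (univ.filter fun g : G => g⁻¹ • c i ∈ 𝒢).card := by
    rw [← Finset.card_univ]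
    refine (Finset.card_le_card fun g _ => ?_).trans Finset.card_biUnion_le
    obtain ⟨i, hi⟩ := h g
    exact Finset.mem_biUnion.mpr ⟨i, Finset.mem_univ _, Finset.mem_filter.mpr
      ⟨Finset.mem_univ _, hi⟩⟩
  have h2 : Fintype.card G * (t * k).choose k ≤ Fintype.card G * (t * 𝒢.card) := by
    refine (Nat.mul_le_mul_right _ h1).trans (le_of_eq ?_)
    rw [Finset.sum_mul, ← hC]
    simp_rw [card_filter_inv_smul_mem 𝒢]
    rw [Finset.sum_const, Finset.card_univ, Fintype.card_fin, smul_eq_mul]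
    ring
  have h3 := Nat.le_of_mul_le_mul_left h2 Fintype.card_pos
  have h4 : t * k * (t * k - 1).choose (k - 1) = (t * k).choose k * k := by
    have := Nat.add_one_mul_choose_eq (t * k - 1) (k - 1)
    rwa [Nat.sub_add_cancel (Nat.mul_pos ht hk), Nat.sub_add_cancel hk] at this
  refine le_of_mul_le_mul_left (a := t * k) ?_ (Nat.mul_pos ht hk)
  rw [h4, mul_right_comm]
  exact Nat.mul_le_mul_right _ h3

theorem IsUnionFree.isCoverFree [DecidableEq α] {t : ℕ} {H : Finset (Finset α)}
    (h : IsUnionFree (t + 1) H) (hne : ∀ A ∈ H, A.Nonempty) : IsCoverFree t H := by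
  intro 𝒜 h𝒜 hcard B hB hB𝒜 hsub
  have h𝒜ne : 𝒜.Nonempty := by
    rw [Finset.nonempty_iff_ne_empty]
    rintro rfl
    exact (hne B hB).ne_empty (Finset.subset_empty.mp hsub)
  refine h 𝒜 h𝒜 (insert B 𝒜) (Finset.insert_subset hB h𝒜) h𝒜ne (Finset.insert_nonempty _ _)
    (by omega) ((Finset.card_insert_le _ _).trans (by omega)) (fun he => hB𝒜 ?_) ?_
  · rw [he]
    exact Finset.mem_insert_self _ _
  · rw [Finset.sup_insert]
    exact (sup_eq_right.mpr hsub).symm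

/-- Every edge of a cover-free family has many subsets of size `k` that lie in no other edge. -/
theorem IsCoverFree.choose_le_card_own [DecidableEq α] {t k : ℕ} (ht : 1 ≤ t) (hk : 1 ≤ k)
    {H : Finset (Finset α)} (h : IsCoverFree t H) {A : Finset α} (hA : A ∈ H)
    (hcard : A.card = t * k) : (t * k - 1).choose (k - 1) ≤
      ((powersetCard k A).filter fun T => ∀ B ∈ H, T ⊆ B → B = A).card := by
  classical
  have e : Fin t × Fin k ≃ A := Fintype.equivOfCardEq (by simp [hcard])
  set f : Fin t × Fin k ↪ α := e.toEmbedding.trans (Function.Embedding.subtype _) with hf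
  have hfA : ∀ x, f x ∈ A := fun x => (e x).2
  have hc : ∀ i : Fin t, (univ.image fun j : Fin k => (i, j)).card = k := by
    intro i
    rw [Finset.card_image_of_injective _ (fun a b hab => (Prod.ext_iff.mp hab).2),
      Finset.card_univ, Fintype.card_fin]
  refine (choose_le_card_of_forall_perm ht hk (univ.filter fun c =>
    ∀ B ∈ H, (c : Finset (Fin t × Fin k)).map f ⊆ B → B = A)
    (fun i => ⟨univ.image fun j : Fin k => (i, j), hc i⟩) fun g => ?_).trans
    (Finset.card_le_card_of_injOn (fun c => (c : Finset (Fin t × Fin k)).map f) ?_ ?_)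
  · by_contra! hno
    simp only [Finset.mem_filter, Finset.mem_univ, true_and, not_forall] at hno
    choose B hBH hsub hBA using hno
    refine h (univ.image B) (by simpa [Finset.image_subset_iff] using hBH)
      (Finset.card_image_le.trans (by simp)) A hA (by simpa using hBA) fun x hx => ?_
    have hx' : f (e.symm ⟨x, hx⟩) = x := by simp [hf]
    rw [Finset.mem_sup]
    refine ⟨B (g (e.symm ⟨x, hx⟩)).1, Finset.mem_image_of_mem _ (Finset.mem_univ _), ?_⟩
    refine hsub _ (Finset.mem_map.mpr ⟨e.symm ⟨x, hx⟩, ?_, hx'⟩)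
    rw [Set.powersetCard.coe_smul, Finset.mem_inv_smul_finset_iff]
    refine Finset.mem_image.mpr ⟨(g (e.symm ⟨x, hx⟩)).2, Finset.mem_univ _, ?_⟩
    rfl
  · intro c hcm
    simp only [Finset.coe_filter, Set.mem_ofPred_eq, Finset.mem_univ, true_and,
      Finset.mem_powersetCard] at hcm ⊢
    refine ⟨⟨fun x hx => ?_, ?_⟩, hcm⟩
    · obtain ⟨y, -, rfl⟩ := Finset.mem_map.mp hx
      exact hfA y
    · rw [Finset.card_map]
      exact Set.powersetCard.card_eq c
  · intro c _ c' _ hcc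
    exact Subtype.ext (Finset.map_injective f hcc)

/-- The upper bound for cover-free families. -/
theorem IsCoverFree.card_mul_choose_le [Fintype α] [DecidableEq α] {t k : ℕ} (ht : 1 ≤ t)
    (hk : 1 ≤ k) {H : Finset (Finset α)} (h : IsCoverFree t H) (hcard : ∀ A ∈ H, A.card = t * k) :
    H.card * (t * k - 1).choose (k - 1) ≤ (Fintype.card α).choose k := by
  have h1 : (H.biUnion fun A => (powersetCard k A).filter fun T => ∀ B ∈ H, T ⊆ B → B = A) ⊆
      powersetCard k univ := by
    intro T hT
    obtain ⟨A, -, hT⟩ := Finset.mem_biUnion.mp hT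
    rw [Finset.mem_filter, Finset.mem_powersetCard] at hT
    exact Finset.mem_powersetCard.mpr ⟨Finset.subset_univ _, hT.1.2⟩
  rw [← Finset.card_univ, ← Finset.card_powersetCard]
  refine le_trans ?_ (Finset.card_le_card h1)
  rw [Finset.card_biUnion]
  · rw [← smul_eq_mul, ← Finset.sum_const]
    refine Finset.sum_le_sum fun A hA => ?_
    refine (h.choose_le_card_own ht hk hA (hcard A hA)).trans (le_of_eq ?_)
    congr!
  · intro A hA A' hA' hne
    refine Finset.disjoint_left.mpr fun T hT hT' => hne ?_
    rw [Finset.mem_filter, Finset.mem_powersetCard] at hT hT'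
    exact hT'.2 A hA hT.1.1

theorem bddAbove_card_isUnionFree (s n r : ℕ) : BddAbove {N | ∃ H : Finset (Finset (Fin n)),
    (∀ e ∈ H, e.card = r) ∧ IsUnionFree s H ∧ H.card = N} := by
  refine ⟨Fintype.card (Finset (Fin n)), ?_⟩
  rintro N ⟨H, -, -, rfl⟩
  exact Finset.card_le_univ H

theorem maxUnionFree_mul_choose_le {t k : ℕ} (ht : 1 ≤ t) (hk : 1 ≤ k) (n : ℕ) :
    maxUnionFree (t + 1) n (t * k) * (t * k - 1).choose (k - 1) ≤ n.choose k := by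
  obtain ⟨H, hr, hH, hcard⟩ := Nat.sSup_mem (s := {N | ∃ H : Finset (Finset (Fin n)),
    (∀ e ∈ H, e.card = t * k) ∧ IsUnionFree (t + 1) H ∧ H.card = N})
    ⟨0, ∅, by simp, fun 𝒜 h𝒜 ℬ _ h𝒜' => absurd (Finset.subset_empty.mp h𝒜) h𝒜'.ne_empty, rfl⟩
    (bddAbove_card_isUnionFree _ _ _)
  rw [maxUnionFree, ← hcard]
  have h1 := (hH.isCoverFree fun A hA => Finset.card_pos.mp
    (by rw [hr A hA]; exact Nat.mul_pos ht hk)).card_mul_choose_le ht hk hr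
  rwa [Fintype.card_fin] at h1

/-- Union-freeness is preserved by injections. -/
theorem IsUnionFree.map [DecidableEq α] [DecidableEq β] {s : ℕ} {H : Finset (Finset α)}
    (h : IsUnionFree s H) (f : α ↪ β) :
    IsUnionFree s (H.map (Finset.mapEmbedding f).toEmbedding) := by
  have hsup : ∀ 𝒞 : Finset (Finset α),
      (𝒞.map (Finset.mapEmbedding f).toEmbedding).sup id = (𝒞.sup id).map f := by
    intro 𝒞
    ext x
    simp only [Finset.mem_sup, Finset.mem_map, id]
    constructor
    · rintro ⟨_, ⟨A, hA, rfl⟩, hx⟩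
      obtain ⟨y, hy, rfl⟩ := Finset.mem_map.mp hx
      exact ⟨y, ⟨A, hA, hy⟩, rfl⟩
    · rintro ⟨y, ⟨A, hA, hy⟩, rfl⟩
      exact ⟨_, ⟨A, hA, rfl⟩, Finset.mem_map_of_mem f hy⟩
  intro 𝒜 h𝒜 ℬ hℬ h𝒜ne hℬne h𝒜c hℬc hne
  obtain ⟨𝒜', h𝒜', rfl⟩ := Finset.subset_map_iff.mp h𝒜
  obtain ⟨ℬ', hℬ', rfl⟩ := Finset.subset_map_iff.mp hℬ
  rw [hsup, hsup]
  rw [Finset.card_map] at h𝒜c hℬc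
  exact fun he => h 𝒜' h𝒜' ℬ' hℬ' (Finset.map_nonempty.mp h𝒜ne)
    (Finset.map_nonempty.mp hℬne) h𝒜c hℬc (fun hab => hne (by rw [hab])) (Finset.map_injective f he)

theorem IsUnionFree.card_le_maxUnionFree [Fintype α] [DecidableEq α] {s n r : ℕ}
    {H : Finset (Finset α)} (h : IsUnionFree s H) (hr : ∀ e ∈ H, e.card = r)
    (hn : Fintype.card α ≤ n) : H.card ≤ maxUnionFree s n r := by
  obtain ⟨f⟩ := Function.Embedding.nonempty_of_card_le (β := Fin n) (by simpa using hn)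
  refine le_csSup (bddAbove_card_isUnionFree _ _ _) ⟨_, ?_, h.map f, Finset.card_map _⟩
  intro e he
  obtain ⟨A, hA, rfl⟩ := Finset.mem_map.mp he
  simpa using hr A hA

theorem maxUnionFree_div_pow_le {t k : ℕ} (ht : 1 ≤ t) (hk : 1 ≤ k) (n : ℕ) :
    (maxUnionFree (t + 1) n (t * k) : ℝ) / (n : ℝ) ^ k ≤
      1 / (k.factorial : ℝ) * (1 / ((t * k - 1).choose (k - 1) : ℝ)) := by
  have hkt : k ≤ t * k := Nat.le_mul_of_pos_left k ht
  have hc : (0 : ℝ) < ((t * k - 1).choose (k - 1) : ℝ) := by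
    exact_mod_cast Nat.choose_pos (by omega)
  have h1 : (maxUnionFree (t + 1) n (t * k) : ℝ) * ((t * k - 1).choose (k - 1) : ℝ) ≤
      (n : ℝ) ^ k / k.factorial :=
    le_trans (by exact_mod_cast maxUnionFree_mul_choose_le ht hk n) (Nat.choose_le_pow_div k n)
  refine div_le_of_le_mul₀ (by positivity) (by positivity) ?_
  rw [← le_div_iff₀ hc] at h1
  exact h1.trans (le_of_eq (by ring))

theorem eventually_lt_maxUnionFree_div_pow {t k : ℕ} (ht : 2 ≤ t) (hk : 2 ≤ k) {c : ℝ}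
    (hc : c < 1 / (k.factorial : ℝ) * (1 / ((t * k - 1).choose (k - 1) : ℝ))) :
    ∀ᶠ n : ℕ in Filter.atTop, c < (maxUnionFree (t + 1) n (t * k) : ℝ) / (n : ℝ) ^ k := by
  set D : ℝ := 1 / (k.factorial : ℝ) * (1 / ((t * k - 1).choose (k - 1) : ℝ)) with hD
  have hkt : 2 * k ≤ t * k := Nat.mul_le_mul_right k ht
  have hchoose : 0 < (t * k - 1).choose (k - 1) := Nat.choose_pos (by omega)
  have hDpos : 0 < D := by positivity
  set c₀ := max c (D / 2) with hc₀
  have hc₀D : c₀ < D := max_lt hc (by linarith)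
  have hc₀pos : 0 < c₀ := lt_of_lt_of_le (by linarith) (le_max_right _ _)
  set c₁ := (c₀ + D) / 2 with hc₁
  have h01 : c₀ < c₁ := by linarith
  have h1D : c₁ < D := by linarith
  have hc₁pos : 0 < c₁ := hc₀pos.trans h01
  obtain ⟨ι, B, _, _, _, _, _, pos, hpos, hle⟩ :=
    exists_isBlowupBase_density hk (by omega : k ≤ t * k - 1) h1D
  have hratio1 : c₀ / c₁ < 1 := (div_lt_one hc₁pos).mpr h01
  have hratio : 0 < c₀ / c₁ := by positivity
  obtain ⟨q₀, hq₀⟩ := exists_isUnionFree_blowup ht (by omega)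
    (by rw [Fintype.card_option, Fintype.card_fin]; omega) hpos (η := (1 - c₀ / c₁) / 2)
    (by linarith)
  have hN : 0 < Fintype.card B := Fintype.card_pos
  have hlim : Filter.Tendsto (fun n : ℕ => (c₀ + c₁) / 2 *
      (1 - Fintype.card B * (1 / (n : ℝ))) ^ k) Filter.atTop
      (nhds ((c₀ + c₁) / 2 * (1 - Fintype.card B * 0) ^ k)) :=
    tendsto_const_nhds.mul ((tendsto_const_nhds.sub (tendsto_const_nhds.mul
      tendsto_one_div_atTop_nhds_zero_nat)).pow k)
  rw [mul_zero, sub_zero, one_pow, mul_one] at hlim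
  filter_upwards [hlim.eventually_const_lt (by linarith : c₀ < (c₀ + c₁) / 2),
    Filter.eventually_ge_atTop (Fintype.card B * (q₀ + 1))] with n hn hnB
  refine (le_max_left c (D / 2)).trans_lt (hn.trans_le ?_)
  have hnN : Fintype.card B ≤ n := (Nat.le_mul_of_pos_right _ (Nat.succ_pos _)).trans hnB
  have hn0 : (0 : ℝ) < n := by exact_mod_cast hN.trans_le hnN
  have hq : q₀ ≤ n / Fintype.card B := by
    rw [Nat.le_div_iff_mul_le hN]
    nlinarith
  obtain ⟨H, hr, hH, hcard⟩ := hq₀ _ hq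
  have hmax := hH.card_le_maxUnionFree (n := n) hr (by
    rw [Fintype.card_prod, Fintype.card_fin]
    exact Nat.mul_div_le _ _)
  have hmod : (n : ℝ) - Fintype.card B ≤ Fintype.card B * (n / Fintype.card B : ℕ) := by
    have h1 := Nat.div_add_mod n (Fintype.card B)
    have h2 := Nat.mod_lt n hN
    rw [sub_le_iff_le_add]
    exact_mod_cast (by omega : n ≤ Fintype.card B * (n / Fintype.card B) + Fintype.card B)
  rw [le_div_iff₀ (by positivity)]
  have hnN' : (Fintype.card B : ℝ) ≤ n := by exact_mod_cast hnN
  calc (c₀ + c₁) / 2 * (1 - Fintype.card B * (1 / (n : ℝ))) ^ k * (n : ℝ) ^ k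
      = (c₀ + c₁) / 2 * ((n : ℝ) - Fintype.card B) ^ k := by
        rw [mul_assoc, ← mul_pow]
        congr 2
        field_simp
    _ ≤ (c₀ + c₁) / 2 * (Fintype.card B * (n / Fintype.card B : ℕ)) ^ k :=
        mul_le_mul_of_nonneg_left (pow_le_pow_left₀ (by linarith) hmod k) (by linarith)
    _ = (1 - (1 - c₀ / c₁) / 2) *
        (c₁ * (Fintype.card B : ℝ) ^ k * ((n / Fintype.card B : ℕ) : ℝ) ^ k) := by
        rw [mul_pow]
        have := hc₁pos.ne'
        field_simp
        ring
    _ ≤ (1 - (1 - c₀ / c₁) / 2) *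
        (Fintype.card ι * ((n / Fintype.card B : ℕ) : ℝ) ^ k) :=
        mul_le_mul_of_nonneg_left (mul_le_mul_of_nonneg_right hle (by positivity)) (by linarith)
    _ ≤ H.card := hcard
    _ ≤ maxUnionFree (t + 1) n (t * k) := by exact_mod_cast hmax

/-- For all `t ≥ 2` and `k ≥ 2`, `U_{t+1}(n, tk) / n^k → (1/k!) · 1/C(tk-1, k-1)`. -/
theorem unionFree_degenerate_turan_density (t k : ℕ) (ht : 2 ≤ t) (hk : 2 ≤ k) :
    Filter.Tendsto
      (fun n : ℕ => (maxUnionFree (t + 1) n (t * k) : ℝ) / (n : ℝ) ^ k)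
      Filter.atTop
      (nhds (1 / (Nat.factorial k : ℝ) * (1 / ((t * k - 1).choose (k - 1) : ℝ)))) := by
  refine tendsto_order.mpr ⟨fun c hc => eventually_lt_maxUnionFree_div_pow ht hk hc,
    fun c hc => Filter.Eventually.of_forall fun n =>
      (maxUnionFree_div_pow_le (by omega) (by omega) n).trans_lt hc⟩
end

section
/- Let t ≥ 2 and k ≥ 2 be integers. Every 2(t−1)-cancellative tk-graph F on an n-element vertex set satisfies C(tk, k) · |F| ≤ t · C(n, k); equivalently, C_{2(t−1)}(n, tk) ≤ C(n, k)/C(tk−1, k−1), where C(a,b) denotes the binomial coefficient. -/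
open Finset

variable {α : Type*} {β : Type*}

/-- The number of permutations mapping `B` onto `S` does not depend on `S`. -/
theorem card_perm_map_eq [Fintype β] [DecidableEq β] (B S S' : Finset β)
    (h : S.card = S'.card) :
    #{σ : Equiv.Perm β | B.map σ.toEmbedding = S} =
      #{σ : Equiv.Perm β | B.map σ.toEmbedding = S'} := by
  let e : {x // x ∈ S} ≃ {x // x ∈ S'} := Finset.equivOfCardEq h
  let τ : Equiv.Perm β := e.extendSubtype
  have hτ : S.map τ.toEmbedding = S' := by
    apply Finset.eq_of_subset_of_card_le
    · intro x hx
      obtain ⟨y, hy, rfl⟩ := Finset.mem_map.1 hx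
      exact e.extendSubtype_mem y hy
    · simp [h]
  refine Finset.card_equiv (Equiv.mulLeft τ) fun σ => ?_
  have hmul : B.map (τ * σ).toEmbedding = (B.map σ.toEmbedding).map τ.toEmbedding := by
    rw [Finset.map_map]; rfl
  simp only [Finset.mem_filter, Finset.mem_univ, true_and, Equiv.coe_mulLeft]
  rw [hmul, ← hτ, Finset.map_inj]

theorem choose_mul_card_perm_map_mem [Fintype β] [DecidableEq β] {k : ℕ} (B : Finset β)
    (hB : B.card = k) (G : Finset (Finset β)) (hG : ∀ S ∈ G, S.card = k) :
    (Fintype.card β).choose k * #{σ : Equiv.Perm β | B.map σ.toEmbedding ∈ G} =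
      Fintype.card (Equiv.Perm β) * G.card := by
  have count : ∀ G : Finset (Finset β), (∀ S ∈ G, S.card = k) →
      #{σ : Equiv.Perm β | B.map σ.toEmbedding ∈ G} =
        G.card * #{σ : Equiv.Perm β | B.map σ.toEmbedding = B} := by
    intro G hG
    rw [Finset.card_eq_sum_card_fiberwise (f := fun σ : Equiv.Perm β => B.map σ.toEmbedding)
      (t := G) (fun σ hσ => by simpa using hσ), ← smul_eq_mul, ← Finset.sum_const]
    refine Finset.sum_congr rfl fun S hS => ?_
    rw [← card_perm_map_eq B S B (by rw [hG S hS, hB]), Finset.filter_filter]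
    congr 1
    ext σ
    simp only [Finset.mem_filter, Finset.mem_univ, true_and]
    exact ⟨fun h => h.2, fun h => ⟨h ▸ hS, h⟩⟩
  have total := count (powersetCard k univ) fun S hS => (mem_powersetCard.1 hS).2
  rw [Finset.filter_true_of_mem fun σ _ => by simp [mem_powersetCard, hB], card_univ,
    card_powersetCard, card_univ] at total
  rw [count G hG, total]
  ring

/-- A family of `k`-sets meeting every equipartition of a `tk`-set into `t` parts contains at
least a `1 / t` fraction of all `k`-sets. -/
theorem choose_le_mul_card_of_forall_perm {t k : ℕ} (G : Finset (Finset (Fin t × Fin k)))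
    (hG : ∀ S ∈ G, S.card = k)
    (h : ∀ σ : Equiv.Perm (Fin t × Fin k), ∃ i, (({i} ×ˢ univ).map σ.toEmbedding) ∈ G) :
    (t * k).choose k ≤ t * G.card := by
  have hcover : Fintype.card (Equiv.Perm (Fin t × Fin k)) ≤
      ∑ i : Fin t, #{σ : Equiv.Perm (Fin t × Fin k) | ({i} ×ˢ univ).map σ.toEmbedding ∈ G} := by
    rw [← card_univ]
    refine le_trans (card_le_card ?_) card_biUnion_le
    intro σ _
    simpa using h σ
  have hpos : 0 < Fintype.card (Equiv.Perm (Fin t × Fin k)) := Fintype.card_pos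
  refine Nat.le_of_mul_le_mul_left ?_ hpos
  have hblock := fun i : Fin t => choose_mul_card_perm_map_mem
    (({i} : Finset (Fin t)) ×ˢ (univ : Finset (Fin k))) (by simp) G hG
  simp only [Fintype.card_prod, Fintype.card_fin] at hblock
  calc _ ≤ (∑ i : Fin t, #{σ : Equiv.Perm (Fin t × Fin k) |
            ({i} ×ˢ univ).map σ.toEmbedding ∈ G}) * (t * k).choose k :=
        Nat.mul_le_mul_right _ hcover
    _ = _ := by
      rw [mul_comm, Finset.mul_sum, Finset.sum_congr rfl fun i _ => hblock i]
      simp only [sum_const, card_univ, Fintype.card_fin, smul_eq_mul]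
      ring

/-- If every cover of a `tk`-set `A` by `t` of its `k`-subsets uses a set satisfying `P`, then at
least a `1 / t` fraction of the `k`-subsets of `A` satisfy `P`. -/
theorem choose_le_mul_card_filter [DecidableEq α] {t k : ℕ} (A : Finset α)
    (hA : A.card = t * k) (P : Finset α → Prop) [DecidablePred P]
    (h : ∀ f : Fin t → Finset α, (∀ i, (f i).card = k) → univ.biUnion f = A → ∃ i, P (f i)) :
    (t * k).choose k ≤ t * #{S ∈ powersetCard k A | P S} := by
  have e : Fin t × Fin k ≃ A := Fintype.equivOfCardEq (by simp [hA])
  let g : Fin t × Fin k ↪ α := e.toEmbedding.trans (Function.Embedding.subtype _)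
  have hg : ∀ x, g x ∈ A := fun x => (e x).2
  let G : Finset (Finset (Fin t × Fin k)) := {S ∈ powersetCard k univ | P (S.map g)}
  have hGcard : G.card ≤ #{S ∈ powersetCard k A | P S} := by
    refine card_le_card_of_injOn (fun S => S.map g) ?_ (Finset.map_injective g).injOn
    intro S hS
    simp only [G, coe_filter, mem_powersetCard, Set.mem_ofPred_eq, card_map] at hS ⊢
    refine ⟨⟨fun x hx => ?_, hS.1.2⟩, hS.2⟩
    obtain ⟨y, -, rfl⟩ := mem_map.1 hx
    exact hg y
  refine le_trans (choose_le_mul_card_of_forall_perm G ?_ ?_) (Nat.mul_le_mul_left _ hGcard)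
  · exact fun S hS => (mem_powersetCard.1 (mem_filter.1 hS).1).2
  · intro σ
    obtain ⟨i, hi⟩ := h (fun i => (({i} ×ˢ univ).map σ.toEmbedding).map g) (by simp) (by
      ext x
      simp only [mem_biUnion, mem_univ, true_and]
      constructor
      · rintro ⟨i, hx⟩
        obtain ⟨y, -, rfl⟩ := mem_map.1 hx
        exact hg y
      · intro hx
        refine ⟨(σ.symm (e.symm ⟨x, hx⟩)).1, mem_map.2 ⟨e.symm ⟨x, hx⟩, ?_, by simp [g]⟩⟩
        exact mem_map.2 ⟨σ.symm (e.symm ⟨x, hx⟩), by simp, by simp⟩)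
    exact ⟨i, mem_filter.2 ⟨by simp [mem_powersetCard], hi⟩⟩

/-- `S` is an own subset of `A` in `F` if `A` is the only edge of `F` that may contain `S`. -/
def IsOwnSubset (F : Finset (Finset α)) (A S : Finset α) : Prop :=
  ∀ B ∈ F, S ⊆ B → B = A

/-- `S` is one of `t` sets of size `k` that cover `A`, none of which is an own subset of `A`. -/
def InNonownCover [DecidableEq α] (t k : ℕ) (F : Finset (Finset α)) (A S : Finset α) : Prop :=
  ∃ f : Fin t → Finset α, (∀ i, (f i).card = k) ∧ univ.biUnion f = A ∧
    (∀ i, ¬IsOwnSubset F A (f i)) ∧ ∃ i, f i = S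

theorem InNonownCover.exists_sdiff_subset [DecidableEq α] {t k : ℕ} {F : Finset (Finset α)}
    {A C S : Finset α} (h : InNonownCover t k F A S) (hSC : S ⊆ C) :
    ∃ 𝒜 ⊆ F, 𝒜.card ≤ t - 1 ∧ A ∉ 𝒜 ∧ C ∉ 𝒜 ∧ A \ C ⊆ 𝒜.sup id := by
  obtain ⟨f, -, hfA, hown, i, rfl⟩ := h
  simp only [IsOwnSubset, not_forall] at hown
  choose B hBF hfB hBA using hown
  refine ⟨((univ.erase i).image B).erase C, ?_, ?_, ?_, by simp, ?_⟩
  · intro D hD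
    obtain ⟨j, -, rfl⟩ := mem_image.1 (mem_of_mem_erase hD)
    exact hBF j
  · refine (card_erase_le.trans card_image_le).trans ?_
    simp
  · intro hA
    obtain ⟨j, -, hj⟩ := mem_image.1 (mem_of_mem_erase hA)
    exact hBA j hj
  · intro x hx
    obtain ⟨hxA, hxC⟩ := mem_sdiff.1 hx
    rw [← hfA] at hxA
    obtain ⟨j, -, hj⟩ := mem_biUnion.1 hxA
    have hji : j ≠ i := fun h => hxC (hSC (h ▸ hj))
    refine mem_sup.2 ⟨B j, mem_erase.2 ⟨fun h => hxC (h ▸ hfB j hj), ?_⟩, hfB j hj⟩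
    exact mem_image_of_mem _ (by simp [hji])

theorem IsCancellative.eq_of_inNonownCover [DecidableEq α] {t k : ℕ} {F : Finset (Finset α)}
    (hF : IsCancellative (2 * (t - 1)) F) {A C S : Finset α} (hA : A ∈ F) (hC : C ∈ F)
    (hSA : S ⊆ A) (hSC : S ⊆ C) (h : InNonownCover t k F A S) (h' : InNonownCover t k F C S) :
    A = C := by
  by_contra hne
  obtain ⟨𝒜, h𝒜, hc, hA𝒜, hC𝒜, hs⟩ := h.exists_sdiff_subset hSC
  obtain ⟨ℬ, hℬ, hc', hCℬ, hAℬ, hs'⟩ := h'.exists_sdiff_subset hSA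
  refine hF (𝒜 ∪ ℬ) (union_subset h𝒜 hℬ) ((card_union_le _ _).trans (by omega)) A hA C hC
    (by simp [hA𝒜, hAℬ]) (by simp [hC𝒜, hCℬ]) hne ?_
  rw [sup_union]
  exact union_subset_union hs hs'

theorem IsCancellative.choose_mul_card_le [Fintype α] [DecidableEq α] {t k : ℕ}
    (ht : 0 < t) {F : Finset (Finset α)} (hF : ∀ e ∈ F, e.card = t * k)
    (hcanc : IsCancellative (2 * (t - 1)) F) :
    (t * k).choose k * F.card ≤ t * (Fintype.card α).choose k := by
  classical
  let good : Finset α → Finset (Finset α) := fun A =>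
    {S ∈ powersetCard k A | IsOwnSubset F A S ∨ InNonownCover t k F A S}
  have hgood : ∀ A ∈ F, (t * k).choose k ≤ t * (good A).card := by
    intro A hA
    refine choose_le_mul_card_filter A (hF A hA) _ fun f hf hfA => ?_
    by_contra! hbad
    exact (hbad ⟨0, ht⟩).2 ⟨f, hf, hfA, fun j => (hbad j).1, _, rfl⟩
  have hdisj : (F : Set (Finset α)).PairwiseDisjoint good := by
    intro A hA C hC hne
    refine disjoint_left.2 fun S hS hS' => hne ?_
    simp only [good, mem_filter, mem_powersetCard] at hS hS'
    obtain ⟨⟨hSA, -⟩, hS⟩ := hS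
    obtain ⟨⟨hSC, -⟩, hS'⟩ := hS'
    rcases hS with hS | hS
    · exact (hS C hC hSC).symm
    rcases hS' with hS' | hS'
    · exact hS' A hA hSA
    exact hcanc.eq_of_inNonownCover hA hC hSA hSC hS hS'
  have hsum : ∑ A ∈ F, (good A).card ≤ (Fintype.card α).choose k := by
    rw [← card_biUnion hdisj, ← card_univ, ← card_powersetCard]
    refine card_le_card (biUnion_subset.2 fun A _ => ?_)
    exact (filter_subset _ _).trans (powersetCard_mono (subset_univ A))
  calc (t * k).choose k * F.card = ∑ A ∈ F, (t * k).choose k := by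
        rw [sum_const, smul_eq_mul, mul_comm]
    _ ≤ ∑ A ∈ F, t * (good A).card := sum_le_sum hgood
    _ = t * ∑ A ∈ F, (good A).card := (mul_sum _ _ _).symm
    _ ≤ _ := Nat.mul_le_mul_left _ hsum

theorem Nat.choose_mul_self_eq {t k : ℕ} (ht : 0 < t) (hk : 0 < k) :
    (t * k).choose k = t * (t * k - 1).choose (k - 1) := by
  have h := Nat.add_one_mul_choose_eq (t * k - 1) (k - 1)
  rw [Nat.sub_add_cancel (Nat.mul_pos ht hk), Nat.sub_add_cancel hk] at h
  refine Nat.eq_of_mul_eq_mul_right hk ?_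
  rw [← h]
  ring

theorem exists_card_eq_maxCancellative (t n r : ℕ) :
    ∃ H : Finset (Finset (Fin n)),
      (∀ e ∈ H, e.card = r) ∧ IsCancellative t H ∧ H.card = maxCancellative t n r := by
  refine Nat.sSup_mem (s := {N | ∃ H : Finset (Finset (Fin n)),
    (∀ e ∈ H, e.card = r) ∧ IsCancellative t H ∧ H.card = N}) ⟨0, ∅, ?_⟩ ?_
  · simp [IsCancellative]
  · refine ⟨Fintype.card (Finset (Fin n)), ?_⟩
    rintro N ⟨H, -, -, rfl⟩
    exact card_le_univ H

/-- Every `2(t-1)`-cancellative `tk`-graph `F` on `n` vertices satisfies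
`C(tk, k) · |F| ≤ t · C(n, k)`; equivalently,
`C_{2(t-1)}(n, tk) ≤ C(n, k) / C(tk-1, k-1)`. -/
theorem cancellative_upper_bound (t k n : ℕ) (ht : 2 ≤ t) (hk : 2 ≤ k)
    (F : Finset (Finset (Fin n))) (hF : ∀ e ∈ F, e.card = t * k)
    (hcanc : IsCancellative (2 * (t - 1)) F) :
    (t * k).choose k * F.card ≤ t * n.choose k ∧
    (maxCancellative (2 * (t - 1)) n (t * k) : ℝ) ≤
      (n.choose k : ℝ) / ((t * k - 1).choose (k - 1) : ℝ) := by
  have ht' : 0 < t := by omega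
  refine ⟨by simpa using hcanc.choose_mul_card_le ht' hF, ?_⟩
  obtain ⟨H, hH, hHcanc, hHcard⟩ := exists_card_eq_maxCancellative (2 * (t - 1)) n (t * k)
  have hbound := hHcanc.choose_mul_card_le ht' hH
  rw [Nat.choose_mul_self_eq ht' (by omega), Fintype.card_fin, mul_assoc, hHcard] at hbound
  have hpos : 0 < (t * k - 1).choose (k - 1) :=
    Nat.choose_pos (Nat.sub_le_sub_right (Nat.le_mul_of_pos_left k ht') 1)
  rw [le_div_iff₀ (by exact_mod_cast hpos), mul_comm]
  exact_mod_cast Nat.le_of_mul_le_mul_left hbound ht'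
end
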